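/- Let f : G → G be a graph map with zero topological entropy and let ⟨x,y⟩ ∈ G×G with x ≠ y. Then the following are equivalent: (1) ⟨x,y⟩ is an NS-pair; (2) ⟨x,y⟩ is an IN-pair; (3) ⟨x,y⟩ is an IT-pair. -/

import Mathlib

open Set Filter Topology

/-- An arc in `X` with endpoints `a` and `b`: the image of a continuous injection
of `[0,1]` sending `0` to `a` and `1` to `b`. -/
def IsArcWithEnds {X : Type*} [TopologicalSpace X] (A : Set X) (a b : X) : Prop :=
  ∃ φ : Set.Icc (0:ℝ) 1 → X, Continuous φ ∧ Function.Injective φ ∧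
    Set.range φ = A ∧ φ ⟨0, by norm_num⟩ = a ∧ φ ⟨1, by norm_num⟩ = b

/-- A topological graph: a compact connected (metrizable) space which is a union of
finitely many arcs, any two of which are either disjoint or intersect in exactly one
common endpoint. -/
def IsTopGraph (X : Type*) [TopologicalSpace X] : Prop :=
  CompactSpace X ∧ ConnectedSpace X ∧
  ∃ (n : ℕ) (A : Fin n → Set X) (a b : Fin n → X),
    (∀ i, IsArcWithEnds (A i) (a i) (b i)) ∧
    (⋃ i, A i) = Set.univ ∧
    ∀ i j, i ≠ j →
      A i ∩ A j = ∅ ∨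
      ∃ p, A i ∩ A j = {p} ∧ p ∈ ({a i, b i} : Set X) ∧ p ∈ ({a j, b j} : Set X)

/-- A subgraph of `G`: a closed connected subset which is itself a topological graph. -/
def IsSubgraph {G : Type*} [TopologicalSpace G] (K : Set G) : Prop :=
  IsClosed K ∧ IsConnected K ∧ IsTopGraph ↥K

/-- A periodic subgraph with period `k`: `K, f(K), …, f^{k−1}(K)` are pairwise disjoint
and `f^k(K) = K`. -/
def IsPeriodicSubgraph {G : Type*} [TopologicalSpace G] (f : G → G) (K : Set G) (k : ℕ) :
    Prop :=
  IsSubgraph K ∧ 0 < k ∧ f^[k] '' K = K ∧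
    ∀ i j, i < k → j < k → i ≠ j → Disjoint (f^[i] '' K) (f^[j] '' K)

/-- A cycle of graphs with period `k`: the orbit `⋃_{i<k} f^i(K)` of a periodic
subgraph `K` with period `k`. -/
def IsCycleOfGraphs {G : Type*} [TopologicalSpace G] (f : G → G) (X : Set G) (k : ℕ) :
    Prop :=
  ∃ K, IsPeriodicSubgraph f K k ∧ X = ⋃ i ∈ Finset.range k, f^[i] '' K

/-- The ω-limit set of `x` under `f`. -/
def omegaSet {G : Type*} [TopologicalSpace G] (f : G → G) (x : G) : Set G :=
  ⋂ n : ℕ, closure ((fun m => f^[m] x) '' Set.Ici n)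

/-- `ω(f) = ⋃_{x} ω_f(x)`. -/
def omegaUnion {G : Type*} [TopologicalSpace G] (f : G → G) : Set G :=
  ⋃ x, omegaSet f x

/-- A set `W` is a solenoid for `f` if it is infinite and is contained in cycles of
graphs of arbitrarily large periods. -/
def IsSolenoid {G : Type*} [TopologicalSpace G] (f : G → G) (W : Set G) : Prop :=
  W.Infinite ∧ ∀ n : ℕ, ∃ X k, n ≤ k ∧ IsCycleOfGraphs f X k ∧ W ⊆ X

/-- Two points are separable if they belong to two disjoint periodic subgraphs. -/
def SeparablePoints {G : Type*} [TopologicalSpace G] (f : G → G) (x y : G) : Prop :=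
  ∃ I J kI kJ, IsPeriodicSubgraph f I kI ∧ IsPeriodicSubgraph f J kJ ∧
    Disjoint I J ∧ x ∈ I ∧ y ∈ J

/-- An NS-pair: a pair of distinct points of `ω(f)` contained in a nested sequence of
periodic subgraphs whose periods tend to infinity. -/
def IsNSPair {G : Type*} [TopologicalSpace G] (f : G → G) (x y : G) : Prop :=
  x ≠ y ∧ x ∈ omegaUnion f ∧ y ∈ omegaUnion f ∧
  ∃ (J : ℕ → Set G) (m : ℕ → ℕ),
    (∀ n, IsPeriodicSubgraph f (J n) (m n)) ∧
    (∀ n, J (n + 1) ⊆ J n) ∧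
    Filter.Tendsto m Filter.atTop Filter.atTop ∧
    ∀ n, x ∈ J n ∧ y ∈ J n

/-- The pair `⟨x,y⟩` is proximal. -/
def Proximal {G : Type*} [PseudoMetricSpace G] (f : G → G) (x y : G) : Prop :=
  ∀ ε > (0 : ℝ), ∀ N : ℕ, ∃ n ≥ N, dist (f^[n] x) (f^[n] y) < ε

/-- The pair `⟨x,y⟩` is asymptotic. -/
def Asymptotic {G : Type*} [PseudoMetricSpace G] (f : G → G) (x y : G) : Prop :=
  Filter.Tendsto (fun n => dist (f^[n] x) (f^[n] y)) Filter.atTop (nhds 0)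

/-- A scrambled pair is proximal but not asymptotic. -/
def ScrambledPair {G : Type*} [PseudoMetricSpace G] (f : G → G) (x y : G) : Prop :=
  Proximal f x y ∧ ¬ Asymptotic f x y

/-- Li–Yorke chaos: existence of an uncountable scrambled set. -/
def LiYorkeChaotic {G : Type*} [PseudoMetricSpace G] (f : G → G) : Prop :=
  ∃ S : Set G, ¬ S.Countable ∧ ∀ x ∈ S, ∀ y ∈ S, x ≠ y → ScrambledPair f x y

/-- `I ⊆ ℕ` is an independence set for the pair of sets `{A, B}`. -/
def IsIndepSet {G : Type*} (f : G → G) (A B : Set G) (I : Set ℕ) : Prop :=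
  ∀ J : Finset ℕ, ↑J ⊆ I → J.Nonempty → ∀ S : ℕ → Bool,
    (⋂ i ∈ J, f^[i] ⁻¹' (if S i then A else B)).Nonempty

/-- An IN-pair: every pair of neighborhoods has arbitrarily large finite
independence sets. -/
def IsINPair {G : Type*} [TopologicalSpace G] (f : G → G) (x y : G) : Prop :=
  ∀ U V : Set G, U ∈ nhds x → V ∈ nhds y →
    ∀ n : ℕ, ∃ I : Finset ℕ, n ≤ I.card ∧ IsIndepSet f U V ↑I

/-- An IT-pair: every pair of neighborhoods has an infinite independence set. -/
def IsITPair {G : Type*} [TopologicalSpace G] (f : G → G) (x y : G) : Prop :=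
  ∀ U V : Set G, U ∈ nhds x → V ∈ nhds y →
    ∃ I : Set ℕ, I.Infinite ∧ IsIndepSet f U V I

/-- The set of periodic points of `f`. -/
def PerPts {G : Type*} (f : G → G) : Set G :=
  {p | ∃ n ≥ 1, f^[n] p = p}

/-- A parametrized arc whose open subarcs are open in the ambient space. -/
structure IsOpenArc {G : Type*} [TopologicalSpace G] (γ : ℝ → G) : Prop where
  continuous : Continuous γ
  injOn : InjOn γ (Icc 0 1)
  isOpen : ∀ a b : ℝ, 0 ≤ a → b ≤ 1 → IsOpen (γ '' Ioo a b)

/-- Parametrized edges of a topological graph. -/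
structure IsEdgeSystem {G : Type*} [TopologicalSpace G] {n : ℕ} (ψ : Fin n → ℝ → G) :
    Prop where
  arc : ∀ i, IsOpenArc (ψ i)
  cover : ∀ p, ∃ i, p ∈ ψ i '' Icc 0 1
  disj : ∀ i j, i ≠ j → Disjoint (ψ i '' Ioo 0 1) (ψ j '' Icc 0 1)
  subsingleton : ∀ i j, i ≠ j → (ψ i '' Icc 0 1 ∩ ψ j '' Icc 0 1).Subsingleton

theorem IsTopGraph.exists_edgeSystem {G : Type*} [TopologicalSpace G] [T2Space G]
    (hG : IsTopGraph G) : ∃ (n : ℕ) (ψ : Fin n → ℝ → G), IsEdgeSystem ψ := by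
  obtain ⟨-, -, n, A, a, b, hA, hU, hI⟩ := hG
  choose φ hc hi hr h0 h1 using hA
  have hz : (0:ℝ) ≤ 1 := zero_le_one
  have him : ∀ i, (IccExtend hz (φ i)) '' Icc 0 1 = A i := by
    intro i
    rw [← hr i]
    ext p
    constructor
    · rintro ⟨t, ht, rfl⟩
      exact ⟨⟨t, ht⟩, by rw [IccExtend_of_mem hz _ ht]⟩
    · rintro ⟨t, rfl⟩
      exact ⟨t, t.2, by rw [IccExtend_of_mem hz _ t.2]⟩
  have hcont : ∀ i, Continuous (IccExtend hz (φ i)) := fun i => (hc i).Icc_extend'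
  have hinj : ∀ i, InjOn (IccExtend hz (φ i)) (Icc 0 1) := by
    intro i s hs t ht hst
    rw [IccExtend_of_mem hz _ hs, IccExtend_of_mem hz _ ht] at hst
    exact congrArg Subtype.val (hi i hst)
  have hv0 : ∀ i, IccExtend hz (φ i) 0 = a i := fun i => by
    rw [IccExtend_of_mem hz _ (left_mem_Icc.2 hz)]; exact h0 i
  have hv1 : ∀ i, IccExtend hz (φ i) 1 = b i := fun i => by
    rw [IccExtend_of_mem hz _ (right_mem_Icc.2 hz)]; exact h1 i
  have hdisj : ∀ i j, i ≠ j → Disjoint (IccExtend hz (φ i) '' Ioo 0 1) (A j) := by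
    intro i j hij
    rw [Set.disjoint_left]
    rintro _ ⟨t, ht, rfl⟩ hj
    have hti : IccExtend hz (φ i) t ∈ A i := by
      rw [← him i]; exact mem_image_of_mem _ (Ioo_subset_Icc_self ht)
    rcases hI i j hij with h | ⟨p, hp, hpi, -⟩
    · exact absurd (show _ ∈ A i ∩ A j from ⟨hti, hj⟩) (by rw [h]; exact notMem_empty _)
    · have : IccExtend hz (φ i) t = p := by
        have : IccExtend hz (φ i) t ∈ A i ∩ A j := ⟨hti, hj⟩
        rw [hp] at this; exact this
      rcases hpi with h | h
      · have := hinj i (Ioo_subset_Icc_self ht) (left_mem_Icc.2 hz)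
          (by rw [this, h, hv0])
        exact ht.1.ne' this
      · have := hinj i (Ioo_subset_Icc_self ht) (right_mem_Icc.2 hz)
          (by rw [this, h, hv1])
        exact ht.2.ne this
  refine ⟨n, fun i => IccExtend hz (φ i), ⟨fun i => ⟨hcont i, hinj i, ?_⟩, ?_, ?_, ?_⟩⟩
  · intro s t hs ht
    have : IccExtend hz (φ i) '' Ioo s t =
        (IccExtend hz (φ i) '' (Icc 0 1 \ Ioo s t) ∪ ⋃ j ∈ {j | j ≠ i}, A j)ᶜ := by
      ext p
      constructor
      · rintro ⟨u, hu, rfl⟩ (⟨v, hv, hvu⟩ | hp)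
        · have := hinj i hv.1 ⟨hs.trans hu.1.le, hu.2.le.trans ht⟩ hvu
          exact hv.2 (this ▸ hu)
        · simp only [mem_iUnion] at hp
          obtain ⟨j, hj, hp⟩ := hp
          exact Set.disjoint_left.1 (hdisj i j (Ne.symm hj))
            ⟨u, ⟨hs.trans_lt hu.1, hu.2.trans_le ht⟩, rfl⟩ hp
      · intro hp
        rw [mem_compl_iff, mem_union, not_or] at hp
        have hpU : p ∈ ⋃ i, A i := hU ▸ mem_univ p
        obtain ⟨j, hj⟩ := mem_iUnion.1 hpU
        by_cases hji : j = i
        · subst hji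
          rw [← him j] at hj
          obtain ⟨u, hu, rfl⟩ := hj
          by_contra hcon
          exact hp.1 ⟨u, ⟨hu, fun h => hcon ⟨u, h, rfl⟩⟩, rfl⟩
        · exact absurd (mem_biUnion (x := j) hji hj) hp.2
    rw [this, isOpen_compl_iff]
    refine IsClosed.union ?_ ?_
    · exact ((isCompact_Icc.diff isOpen_Ioo).image (hcont i)).isClosed
    · refine (Set.toFinite _).isClosed_biUnion fun j _ => ?_
      rw [← him j]
      exact (isCompact_Icc.image (hcont j)).isClosed
  · intro p
    have hpU : p ∈ ⋃ i, A i := hU ▸ mem_univ p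
    obtain ⟨j, hj⟩ := mem_iUnion.1 hpU
    exact ⟨j, by rw [him]; exact hj⟩
  · intro i j hij
    simp only [him]
    exact hdisj i j hij
  · intro i j hij
    simp only [him]
    rcases hI i j hij with h | ⟨p, hp, -, -⟩
    · rw [h]; exact subsingleton_empty
    · rw [hp]; exact subsingleton_singleton

namespace IsOpenArc

variable {G : Type*} [TopologicalSpace G] {γ : ℝ → G}

theorem affine (hγ : IsOpenArc γ) {u v : ℝ} (hu : u ∈ Icc (0:ℝ) 1) (hv : v ∈ Icc (0:ℝ) 1)
    (huv : u ≠ v) : IsOpenArc (fun t => γ (u + (v - u) * t)) := by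
  have hmem : ∀ t ∈ Icc (0:ℝ) 1, u + (v - u) * t ∈ Icc (0:ℝ) 1 := by
    intro t ht
    have := (convex_Icc (0:ℝ) 1) hu hv (sub_nonneg.2 ht.2) ht.1 (by ring)
    simp only [smul_eq_mul] at this
    convert this using 1
    ring
  refine ⟨hγ.continuous.comp (by fun_prop), ?_, ?_⟩
  · intro s hs t ht hst
    have := hγ.injOn (hmem s hs) (hmem t ht) hst
    have h2 : (v - u) * s = (v - u) * t := by linarith
    exact mul_left_cancel₀ (sub_ne_zero.2 huv.symm) h2
  · intro a b ha hb
    rcases le_or_gt b a with hba | hab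
    · rw [Ioo_eq_empty (not_lt.2 hba)]; simp
    have ha' := hmem a ⟨ha, hab.le.trans hb⟩
    have hb' := hmem b ⟨ha.trans hab.le, hb⟩
    have himg : (fun t => γ (u + (v - u) * t)) '' Ioo a b =
        γ '' ((fun t => u + (v - u) * t) '' Ioo a b) := by rw [image_image]
    rw [himg]
    rcases lt_or_gt_of_ne huv with h | h
    · have : (fun t => u + (v - u) * t) '' Ioo a b =
          Ioo (u + (v - u) * a) (u + (v - u) * b) := by
        have hpos : 0 < v - u := sub_pos.2 h
        ext w
        constructor
        · rintro ⟨t, ht, rfl⟩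
          exact ⟨by have := mul_lt_mul_of_pos_left ht.1 hpos; linarith,
            by have := mul_lt_mul_of_pos_left ht.2 hpos; linarith⟩
        · intro hw
          refine ⟨(w - u) / (v - u), ⟨?_, ?_⟩, by field_simp; ring⟩
          · rw [lt_div_iff₀ hpos]; linarith [hw.1]
          · rw [div_lt_iff₀ hpos]; linarith [hw.2]
      rw [this]
      exact hγ.isOpen _ _ ha'.1 hb'.2
    · have : (fun t => u + (v - u) * t) '' Ioo a b =
          Ioo (u + (v - u) * b) (u + (v - u) * a) := by
        have hpos : 0 < u - v := sub_pos.2 h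
        ext w
        constructor
        · rintro ⟨t, ht, rfl⟩
          exact ⟨by have := mul_lt_mul_of_pos_left ht.2 hpos; linarith,
            by have := mul_lt_mul_of_pos_left ht.1 hpos; linarith⟩
        · intro hw
          refine ⟨(u - w) / (u - v), ⟨?_, ?_⟩, ?_⟩
          · rw [lt_div_iff₀ hpos]; linarith [hw.2]
          · rw [div_lt_iff₀ hpos]; linarith [hw.1]
          · field_simp; ring
      rw [this]
      exact hγ.isOpen _ _ hb'.1 ha'.2

theorem isOpen_compl_image_Icc [T2Space G] (hγ : IsOpenArc γ) (a b : ℝ) :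
    IsOpen (γ '' Icc a b)ᶜ :=
  (isCompact_Icc.image hγ.continuous).isClosed.isOpen_compl

theorem mem_image_iff (hγ : IsOpenArc γ) {t : ℝ} {S : Set ℝ} (ht : t ∈ Icc (0:ℝ) 1)
    (hS : S ⊆ Icc 0 1) : γ t ∈ γ '' S ↔ t ∈ S := by
  constructor
  · rintro ⟨u, hu, h⟩
    rwa [← hγ.injOn (hS hu) ht h]
  · exact mem_image_of_mem _

/-- A connected set meeting an open subarc but missing its two ends lies in it. -/
theorem subset_of_isPreconnected [T2Space G] (hγ : IsOpenArc γ) {C : Set G}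
    (hC : IsPreconnected C) {q p q' : ℝ} (h0 : 0 ≤ q) (hqp : q < p) (hpq : p < q')
    (h1 : q' ≤ 1) (hp : γ p ∈ C) (hq : γ q ∉ C) (hq' : γ q' ∉ C) : C ⊆ γ '' Ioo q q' := by
  refine hC.subset_left_of_subset_union (hγ.isOpen q q' h0 h1)
    (hγ.isOpen_compl_image_Icc q q') ?_ ?_ ⟨_, hp, mem_image_of_mem _ ⟨hqp, hpq⟩⟩
  · rw [Set.disjoint_compl_right_iff_subset]
    exact image_mono Ioo_subset_Icc_self
  · intro c hc
    by_cases h : c ∈ γ '' Icc q q'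
    · left
      obtain ⟨t, ht, rfl⟩ := h
      refine mem_image_of_mem _ ⟨lt_of_le_of_ne ht.1 ?_, lt_of_le_of_ne ht.2 ?_⟩
      · rintro rfl; exact hq hc
      · rintro rfl; exact hq' hc
    · right; exact h

/-- Initial subarcs eventually lie inside or outside a given connected set. -/
theorem dichotomy [T2Space G] (hγ : IsOpenArc γ) {C : Set G} (hC : IsPreconnected C) :
    ∃ s, 0 < s ∧ s ≤ 1 ∧ (γ '' Ioc 0 s ⊆ C ∨ Disjoint (γ '' Ioc 0 s) C) := by
  by_contra! hcon
  have h1 : ∀ s, 0 < s → s ≤ 1 → ∃ q, 0 < q ∧ q ≤ s ∧ γ q ∉ C := by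
    intro s hs hs1
    have := (hcon s hs hs1).1
    rw [Set.not_subset] at this
    obtain ⟨_, ⟨q, hq, rfl⟩, h⟩ := this
    exact ⟨q, hq.1, hq.2, h⟩
  have h2 : ∀ s, 0 < s → s ≤ 1 → ∃ q, 0 < q ∧ q ≤ s ∧ γ q ∈ C := by
    intro s hs hs1
    have := (hcon s hs hs1).2
    rw [Set.not_disjoint_iff] at this
    obtain ⟨_, ⟨q, hq, rfl⟩, h⟩ := this
    exact ⟨q, hq.1, hq.2, h⟩
  obtain ⟨q', hq'0, hq'1, hq'⟩ := h1 1 one_pos le_rfl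
  obtain ⟨p, hp0, hp1, hp⟩ := h2 (q' / 2) (by linarith) (by linarith)
  obtain ⟨q, hq0, hq1, hq⟩ := h1 (p / 2) (by linarith) (by linarith)
  have hsub := hγ.subset_of_isPreconnected hC hq0.le (by linarith) (by linarith : p < q')
    hq'1 hp hq hq'
  obtain ⟨u, hu0, hu1, hu⟩ := h2 q hq0 (by linarith)
  have := (hγ.mem_image_iff ⟨hu0.le, by linarith⟩
    (fun t ht => ⟨hq0.le.trans ht.1.le, ht.2.le.trans hq'1⟩)).1 (hsub hu)
  exact absurd this.1 (not_lt.2 hu1)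

theorem dichotomy_iUnion [T2Space G] (hγ : IsOpenArc γ) {ι : Type*} [Finite ι]
    {C : ι → Set G} (hC : ∀ i, IsPreconnected (C i)) :
    ∃ s, 0 < s ∧ s ≤ 1 ∧ (γ '' Ioc 0 s ⊆ ⋃ i, C i ∨ Disjoint (γ '' Ioc 0 s) (⋃ i, C i)) := by
  choose s hs0 hs1 hs using fun i => hγ.dichotomy (hC i)
  by_cases h : ∃ i, γ '' Ioc 0 (s i) ⊆ C i
  · obtain ⟨i, hi⟩ := h
    exact ⟨s i, hs0 i, hs1 i, Or.inl (hi.trans (subset_iUnion C i))⟩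
  · push Not at h
    have hd : ∀ i, Disjoint (γ '' Ioc 0 (s i)) (C i) := fun i => (hs i).resolve_left (h i)
    obtain ⟨m, hm0, hm1, hm⟩ : ∃ m : ℝ, 0 < m ∧ m ≤ 1 ∧ ∀ i, m ≤ s i := by
      cases isEmpty_or_nonempty ι
      · exact ⟨1, one_pos, le_rfl, fun i => isEmptyElim i⟩
      · obtain ⟨i, hi⟩ := Finite.exists_min s
        exact ⟨s i, hs0 i, hs1 i, hi⟩
    refine ⟨m, hm0, hm1, Or.inr ?_⟩
    rw [disjoint_iUnion_right]
    exact fun i => (hd i).mono_left (image_mono (Ioc_subset_Ioc_right (hm i)))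

/-- Along an open arc, a connected set has at most three frontier points. -/
theorem encard_frontier_inter_le [T2Space G] (hγ : IsOpenArc γ) {C : Set G}
    (hC : IsPreconnected C) : (frontier C ∩ γ '' Ioo 0 1).encard ≤ 3 := by
  by_contra! hcon
  set T : Set ℝ := {t | t ∈ Ioo (0:ℝ) 1 ∧ γ t ∈ frontier C} with hT
  have himg : frontier C ∩ γ '' Ioo 0 1 = γ '' T := by
    ext p
    constructor
    · rintro ⟨hp, t, ht, rfl⟩; exact ⟨t, ⟨ht, hp⟩, rfl⟩
    · rintro ⟨t, ⟨ht, hp⟩, rfl⟩; exact ⟨hp, t, ht, rfl⟩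
  rw [himg] at hcon
  have h4 : (4 : ℕ∞) ≤ T.encard := by
    have h1 := (Order.add_one_le_of_lt hcon).trans (encard_image_le γ T)
    exact le_trans (by norm_num) h1
  obtain ⟨F, hFT, hF⟩ := Set.exists_subset_encard_eq h4
  have hFfin : F.Finite := Set.finite_of_encard_eq_coe (k := 4) hF
  have hFcard : hFfin.toFinset.card = 4 := by
    have := hFfin.encard_eq_coe_toFinset_card
    rw [hF] at this
    exact_mod_cast this.symm
  set e := hFfin.toFinset.orderEmbOfFin hFcard
  have he : ∀ k, e k ∈ T := fun k => hFT (hFfin.mem_toFinset.1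
    (Finset.orderEmbOfFin_mem _ hFcard k))
  have h01 : e 0 < e 1 := e.strictMono (by decide)
  have h12 : e 1 < e 2 := e.strictMono (by decide)
  have h23 : e 2 < e 3 := e.strictMono (by decide)
  have key : ∀ t ∈ T, ∀ a b : ℝ, 0 ≤ a → b ≤ 1 → a < t → t < b →
      (∃ u ∈ Ioo a b, γ u ∈ C) ∧ ∃ u ∈ Ioo a b, γ u ∉ C := by
    intro t ht a b ha hb hat htb
    have hop := hγ.isOpen a b ha hb
    have hmem : γ t ∈ γ '' Ioo a b := mem_image_of_mem _ ⟨hat, htb⟩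
    have hf := ht.2
    rw [frontier_eq_closure_inter_closure] at hf
    obtain ⟨_, ⟨u, hu, rfl⟩, hu'⟩ := mem_closure_iff.1 hf.1 _ hop hmem
    obtain ⟨_, ⟨v, hv, rfl⟩, hv'⟩ := mem_closure_iff.1 hf.2 _ hop hmem
    exact ⟨⟨u, hu, hu'⟩, v, hv, hv'⟩
  have m0 := (he 0).1
  have m3 := (he 3).1
  obtain ⟨-, o1, ho1, hO1⟩ := key _ (he 0) 0 ((e 0 + e 1) / 2) le_rfl
    (by linarith [m3.2]) m0.1 (by linarith)
  obtain ⟨⟨i2, hi2, hI2⟩, -⟩ := key _ (he 1) ((e 0 + e 1) / 2) ((e 1 + e 2) / 2)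
    (by linarith [m0.1]) (by linarith [m3.2]) (by linarith) (by linarith)
  obtain ⟨-, o3, ho3, hO3⟩ := key _ (he 2) ((e 1 + e 2) / 2) ((e 2 + e 3) / 2)
    (by linarith [m0.1]) (by linarith [m3.2]) (by linarith) (by linarith)
  obtain ⟨⟨i4, hi4, hI4⟩, -⟩ := key _ (he 3) ((e 2 + e 3) / 2) 1
    (by linarith [m0.1]) le_rfl (by linarith) (by linarith [m3.2])
  simp only [mem_Ioo] at ho1 hi2 ho3 hi4
  have hsub := hγ.subset_of_isPreconnected hC ho1.1.le (by linarith : o1 < i2)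
    (by linarith : i2 < o3) (by linarith) hI2 hO1 hO3
  have := (hγ.mem_image_iff ⟨by linarith, by linarith⟩
    (fun t ht => ⟨ho1.1.le.trans ht.1.le, ht.2.le.trans (by linarith)⟩)).1 (hsub hI4)
  linarith [this.2]

end IsOpenArc

theorem frontier_iUnion_subset {X ι : Type*} [TopologicalSpace X] [Finite ι] (C : ι → Set X) :
    frontier (⋃ i, C i) ⊆ ⋃ i, frontier (C i) := by
  intro p hp
  rw [frontier, closure_iUnion_of_finite] at hp
  obtain ⟨i, hi⟩ := mem_iUnion.1 hp.1
  exact mem_iUnion.2 ⟨i, hi, fun h => hp.2 (interior_mono (subset_iUnion C i) h)⟩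

/-- Frontiers of unions of `k` connected sets have uniformly bounded cardinality. -/
def HasFrontierBound (G : Type*) [TopologicalSpace G] (N : ℕ) : Prop :=
  ∀ C : Set G, IsPreconnected C → (frontier C).encard ≤ N

theorem HasFrontierBound.iUnion {G : Type*} [TopologicalSpace G] {N : ℕ}
    (hN : HasFrontierBound G N) {k : ℕ} {C : Fin k → Set G} (hC : ∀ i, IsPreconnected (C i)) :
    (frontier (⋃ i, C i)).encard ≤ (k * N : ℕ) := by
  refine (encard_le_encard (frontier_iUnion_subset C)).trans ?_
  refine (encard_iUnion_le_of_fintype _).trans ?_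
  refine (Finset.sum_le_sum fun i _ => hN _ (hC i)).trans ?_
  simp

namespace IsEdgeSystem

variable {G : Type*} [TopologicalSpace G] [T2Space G] {n : ℕ} {ψ : Fin n → ℝ → G}

theorem exists_hasFrontierBound (hψ : IsEdgeSystem ψ) : ∃ N, HasFrontierBound G N := by
  refine ⟨n * 5, fun C hC => ?_⟩
  have hsub : frontier C ⊆ ⋃ i, (frontier C ∩ ψ i '' Ioo 0 1 ∪ {ψ i 0, ψ i 1}) := by
    intro p hp
    obtain ⟨i, t, ht, rfl⟩ := hψ.cover p
    refine mem_iUnion.2 ⟨i, ?_⟩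
    rcases eq_or_lt_of_le ht.1 with h | h
    · right; left; rw [← h]
    rcases eq_or_lt_of_le ht.2 with h' | h'
    · right; right; rw [h']; rfl
    · left; exact ⟨hp, t, ⟨h, h'⟩, rfl⟩
  refine (encard_le_encard hsub).trans ?_
  refine (encard_iUnion_le_of_fintype _).trans ?_
  have : ∀ i, (frontier C ∩ ψ i '' Ioo 0 1 ∪ {ψ i 0, ψ i 1}).encard ≤ 5 := by
    intro i
    refine (encard_union_le _ _).trans ?_
    have h2 : ({ψ i 0, ψ i 1} : Set G).encard ≤ 2 := by
      refine (encard_insert_le _ _).trans ?_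
      rw [encard_singleton]; norm_num
    calc _ ≤ (3 : ℕ∞) + 2 := add_le_add ((hψ.arc i).encard_frontier_inter_le hC) h2
      _ = 5 := by norm_num
  refine (Finset.sum_le_sum fun i _ => this i).trans ?_
  simp

/-- A connected set containing no vertex lies inside an open edge. -/
theorem subset_edge (hψ : IsEdgeSystem ψ) {C : Set G} (hC : IsPreconnected C)
    (hne : C.Nonempty) (h0 : ∀ i, ψ i 0 ∉ C) (h1 : ∀ i, ψ i 1 ∉ C) :
    ∃ i, C ⊆ ψ i '' Ioo 0 1 := by
  obtain ⟨p, hp⟩ := hne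
  obtain ⟨i, t, ht, rfl⟩ := hψ.cover p
  refine ⟨i, (hψ.arc i).subset_of_isPreconnected hC le_rfl
    (lt_of_le_of_ne ht.1 ?_) (lt_of_le_of_ne ht.2 ?_) le_rfl hp (h0 i) (h1 i)⟩
  · rintro rfl; exact h0 i hp
  · rintro rfl; exact h1 i hp

theorem _root_.IsOpenArc.exists_germs_nhds {γ : ℝ → G} (hγ : IsOpenArc γ) (x : G) :
    ∃ Γ : Set (ℝ → G), Γ.Finite ∧ (∀ β ∈ Γ, IsOpenArc β ∧ β 0 = x) ∧
      ∀ s > 0, ∀ᶠ p in 𝓝 x, p ∈ γ '' Icc 0 1 → p = x ∨ ∃ β ∈ Γ, p ∈ β '' Ioc 0 s := by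
  by_cases hx : x ∈ γ '' Icc 0 1
  · obtain ⟨t, ht, rfl⟩ := hx
    have h1 : (1:ℝ) ∈ Icc (0:ℝ) 1 := by simp
    have h0 : (0:ℝ) ∈ Icc (0:ℝ) 1 := by simp
    refine ⟨{β | (t ≠ 1 ∧ β = fun u => γ (t + (1 - t) * u)) ∨
      (t ≠ 0 ∧ β = fun u => γ (t + (0 - t) * u))}, ?_, ?_, ?_⟩
    · refine (Set.toFinite {(fun u => γ (t + (1 - t) * u)), (fun u => γ (t + (0 - t) * u))}
        ).subset ?_
      rintro β (⟨-, rfl⟩ | ⟨-, rfl⟩) <;> simp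
    · rintro β (⟨h, rfl⟩ | ⟨h, rfl⟩)
      · exact ⟨hγ.affine ht h1 h, by simp⟩
      · exact ⟨hγ.affine ht h0 h, by simp⟩
    · intro s hs
      obtain ⟨δ, hδ, hδ1, hδ0⟩ : ∃ δ > 0, (t ≠ 1 → δ ≤ (1 - t) * s) ∧ (t ≠ 0 → δ ≤ t * s) := by
        rcases eq_or_lt_of_le ht.1 with h | h
        · exact ⟨s, hs, fun _ => by rw [← h]; simp, fun h' => absurd h.symm h'⟩
        · rcases eq_or_lt_of_le ht.2 with h' | h'
          · exact ⟨s, hs, fun h'' => absurd h' h'', fun _ => by rw [h']; simp⟩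
          · exact ⟨min ((1 - t) * s) (t * s), lt_min (mul_pos (sub_pos.2 h') hs) (mul_pos h hs),
              fun _ => min_le_left _ _, fun _ => min_le_right _ _⟩
      have hK : IsClosed (γ '' (Icc 0 1 \ Ioo (t - δ) (t + δ))) :=
        ((isCompact_Icc.diff isOpen_Ioo).image hγ.continuous).isClosed
      have hxK : γ t ∉ γ '' (Icc 0 1 \ Ioo (t - δ) (t + δ)) := by
        rw [hγ.mem_image_iff ht sdiff_subset]
        exact fun h => h.2 ⟨by linarith, by linarith⟩
      filter_upwards [hK.isOpen_compl.mem_nhds hxK]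
      rintro _ hp ⟨u, hu, rfl⟩
      have hu' : u ∈ Ioo (t - δ) (t + δ) := by
        by_contra hcon
        exact hp ⟨u, ⟨hu, hcon⟩, rfl⟩
      rcases lt_trichotomy u t with h | h | h
      · right
        have ht0 : 0 < t := hu.1.trans_lt h
        refine ⟨_, Or.inr ⟨ht0.ne', rfl⟩, (t - u) / t, ⟨by apply div_pos <;> linarith, ?_⟩, ?_⟩
        · rw [div_le_iff₀ ht0]; linarith [hδ0 ht0.ne', hu'.1]
        · simp only; congr 1; field_simp; ring
      · left; rw [h]
      · right
        have ht1 : 0 < 1 - t := by linarith [hu.2]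
        refine ⟨_, Or.inl ⟨by linarith, rfl⟩, (u - t) / (1 - t),
          ⟨by apply div_pos <;> linarith, ?_⟩, ?_⟩
        · rw [div_le_iff₀ ht1]; linarith [hδ1 (by linarith), hu'.2]
        · simp only; congr 1; field_simp; ring
  · refine ⟨∅, Set.finite_empty, by simp, fun s _ => ?_⟩
    filter_upwards [(isCompact_Icc.image hγ.continuous).isClosed.isOpen_compl.mem_nhds hx]
      with p hp h using absurd h hp

/-- Every point has finitely many germs of arcs whose initial segments, together with the point
itself, form neighborhoods. -/
theorem exists_germs_nhds (hψ : IsEdgeSystem ψ) (x : G) :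
    ∃ Γ : Set (ℝ → G), Γ.Finite ∧ (∀ β ∈ Γ, IsOpenArc β ∧ β 0 = x) ∧
      ∀ s > 0, {x} ∪ ⋃ β ∈ Γ, β '' Ioc 0 s ∈ 𝓝 x := by
  choose Γ hfin hΓ hn using fun i => (hψ.arc i).exists_germs_nhds x
  refine ⟨⋃ i, Γ i, Set.finite_iUnion hfin, ?_, fun s hs => ?_⟩
  · intro β hβ
    obtain ⟨i, hi⟩ := mem_iUnion.1 hβ
    exact hΓ i β hi
  · filter_upwards [eventually_all.2 fun i => hn i s hs] with p hp
    obtain ⟨i, hi⟩ := hψ.cover p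
    rcases hp i hi with h | ⟨β, hβ, h⟩
    · left; exact h
    · right; exact mem_biUnion (mem_iUnion.2 ⟨i, hβ⟩) h

end IsEdgeSystem

/-- `P` is a finite set of disjoint subintervals of `[0,1]` with union `T`. -/
def IsIntervalPartition (P : Set (ℝ × ℝ)) (T : Set ℝ) : Prop :=
  P.Finite ∧ (∀ p ∈ P, 0 ≤ p.1 ∧ p.1 ≤ p.2 ∧ p.2 ≤ 1) ∧
    (∀ p ∈ P, ∀ q ∈ P, p ≠ q → Disjoint (Icc p.1 p.2) (Icc q.1 q.2)) ∧
    T = ⋃ p ∈ P, Icc p.1 p.2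

theorem exists_isIntervalPartition_of_ordConnected {T : Set ℝ} (hT : IsClosed T)
    (h01 : T ⊆ Icc 0 1) (ho : T.OrdConnected) : ∃ P, IsIntervalPartition P T := by
  rcases T.eq_empty_or_nonempty with rfl | hne
  · exact ⟨∅, by simp, by simp, by simp, by simp⟩
  · have hc : IsCompact T := isCompact_Icc.of_isClosed_subset hT h01
    have hcon : IsConnected T := ⟨hne, ho.isPreconnected⟩
    have := eq_Icc_of_connected_compact hcon hc
    refine ⟨{(sInf T, sSup T)}, by simp, ?_, by simp +contextual, by simpa using this⟩
    rintro p rfl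
    exact ⟨(h01 (hc.sInf_mem hne)).1, csInf_le_csSup hne hc.bddBelow hc.bddAbove,
      (h01 (hc.sSup_mem hne)).2⟩

theorem exists_isIntervalPartition_of_ordConnected_diff {T : Set ℝ} (hT : IsClosed T)
    (h01 : T ⊆ Icc 0 1) (ho : (Icc 0 1 \ T).OrdConnected) : ∃ P, IsIntervalPartition P T := by
  rcases (Icc 0 1 \ T).eq_empty_or_nonempty with h | ⟨j, hj⟩
  · have : T = Icc 0 1 := h01.antisymm (sdiff_eq_empty.1 h)
    refine exists_isIntervalPartition_of_ordConnected hT h01 ?_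
    rw [this]; exact ordConnected_Icc
  · obtain ⟨P, hP⟩ := exists_isIntervalPartition_of_ordConnected (T := T ∩ Iic j)
      (hT.inter isClosed_Iic) (inter_subset_left.trans h01) ⟨by
        intro a ha b hb c hc
        refine ⟨?_, hc.2.trans hb.2⟩
        by_contra hcT
        have : b ∈ Icc 0 1 \ T := ho.out ⟨⟨(h01 ha.1).1.trans hc.1, hc.2.trans (h01 hb.1).2⟩, hcT⟩
          hj ⟨hc.2, hb.2⟩
        exact this.2 hb.1⟩
    obtain ⟨Q, hQ⟩ := exists_isIntervalPartition_of_ordConnected (T := T ∩ Ici j)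
      (hT.inter isClosed_Ici) (inter_subset_left.trans h01) ⟨by
        intro a ha b hb c hc
        refine ⟨?_, ha.2.trans hc.1⟩
        by_contra hcT
        have : a ∈ Icc 0 1 \ T := ho.out hj
          ⟨⟨(h01 ha.1).1.trans hc.1, hc.2.trans (h01 hb.1).2⟩, hcT⟩ ⟨ha.2, hc.1⟩
        exact this.2 ha.1⟩
    have hdis : ∀ p ∈ P, ∀ q ∈ Q, Disjoint (Icc p.1 p.2) (Icc q.1 q.2) := by
      intro p hp q hq
      rw [Set.disjoint_left]
      intro t htp htq
      have h1 : t ∈ T ∩ Iic j := by rw [hP.2.2.2]; exact mem_biUnion hp htp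
      have h2 : t ∈ T ∩ Ici j := by rw [hQ.2.2.2]; exact mem_biUnion hq htq
      have : t = j := le_antisymm h1.2 h2.2
      exact hj.2 (this ▸ h1.1)
    refine ⟨P ∪ Q, hP.1.union hQ.1, ?_, ?_, ?_⟩
    · rintro p (hp | hp)
      · exact hP.2.1 p hp
      · exact hQ.2.1 p hp
    · rintro p (hp | hp) q (hq | hq) hpq
      · exact hP.2.2.1 p hp q hq hpq
      · exact hdis p hp q hq
      · exact (hdis q hq p hp).symm
      · exact hQ.2.2.1 p hp q hq hpq
    · rw [biUnion_union, ← hP.2.2.2, ← hQ.2.2.2, ← inter_union_distrib_left, Iic_union_Ici,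
        inter_univ]

theorem IsOpenArc.exists_isIntervalPartition {G : Type*} [TopologicalSpace G] [T2Space G]
    {γ : ℝ → G} (hγ : IsOpenArc γ) {C : Set G} (hC : IsPreconnected C) (hcl : IsClosed C) :
    ∃ P, IsIntervalPartition P (Icc 0 1 ∩ γ ⁻¹' C) := by
  have hT : IsClosed (Icc 0 1 ∩ γ ⁻¹' C) := isClosed_Icc.inter (hcl.preimage hγ.continuous)
  by_cases h : (Icc 0 1 \ (Icc 0 1 ∩ γ ⁻¹' C)).OrdConnected
  · exact exists_isIntervalPartition_of_ordConnected_diff hT inter_subset_left h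
  refine exists_isIntervalPartition_of_ordConnected hT inter_subset_left ?_
  rw [ordConnected_iff] at h
  push Not at h
  obtain ⟨q, hq, q', hq', hqq', h⟩ := h
  rw [Set.not_subset] at h
  obtain ⟨p, hp, hpT⟩ := h
  have hq0 : γ q ∉ C := fun h => hq.2 ⟨hq.1, h⟩
  have hq'0 : γ q' ∉ C := fun h => hq'.2 ⟨hq'.1, h⟩
  have hpm : p ∈ Icc (0:ℝ) 1 := ⟨hq.1.1.trans hp.1, hp.2.trans hq'.1.2⟩
  have hp0 : γ p ∈ C := by
    by_contra hcon
    exact hpT ⟨hpm, fun h => hcon h.2⟩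
  have hsub := hγ.subset_of_isPreconnected hC hq.1.1
    (lt_of_le_of_ne hp.1 (by rintro rfl; exact hq0 hp0))
    (lt_of_le_of_ne hp.2 (by rintro rfl; exact hq'0 hp0)) hq'.1.2 hp0 hq0 hq'0
  have hIoo : ∀ t, Icc (0:ℝ) 1 t → γ t ∈ C → t ∈ Ioo q q' := fun t ht htC =>
    (hγ.mem_image_iff ht (fun t ht => ⟨hq.1.1.trans ht.1.le, ht.2.le.trans hq'.1.2⟩)).1
      (hsub htC)
  refine ⟨fun a ha b hb c hc => ?_⟩
  have hcm : c ∈ Icc (0:ℝ) 1 := ⟨ha.1.1.trans hc.1, hc.2.trans hb.1.2⟩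
  refine ⟨hcm, ?_⟩
  by_contra hcC
  have hac : a < c := lt_of_le_of_ne hc.1 (by rintro rfl; exact hcC ha.2)
  have hcb : c < b := lt_of_le_of_ne hc.2 (by rintro rfl; exact hcC hb.2)
  have haq := hIoo a ha.1 ha.2
  have hbq := hIoo b hb.1 hb.2
  have := hγ.subset_of_isPreconnected hC hq.1.1 haq.1 hac hcm.2 ha.2 hq0 hcC hb.2
  have := (hγ.mem_image_iff hb.1 (fun t ht => ⟨hq.1.1.trans ht.1.le, ht.2.le.trans hcm.2⟩)).1 this
  exact absurd this.2 (not_lt.2 hcb.le)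

theorem IsEdgeSystem.isTopGraph_coe {G : Type*} [TopologicalSpace G] [T2Space G]
    [CompactSpace G] {n : ℕ} {ψ : Fin n → ℝ → G} (hψ : IsEdgeSystem ψ) {C : Set G}
    (hC : IsConnected C) (hcl : IsClosed C) (hnt : C.Nontrivial) : IsTopGraph ↥C := by
  choose P hP using fun i => (hψ.arc i).exists_isIntervalPartition hC.isPreconnected hcl
  have hPmem : ∀ i, ∀ p ∈ P i, ∀ t ∈ Icc p.1 p.2, t ∈ Icc (0:ℝ) 1 ∧ ψ i t ∈ C := by
    intro i p hp t ht
    have : t ∈ Icc 0 1 ∩ ψ i ⁻¹' C := by rw [(hP i).2.2.2]; exact mem_biUnion hp ht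
    exact this
  let Q : Set (Fin n × ℝ × ℝ) := {a | a.2 ∈ P a.1 ∧ a.2.1 < a.2.2}
  have hQ : Q.Finite := by
    have : Q ⊆ ⋃ i, (fun p => (i, p)) '' P i := by
      rintro ⟨i, p⟩ ⟨h, -⟩
      exact mem_iUnion.2 ⟨i, p, h, rfl⟩
    exact (Set.finite_iUnion fun i => ((hP i).1.image _)).subset this
  have : Finite Q := hQ
  obtain ⟨m, ⟨e⟩⟩ := Finite.exists_equiv_fin Q
  let d : Fin m → Fin n × ℝ × ℝ := fun j => (e.symm j : Q)
  have hd : ∀ j, d j ∈ Q := fun j => (e.symm j).2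
  have hdinj : Function.Injective d := Subtype.val_injective.comp e.symm.injective
  have hpar : ∀ j, ∀ u : Icc (0:ℝ) 1, (d j).2.1 + ((d j).2.2 - (d j).2.1) * u ∈
      Icc (d j).2.1 (d j).2.2 := by
    intro j u
    have h1 := (hd j).2
    constructor
    · nlinarith [u.2.1, u.2.2]
    · nlinarith [u.2.1, u.2.2]
  have hcover : C ⊆ ⋃ j, ψ (d j).1 '' Icc (d j).2.1 (d j).2.2 := by
    set M := ⋃ j, ψ (d j).1 '' Icc (d j).2.1 (d j).2.2 with hM
    have hMcl : IsClosed M := isClosed_iUnion_of_finite fun j =>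
      (isCompact_Icc.image (hψ.arc _).continuous).isClosed
    have hF : (C \ M).Finite := by
      refine (Set.finite_iUnion fun i => ((hP i).1.image fun p => ψ i p.1)).subset ?_
      rintro c ⟨hc, hcM⟩
      obtain ⟨i, t, ht, rfl⟩ := hψ.cover c
      have : t ∈ Icc 0 1 ∩ ψ i ⁻¹' C := ⟨ht, hc⟩
      rw [(hP i).2.2.2] at this
      obtain ⟨p, hp, htp⟩ := mem_iUnion₂.1 this
      refine mem_iUnion.2 ⟨i, p, hp, ?_⟩
      rcases lt_or_ge p.1 p.2 with h | h
      · refine absurd ?_ hcM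
        have hq : (i, p) ∈ Q := ⟨hp, h⟩
        refine mem_iUnion.2 ⟨e ⟨_, hq⟩, ?_⟩
        have : d (e ⟨_, hq⟩) = (i, p) := by simp [d]
        rw [this]
        exact mem_image_of_mem _ htp
      · have : t = p.1 := le_antisymm (htp.2.trans h) htp.1
        simp only [this]
    by_contra hcon
    obtain ⟨c, hc, hcM⟩ := Set.not_subset.1 hcon
    have hpre := isPreconnected_closed_iff.1 hC.isPreconnected M (C \ M) hMcl hF.isClosed
      (fun a ha => by by_cases h : a ∈ M; exacts [Or.inl h, Or.inr ⟨ha, h⟩])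
    rcases (C ∩ M).eq_empty_or_nonempty with h | h
    · refine hC.isPreconnected.infinite_of_nontrivial hnt (hF.subset fun a ha => ⟨ha, fun h' => ?_⟩)
      exact (h ▸ (⟨ha, h'⟩ : a ∈ C ∩ M) : a ∈ (∅ : Set G))
    · obtain ⟨a, -, h1, h2⟩ := hpre h ⟨c, hc, hc, hcM⟩
      exact h2.2 h1
  refine ⟨isCompact_iff_compactSpace.1 hcl.isCompact, isConnected_iff_connectedSpace.1 hC, m,
    fun j => {c | (c : G) ∈ ψ (d j).1 '' Icc (d j).2.1 (d j).2.2},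
    fun j => ⟨ψ (d j).1 (d j).2.1, (hPmem _ _ (hd j).1 _ ⟨le_rfl, (hd j).2.le⟩).2⟩,
    fun j => ⟨ψ (d j).1 (d j).2.2, (hPmem _ _ (hd j).1 _ ⟨(hd j).2.le, le_rfl⟩).2⟩,
    fun j => ?_, ?_, fun j k hjk => ?_⟩
  · refine ⟨fun u => ⟨ψ (d j).1 ((d j).2.1 + ((d j).2.2 - (d j).2.1) * u),
      (hPmem _ _ (hd j).1 _ (hpar j u)).2⟩, ?_, ?_, ?_, ?_, ?_⟩
    · refine Continuous.subtype_mk ?_ _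
      exact (hψ.arc _).continuous.comp (by fun_prop)
    · intro u v huv
      have := (hψ.arc _).injOn (hPmem _ _ (hd j).1 _ (hpar j u)).1
        (hPmem _ _ (hd j).1 _ (hpar j v)).1 (congrArg Subtype.val huv)
      have h2 : ((d j).2.2 - (d j).2.1) * (u:ℝ) = ((d j).2.2 - (d j).2.1) * v := by linarith
      exact Subtype.ext (mul_left_cancel₀ (sub_ne_zero.2 (hd j).2.ne') h2)
    · ext c
      constructor
      · rintro ⟨u, rfl⟩
        exact mem_image_of_mem _ (hpar j u)
      · rintro ⟨t, ht, htc⟩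
        have hpos := sub_pos.2 (hd j).2
        refine ⟨⟨(t - (d j).2.1) / ((d j).2.2 - (d j).2.1), ?_, ?_⟩, ?_⟩
        · exact div_nonneg (by linarith [ht.1]) hpos.le
        · rw [div_le_one hpos]; linarith [ht.2]
        · refine Subtype.ext ?_
          rw [← htc]
          simp only
          congr 1
          field_simp
          ring
    · simp
    · simp
  · refine eq_univ_of_forall fun c => ?_
    obtain ⟨j, hj⟩ := mem_iUnion.1 (hcover c.2)
    exact mem_iUnion.2 ⟨j, hj⟩
  · by_cases hedge : (d j).1 = (d k).1
    · left
      refine eq_empty_of_forall_notMem ?_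
      rintro c ⟨⟨t, ht, htc⟩, ⟨s, hs, hsc⟩⟩
      have hne : (d j).2 ≠ (d k).2 := fun h => hjk (hdinj (Prod.ext hedge h))
      have hkP := (hd k).1
      have hkI := hPmem _ _ (hd k).1 _ hs
      rw [← hedge] at hkP hkI hsc
      have hdis := (hP (d j).1).2.2.1 _ (hd j).1 _ hkP hne
      have hts := (hψ.arc _).injOn (hPmem _ _ (hd j).1 _ ht).1 hkI.1 (htc.trans hsc.symm)
      exact Set.disjoint_left.1 hdis ht (hts ▸ hs)
    · rcases ({c : ↥C | (c : G) ∈ ψ (d j).1 '' Icc (d j).2.1 (d j).2.2} ∩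
        {c : ↥C | (c : G) ∈ ψ (d k).1 '' Icc (d k).2.1 (d k).2.2}).eq_empty_or_nonempty
        with h | ⟨c, hc⟩
      · exact Or.inl h
      · right
        have hIcc : ∀ l, ψ (d l).1 '' Icc (d l).2.1 (d l).2.2 ⊆ ψ (d l).1 '' Icc 0 1 :=
          fun l => image_mono fun t ht => (hPmem _ _ (hd l).1 t ht).1
        have hend : ∀ j k, (d j).1 ≠ (d k).1 → (c : G) ∈ ψ (d j).1 '' Icc (d j).2.1 (d j).2.2 →
            (c : G) ∈ ψ (d k).1 '' Icc (d k).2.1 (d k).2.2 →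
            (c : G) = ψ (d j).1 (d j).2.1 ∨ (c : G) = ψ (d j).1 (d j).2.2 := by
          rintro j k hjk ⟨t, ht, htc⟩ hk
          have h01 := (hPmem _ _ (hd j).1 _ ht).1
          have hl := (hPmem _ _ (hd j).1 _ ⟨le_rfl, (hd j).2.le⟩).1
          have hr := (hPmem _ _ (hd j).1 _ ⟨(hd j).2.le, le_rfl⟩).1
          rcases eq_or_lt_of_le h01.1 with h | h
          · left; rw [← htc]; congr 1; linarith [ht.1, hl.1]
          rcases eq_or_lt_of_le h01.2 with h' | h'
          · right; rw [← htc]; congr 1; linarith [ht.2, hr.2]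
          · exact absurd (hIcc k hk) (Set.disjoint_left.1 (hψ.disj _ _ hjk)
              ⟨t, ⟨h, h'⟩, htc⟩)
        refine ⟨c, ?_, ?_, ?_⟩
        · refine Subset.antisymm ?_ (singleton_subset_iff.2 hc)
          intro c' hc'
          exact Subtype.ext (hψ.subsingleton _ _ hedge ⟨hIcc j hc'.1, hIcc k hc'.2⟩
            ⟨hIcc j hc.1, hIcc k hc.2⟩)
        · rcases hend j k hedge hc.1 hc.2 with h | h
          · left; exact Subtype.ext h
          · right; exact Subtype.ext h
        · rcases hend k j (Ne.symm hedge) hc.2 hc.1 with h | h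
          · left; exact Subtype.ext h
          · right; exact Subtype.ext h

theorem exists_itinerary {G : Type*} {g : G → G} {K : Set G} {D : Bool → Set G}
    (hK : K.Nonempty) (hDK : ∀ c, D c ⊆ K) (hcov : ∀ c, K ⊆ g '' D c) (n : ℕ) :
    ∀ w : ℕ → Bool, ∃ p ∈ K, ∀ k < n, g^[k] p ∈ D (w k) := by
  induction n with
  | zero => intro w; obtain ⟨p, hp⟩ := hK; exact ⟨p, hp, by simp⟩
  | succ n ih =>
    intro w
    obtain ⟨q, hq, h⟩ := ih (fun k => w (k + 1))
    obtain ⟨p, hp, rfl⟩ := hcov (w 0) hq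
    refine ⟨p, hDK _ hp, fun k hk => ?_⟩
    cases k with
    | zero => exact hp
    | succ k =>
      rw [Function.iterate_succ_apply]
      exact h k (by omega)

theorem iterate_mul_cover {G : Type*} {f : G → G} {K D : Set G} (hDK : D ⊆ K) {a : ℕ}
    (hcov : K ⊆ f^[a] '' D) (b : ℕ) :
    K ⊆ f^[a * (b + 1)] '' D := by
  induction b with
  | zero => simpa using hcov
  | succ b ih =>
    intro q hq
    obtain ⟨p, hp, rfl⟩ := hcov hq
    obtain ⟨r, hr, rfl⟩ := ih (hDK hp)
    refine ⟨r, hr, ?_⟩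
    rw [← Function.iterate_add_apply]
    congr 2
    ring

/-- Two disjoint compact subsets of `K` each covering `K` at a common time force positive
topological entropy. -/
theorem coverEntropy_pos_of_horseshoe {G : Type*} [MetricSpace G] {f : G → G} {K : Set G}
    {D : Bool → Set G} (hK : K.Nonempty) (hDK : ∀ c, D c ⊆ K) (hDc : ∀ c, IsCompact (D c))
    (hdis : Disjoint (D true) (D false)) {N : ℕ} (hN : 0 < N) (hcov : ∀ c, K ⊆ f^[N] '' D c) :
    0 < Dynamics.coverEntropy f univ := by
  obtain ⟨δ, hδ, hδd⟩ := hdis.exists_thickenings (hDc true) (hDc false).isClosed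
  have hsep : ∀ c c', c ≠ c' → ∀ p ∈ D c, ∀ q ∈ D c', δ ≤ dist p q := by
    have : ∀ p ∈ D true, ∀ q ∈ D false, δ ≤ dist p q := by
      intro p hp q hq
      by_contra! hcon
      refine Set.disjoint_left.1 hδd (Metric.self_subset_thickening hδ _ hp) ?_
      exact Metric.mem_thickening_iff.2 ⟨q, hq, hcon⟩
    intro c c' hcc p hp q hq
    cases c <;> cases c'
    · exact absurd rfl hcc
    · rw [dist_comm]; exact this q hq p hp
    · exact this p hp q hq
    · exact absurd rfl hcc
  set U : SetRel G G := {z | dist z.1 z.2 < δ / 2} with hU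
  have hUu : U ∈ uniformity G := Metric.dist_mem_uniformity (half_pos hδ)
  have hcard : ∀ n : ℕ, (2 ^ n : ℕ∞) ≤ Dynamics.netMaxcard f univ U (N * n) := by
    intro n
    choose p hpK hp using exists_itinerary hK hDK hcov n
    let e : (Fin n → Bool) → ℕ → Bool := fun w k => if h : k < n then w ⟨k, h⟩ else false
    have hfar : ∀ w w', w ≠ w' → ∃ k < N * n, δ ≤ dist (f^[k] (p (e w))) (f^[k] (p (e w'))) := by
      intro w w' hww
      obtain ⟨k, hk⟩ := Function.ne_iff.1 hww
      refine ⟨N * k, Nat.mul_lt_mul_of_pos_left k.2 hN, ?_⟩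
      rw [Function.iterate_mul]
      refine hsep _ _ ?_ _ (hp (e w) k k.2) _ (hp (e w') k k.2)
      simpa [e] using hk
    have hinj : Function.Injective fun w => p (e w) := by
      intro w w' h
      by_contra hww
      obtain ⟨k, -, hk⟩ := hfar w w' hww
      simp only at h
      rw [h, dist_self] at hk
      linarith
    classical
    have hnet : Dynamics.IsDynNetIn f univ U (N * n)
        ((Finset.univ.image fun w => p (e w) : Finset G) : Set G) := by
      refine ⟨subset_univ _, ?_⟩
      rintro _ hw _ hw' hne
      simp only [Finset.coe_image, Finset.coe_univ, image_univ, mem_range] at hw hw'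
      obtain ⟨w, rfl⟩ := hw
      obtain ⟨w', rfl⟩ := hw'
      obtain ⟨k, hkN, hk⟩ := hfar w w' (fun h => hne (by rw [h]))
      rw [Function.onFun, Set.disjoint_left]
      intro z hz hz'
      have h1 : dist (f^[k] (p (e w))) (f^[k] z) < δ / 2 :=
        Dynamics.mem_dynEntourage.1 hz k hkN
      have h2 : dist (f^[k] (p (e w'))) (f^[k] z) < δ / 2 :=
        Dynamics.mem_dynEntourage.1 hz' k hkN
      have := dist_triangle_right (f^[k] (p (e w))) (f^[k] (p (e w'))) (f^[k] z)
      linarith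
    have := hnet.card_le_netMaxcard
    rw [Finset.card_image_of_injective _ hinj] at this
    simpa using this
  refine lt_of_lt_of_le ?_ (Dynamics.netEntropyEntourage_le_coverEntropy f univ hUu)
  by_contra! hcon
  have hlog : 0 < Real.log 2 / (2 * N) := by
    have : (0:ℝ) < N := by exact_mod_cast hN
    have := Real.log_pos one_lt_two
    positivity
  obtain ⟨M, hM⟩ := eventually_atTop.1 (ExpGrowth.expGrowthSup_le_iff.1 hcon
    ((Real.log 2 / (2 * N) : ℝ) : EReal) (by exact_mod_cast hlog))
  have h1 := hM (N * (M + 1)) (by nlinarith)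
  have h2 : ((2 ^ (M + 1) : ℕ) : ENNReal) ≤ EReal.exp
      (((Real.log 2 / (2 * N) : ℝ) : EReal) * ((N * (M + 1) : ℕ) : EReal)) := by
    refine le_trans ?_ h1
    exact_mod_cast hcard (M + 1)
  have h3 : (((Real.log 2 / (2 * N) : ℝ) : EReal) * ((N * (M + 1) : ℕ) : EReal)) =
      ((Real.log 2 * (M + 1) / 2 : ℝ) : EReal) := by
    rw [show ((N * (M + 1) : ℕ) : EReal) = (((N * (M + 1) : ℕ) : ℝ) : EReal) by norm_cast,
      ← EReal.coe_mul]
    congr 1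
    have : (N:ℝ) ≠ 0 := by exact_mod_cast hN.ne'
    push_cast
    field_simp
  rw [h3, EReal.exp_coe] at h2
  have h4 : ((2:ℝ) ^ (M + 1)) ≤ Real.exp (Real.log 2 * (M + 1) / 2) := by
    have := ENNReal.toReal_mono ENNReal.ofReal_ne_top h2
    rw [ENNReal.toReal_ofReal (Real.exp_pos _).le] at this
    simpa using this
  have h5 : ((2:ℝ) ^ (M + 1)) = Real.exp (Real.log 2 * (M + 1)) := by
    rw [Real.exp_mul, Real.exp_log two_pos]; norm_cast
  rw [h5, Real.exp_le_exp] at h4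
  have := Real.log_pos one_lt_two
  nlinarith

/-- Two disjoint compact subsets of `K` which cover `K` at positive times force positive
topological entropy. -/
theorem coverEntropy_pos_of_cover {G : Type*} [MetricSpace G] {f : G → G}
    {K D E : Set G} (hK : K.Nonempty) (hDK : D ⊆ K) (hEK : E ⊆ K) (hD : IsCompact D)
    (hE : IsCompact E) (hdis : Disjoint D E) {a b : ℕ} (ha : 0 < a) (hb : 0 < b)
    (hDa : K ⊆ f^[a] '' D) (hEb : K ⊆ f^[b] '' E) : 0 < Dynamics.coverEntropy f univ := by
  obtain ⟨a, rfl⟩ := Nat.exists_eq_succ_of_ne_zero ha.ne'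
  obtain ⟨b, rfl⟩ := Nat.exists_eq_succ_of_ne_zero hb.ne'
  have h1 := iterate_mul_cover hDK hDa b
  have h2 := iterate_mul_cover hEK hEb a
  refine coverEntropy_pos_of_horseshoe (D := fun c => if c then D else E) hK ?_ ?_ ?_
    (N := (a + 1) * (b + 1)) (by positivity) ?_
  · intro c; cases c <;> simpa
  · intro c; cases c <;> simpa
  · simpa using hdis
  · intro c
    cases c
    · rw [mul_comm]; simpa using h2
    · simpa using h1

theorem exists_shattered_coloring (d : ℕ) : ∃ M : ℕ, ∀ col : Finset (Fin M) → Finset (Fin M),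
    (∀ σ, col σ ⊆ σ) → ∃ c J : Finset (Fin M), d ≤ J.card ∧
      ∀ t ⊆ J, ∃ σ, c ∩ σ = col σ ∧ J ∩ σ = t := by
  classical
  obtain ⟨M, hM⟩ : ∃ M : ℕ, (2:ℝ) ^ M * (d * (M + 1) ^ d) < 3 ^ M := by
    have h1 : Tendsto (fun n : ℕ => (n:ℝ) ^ d * (2 / 3 : ℝ) ^ n) atTop (𝓝 0) :=
      tendsto_pow_const_mul_const_pow_of_abs_lt_one d (by rw [abs_of_pos] <;> norm_num)
    have h2 := (tendsto_add_atTop_iff_nat 1).2 h1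
    have h3 := h2.const_mul (3 / 2 * d : ℝ)
    rw [mul_zero] at h3
    obtain ⟨M, hM⟩ := (h3.eventually (gt_mem_nhds one_pos)).exists
    refine ⟨M, ?_⟩
    have : (3 / 2 * d : ℝ) * (((M + 1 : ℕ) : ℝ) ^ d * (2 / 3) ^ (M + 1)) =
        (2 ^ M * (d * (M + 1) ^ d)) / 3 ^ M := by
      rw [div_pow]; push_cast; field_simp; ring
    rw [this, div_lt_one (by positivity)] at hM
    exact hM
  refine ⟨M, fun col hcol => ?_⟩
  let S : Finset (Fin M) → Finset (Finset (Fin M)) := fun c =>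
    Finset.univ.filter fun σ => c ∩ σ = col σ
  have hcount : (3:ℕ) ^ M ≤ ∑ c, (S c).card := by
    have h1 : ∑ c, (S c).card =
        ∑ σ, (Finset.univ.filter fun c : Finset (Fin M) => c ∩ σ = col σ).card := by
      simp only [S, Finset.card_filter]
      exact Finset.sum_comm
    have h2 := Finset.sum_pow_mul_eq_add_pow (1:ℕ) 2 (Finset.univ : Finset (Fin M))
    rw [Finset.powerset_univ, Finset.card_univ, Fintype.card_fin] at h2
    rw [h1, show (3:ℕ) = 1 + 2 from rfl, ← h2]
    refine Finset.sum_le_sum fun σ _ => ?_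
    rw [one_pow, one_mul]
    have h3 : (σᶜ.powerset.image fun e => col σ ∪ e) ⊆
        Finset.univ.filter fun c : Finset (Fin M) => c ∩ σ = col σ := by
      intro c hc
      obtain ⟨e, he, rfl⟩ := Finset.mem_image.1 hc
      rw [Finset.mem_powerset] at he
      simp only [Finset.mem_filter, Finset.mem_univ, true_and]
      ext i
      have hi1 := @hcol σ i
      have hi2 := @he i
      simp only [Finset.mem_inter, Finset.mem_union, Finset.mem_compl] at *
      tauto
    refine le_trans ?_ (Finset.card_le_card h3)
    rw [Finset.card_image_of_injOn, Finset.card_powerset, Finset.card_compl, Fintype.card_fin]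
    intro e he e' he' h
    rw [Finset.mem_coe, Finset.mem_powerset] at he he'
    ext i
    have h4 := Finset.ext_iff.1 h i
    have hi1 := @hcol σ i
    have hi2 := @he i
    have hi3 := @he' i
    simp only [Finset.mem_union, Finset.mem_compl] at *
    tauto
  by_contra! hcon
  have hsmall : ∀ c, (S c).card ≤ d * (M + 1) ^ d := by
    intro c
    refine (S c).card_le_card_shatterer.trans ?_
    have hsub : (S c).shatterer ⊆ (Finset.range d).biUnion fun k =>
        Finset.powersetCard k Finset.univ := by
      intro J hJ
      rw [Finset.mem_shatterer] at hJ
      simp only [Finset.mem_biUnion, Finset.mem_range, Finset.mem_powersetCard_univ]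
      refine ⟨J.card, ?_, rfl⟩
      by_contra! hd
      obtain ⟨t, ht, h⟩ := hcon c J hd
      obtain ⟨σ, hσ, hσt⟩ := hJ ht
      exact h σ (Finset.mem_filter.1 hσ).2 hσt
    refine (Finset.card_le_card hsub).trans (Finset.card_biUnion_le.trans ?_)
    have : ∀ k ∈ Finset.range d, (Finset.powersetCard k (Finset.univ : Finset (Fin M))).card ≤
        (M + 1) ^ d := by
      intro k hk
      rw [Finset.card_powersetCard, Finset.card_univ, Fintype.card_fin]
      exact (Nat.choose_le_pow M k).trans ((Nat.pow_le_pow_left (Nat.le_succ M) k).trans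
        (Nat.pow_le_pow_right (Nat.succ_pos M) (Finset.mem_range.1 hk).le))
    refine (Finset.sum_le_sum this).trans ?_
    simp
  have h5 : (3:ℕ) ^ M ≤ 2 ^ M * (d * (M + 1) ^ d) := by
    refine hcount.trans ((Finset.sum_le_sum fun c _ => hsmall c).trans ?_)
    simp
  have h6 : (3:ℝ) ^ M ≤ 2 ^ M * (d * (M + 1) ^ d) := by exact_mod_cast h5
  linarith

/-- The pair `U`, `V` has arbitrarily large finite independence sets. -/
def HasLargeIndepSets {G : Type*} (f : G → G) (U V : Set G) : Prop :=
  ∀ n : ℕ, ∃ I : Finset ℕ, n ≤ I.card ∧ IsIndepSet f U V ↑I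

section Indep

variable {G : Type*} {f : G → G} {U V U₁ U₂ U' V' : Set G}

theorem IsIndepSet.exists_point {I : Finset ℕ} (h : IsIndepSet f U V ↑I) (S : ℕ → Bool) :
    I.Nonempty → ∃ p, ∀ i ∈ I, f^[i] p ∈ if S i then U else V := by
  intro hne
  obtain ⟨p, hp⟩ := h I subset_rfl hne S
  exact ⟨p, fun i hi => mem_iInter₂.1 hp i hi⟩

theorem isIndepSet_of_forall_exists {I : Set ℕ}
    (h : ∀ S : ℕ → Bool, ∃ p, ∀ i ∈ I, f^[i] p ∈ if S i then U else V) : IsIndepSet f U V I := by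
  intro J hJ _ S
  obtain ⟨p, hp⟩ := h S
  exact ⟨p, mem_iInter₂.2 fun i hi => hp i (hJ hi)⟩

theorem HasLargeIndepSets.symm (h : HasLargeIndepSets f U V) : HasLargeIndepSets f V U := by
  intro n
  obtain ⟨I, hn, hI⟩ := h n
  refine ⟨I, hn, fun J hJ hne S => ?_⟩
  obtain ⟨p, hp⟩ := hI J hJ hne (fun i => !S i)
  refine ⟨p, mem_iInter₂.2 fun i hi => ?_⟩
  have := mem_iInter₂.1 hp i hi
  simp only [mem_preimage] at this ⊢
  cases hS : S i
  · simpa [hS] using this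
  · simpa [hS] using this

theorem HasLargeIndepSets.mono (h : HasLargeIndepSets f U V) (hU : U ⊆ U') (hV : V ⊆ V') :
    HasLargeIndepSets f U' V' := by
  intro n
  obtain ⟨I, hn, hI⟩ := h n
  refine ⟨I, hn, fun J hJ hne S => ?_⟩
  refine (hI J hJ hne S).mono (iInter₂_mono fun i _ => preimage_mono ?_)
  cases S i
  · simpa using hV
  · simpa using hU

theorem HasLargeIndepSets.union (h : HasLargeIndepSets f (U₁ ∪ U₂) V) :
    HasLargeIndepSets f U₁ V ∨ HasLargeIndepSets f U₂ V := by
  classical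
  by_contra! hcon
  obtain ⟨h1, h2⟩ := hcon
  unfold HasLargeIndepSets at h1 h2
  push Not at h1 h2
  obtain ⟨n₁, h1⟩ := h1
  obtain ⟨n₂, h2⟩ := h2
  obtain ⟨M, hM⟩ := exists_shattered_coloring (n₁ + n₂ + 1)
  obtain ⟨I, hIcard, hI⟩ := h (M + 1)
  obtain ⟨I', hI', hI'card⟩ := Finset.exists_subset_card_eq ((Nat.le_succ M).trans hIcard)
  have hne : I.Nonempty := Finset.card_pos.1 (by omega)
  let e : Fin M ↪o ℕ := I'.orderEmbOfFin hI'card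
  have he : ∀ k, e k ∈ I := fun k => hI' (Finset.orderEmbOfFin_mem _ hI'card k)
  have hpt : ∀ σ : Finset (Fin M), ∃ p, ∀ k, (k ∈ σ → f^[e k] p ∈ U₁ ∪ U₂) ∧
      (k ∉ σ → f^[e k] p ∈ V) := by
    intro σ
    obtain ⟨p, hp⟩ := hI.exists_point (fun i => decide (∃ k ∈ σ, e k = i)) hne
    refine ⟨p, fun k => ⟨fun hk => ?_, fun hk => ?_⟩⟩
    · have := hp _ (he k)
      have hex : ∃ a ∈ σ, e a = e k := ⟨k, hk, rfl⟩
      rwa [if_pos (decide_eq_true hex)] at this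
    · have := hp _ (he k)
      have hex : ¬ ∃ a ∈ σ, e a = e k := by
        rintro ⟨a, ha, hak⟩
        exact hk (e.injective hak ▸ ha)
      rwa [if_neg (by simpa using hex)] at this
  choose p hp using hpt
  obtain ⟨c, J, hJ, hsh⟩ := hM (fun σ => σ.filter fun k => f^[e k] (p σ) ∈ U₁)
    (fun σ => Finset.filter_subset _ _)
  have key : ∀ (J' : Finset (Fin M)) (W : Set G), J' ⊆ J →
      (∀ σ, c ∩ σ = (σ.filter fun k => f^[e k] (p σ) ∈ U₁) → ∀ k ∈ J', k ∈ σ →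
        f^[e k] (p σ) ∈ W) → IsIndepSet f W V ↑(J'.map e.toEmbedding) := by
    intro J' W hJ' hW
    refine isIndepSet_of_forall_exists fun S => ?_
    obtain ⟨σ, hσ, hσJ⟩ := hsh (J'.filter fun k => S (e k) = true)
      ((Finset.filter_subset _ _).trans hJ')
    refine ⟨p σ, fun i hi => ?_⟩
    simp only [Finset.coe_map, mem_image, Finset.mem_coe] at hi
    obtain ⟨k, hk, rfl⟩ := hi
    have hk' := Finset.ext_iff.1 hσJ k
    simp only [Finset.mem_inter, hJ' hk, true_and, Finset.mem_filter, hk] at hk'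
    cases hS : S (e.toEmbedding k)
    · simp only [Bool.false_eq_true, if_false]
      refine (hp σ k).2 fun h => ?_
      have h3 := hk'.1 h
      have : S (e k) = false := hS
      simp [this] at h3
    · simp only [if_true]
      exact hW σ hσ k hk (hk'.2 hS)
  have hA := key (J ∩ c) U₁ Finset.inter_subset_left (by
    intro σ hσ k hk hkσ
    have : k ∈ c ∩ σ := Finset.mem_inter.2 ⟨(Finset.mem_inter.1 hk).2, hkσ⟩
    rw [hσ] at this
    exact (Finset.mem_filter.1 this).2)
  have hB := key (J \ c) U₂ Finset.sdiff_subset (by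
    intro σ hσ k hk hkσ
    refine ((hp σ k).1 hkσ).resolve_left fun h => ?_
    have : k ∈ c ∩ σ := by rw [hσ]; exact Finset.mem_filter.2 ⟨hkσ, h⟩
    exact (Finset.mem_sdiff.1 hk).2 (Finset.mem_inter.1 this).1)
  have hcards := Finset.card_inter_add_card_sdiff J c
  rcases le_or_gt n₁ (J ∩ c).card with h | h
  · exact h1 _ (by rw [Finset.card_map]; exact h) hA
  · exact h2 _ (by rw [Finset.card_map]; omega) hB

theorem not_hasLargeIndepSets_empty : ¬ HasLargeIndepSets f ∅ V := by
  intro h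
  obtain ⟨I, hn, hI⟩ := h 1
  obtain ⟨i, hi⟩ := Finset.card_pos.1 hn
  obtain ⟨p, hp⟩ := hI.exists_point (fun _ => true) ⟨i, hi⟩
  simpa using hp i hi

theorem exists_lt_of_two_le_card {I : Finset ℕ} (h : 2 ≤ I.card) :
    ∃ i ∈ I, ∃ j ∈ I, i < j := by
  obtain ⟨i, hi, j, hj, hij⟩ := Finset.one_lt_card.1 h
  rcases lt_or_gt_of_ne hij with h | h
  · exact ⟨i, hi, j, hj, h⟩
  · exact ⟨j, hj, i, hi, h⟩

theorem not_hasLargeIndepSets_singleton {x : G} (hx : x ∉ V) : ¬ HasLargeIndepSets f {x} V := by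
  intro h
  obtain ⟨I, hn, hI⟩ := h 2
  obtain ⟨i, hi, j, hj, hij⟩ := exists_lt_of_two_le_card hn
  obtain ⟨p, hp⟩ := hI.exists_point (fun _ => true) ⟨i, hi⟩
  obtain ⟨q, hq⟩ := hI.exists_point (fun k => decide (k = i)) ⟨i, hi⟩
  have hpi := hp i hi
  have hpj := hp j hj
  have hqi := hq i hi
  have hqj := hq j hj
  simp only [if_true, mem_singleton_iff, decide_true, decide_eq_true_eq, hij.ne', if_false]
    at hpi hpj hqi hqj
  have e1 : ∀ r, f^[j] r = f^[j - i] (f^[i] r) := fun r => by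
    rw [← Function.iterate_add_apply, Nat.sub_add_cancel hij.le]
  rw [e1, hqi] at hqj
  rw [e1, hpi] at hpj
  exact hx (hpj ▸ hqj)

theorem HasLargeIndepSets.exists_of_biUnion {ι : Type*} {Γ : Set ι} (hΓ : Γ.Finite)
    {W : ι → Set G} : HasLargeIndepSets f (⋃ β ∈ Γ, W β) V →
      ∃ β ∈ Γ, HasLargeIndepSets f (W β) V := by
  induction Γ, hΓ using Set.Finite.induction_on with
  | empty => intro h; simp only [mem_empty_iff_false, iUnion_of_empty, iUnion_empty] at h
             exact absurd h not_hasLargeIndepSets_empty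
  | @insert a s _ _ ih =>
    intro h
    rw [biUnion_insert] at h
    rcases h.union with h | h
    · exact ⟨a, mem_insert _ _, h⟩
    · obtain ⟨β, hβ, h⟩ := ih h
      exact ⟨β, mem_insert_of_mem _ hβ, h⟩

theorem HasLargeIndepSets.exists_of_germs {ι : Type*} {Γ : Set ι} (hΓ : Γ.Finite)
    {W : ι → Set G} {x : G} (hx : x ∉ V) (h : HasLargeIndepSets f (U ∩ ({x} ∪ ⋃ β ∈ Γ, W β)) V) :
    ∃ β ∈ Γ, HasLargeIndepSets f (U ∩ W β) V := by
  rw [inter_union_distrib_left] at h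
  have h1 := h.union.resolve_left fun h1 =>
    not_hasLargeIndepSets_singleton hx (h1.mono inter_subset_right subset_rfl)
  rw [inter_iUnion₂] at h1
  exact HasLargeIndepSets.exists_of_biUnion hΓ h1

/-- Initial segments of the arcs `α`, `β` are joined by arbitrarily late common transitions. -/
def HasJointReturns (f : G → G) (α β : ℝ → G) : Prop :=
  ∀ s > 0, ∀ L : ℕ, ∃ i ≥ L,
    (∃ u ∈ α '' Ioc 0 s, f^[i] u ∈ α '' Ioc 0 s) ∧ (∃ u ∈ α '' Ioc 0 s, f^[i] u ∈ β '' Ioc 0 s) ∧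
    (∃ u ∈ β '' Ioc 0 s, f^[i] u ∈ α '' Ioc 0 s) ∧ ∃ u ∈ β '' Ioc 0 s, f^[i] u ∈ β '' Ioc 0 s

theorem HasLargeIndepSets.exists_transitions (h : HasLargeIndepSets f U V) (L : ℕ) :
    ∃ i ≥ L, (∃ u ∈ U, f^[i] u ∈ U) ∧ (∃ u ∈ U, f^[i] u ∈ V) ∧ (∃ u ∈ V, f^[i] u ∈ U) ∧
      ∃ u ∈ V, f^[i] u ∈ V := by
  obtain ⟨I, hn, hI⟩ := h (L + 2)
  have hne : I.Nonempty := Finset.card_pos.1 (by omega)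
  set a := I.min' hne
  set b := I.max' hne
  have ha : a ∈ I := I.min'_mem hne
  have hb : b ∈ I := I.max'_mem hne
  have hcard : I.card ≤ b + 1 - a := by
    rw [← Nat.card_Icc]
    exact Finset.card_le_card fun i hi => Finset.mem_Icc.2 ⟨I.min'_le i hi, I.le_max' i hi⟩
  have hab : b ≠ a := by omega
  have key : ∀ c d : Bool, ∃ u ∈ (if c then U else V), f^[b - a] u ∈ (if d then U else V) := by
    intro c d
    obtain ⟨p, hp⟩ := hI.exists_point (fun i => if i = a then c else d) hne
    have h1 := hp a ha
    have h2 := hp b hb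
    simp only [if_true, hab, if_false] at h1 h2
    refine ⟨f^[a] p, h1, ?_⟩
    rwa [← Function.iterate_add_apply, Nat.sub_add_cancel (by omega)]
  refine ⟨b - a, by omega, ?_, ?_, ?_, ?_⟩
  · simpa using key true true
  · simpa using key true false
  · simpa using key false true
  · simpa using key false false

end Indep

theorem IsEdgeSystem.exists_hasJointReturns {G : Type*} [TopologicalSpace G] [T2Space G] {n : ℕ}
    {ψ : Fin n → ℝ → G} (hψ : IsEdgeSystem ψ) {f : G → G} {x y : G} (hxy : x ≠ y)
    (h : IsINPair f x y) : ∃ α β : ℝ → G, IsOpenArc α ∧ IsOpenArc β ∧ α 0 = x ∧ β 0 = y ∧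
      HasJointReturns f α β := by
  obtain ⟨Γ, hΓf, hΓ, hΓn⟩ := hψ.exists_germs_nhds x
  obtain ⟨Δ, hΔf, hΔ, hΔn⟩ := hψ.exists_germs_nhds y
  obtain ⟨U, V, hU, hV, hxU, hyV, hUV⟩ := t2_separation hxy
  have hstep : ∀ k : ℕ, ∃ a : Γ × Δ, HasLargeIndepSets f
      ((a.1 : ℝ → G) '' Ioc 0 (1 / (k + 1 : ℝ))) ((a.2 : ℝ → G) '' Ioc 0 (1 / (k + 1 : ℝ))) := by
    intro k
    have hk : (0:ℝ) < 1 / (k + 1 : ℝ) := by positivity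
    have h0 : HasLargeIndepSets f (U ∩ ({x} ∪ ⋃ β ∈ Γ, β '' Ioc 0 (1 / (k + 1 : ℝ))))
        (V ∩ ({y} ∪ ⋃ β ∈ Δ, β '' Ioc 0 (1 / (k + 1 : ℝ)))) :=
      h _ _ (inter_mem (hU.mem_nhds hxU) (hΓn _ hk)) (inter_mem (hV.mem_nhds hyV) (hΔn _ hk))
    obtain ⟨α, hα, h1⟩ := HasLargeIndepSets.exists_of_germs hΓf
      (fun hx => Set.disjoint_left.1 hUV hxU hx.1) h0
    obtain ⟨β, hβ, h2⟩ := HasLargeIndepSets.exists_of_germs hΔf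
      (fun hy => Set.disjoint_left.1 hUV hy.1 hyV) h1.symm
    exact ⟨⟨⟨α, hα⟩, ⟨β, hβ⟩⟩, h2.symm.mono inter_subset_right inter_subset_right⟩
  obtain ⟨a, ha⟩ : ∃ a : Γ × Δ, ∀ s > 0, HasLargeIndepSets f
      ((a.1 : ℝ → G) '' Ioc 0 s) ((a.2 : ℝ → G) '' Ioc 0 s) := by
    by_contra! hcon
    choose s hs0 hs using hcon
    have := hΓf.to_subtype
    have := hΔf.to_subtype
    obtain ⟨a₀, -⟩ := hstep 0
    have : Nonempty (Γ × Δ) := ⟨a₀⟩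
    obtain ⟨b, hb⟩ := Finite.exists_min s
    obtain ⟨k, hk⟩ := exists_nat_one_div_lt (hs0 b)
    obtain ⟨a, ha⟩ := hstep k
    have hle : 1 / (k + 1 : ℝ) ≤ s a := hk.le.trans (hb a)
    exact hs a (ha.mono (image_mono (Ioc_subset_Ioc_right hle))
      (image_mono (Ioc_subset_Ioc_right hle)))
  exact ⟨a.1, a.2, (hΓ _ a.1.2).1, (hΔ _ a.2.2).1, (hΓ _ a.1.2).2, (hΔ _ a.2.2).2,
    fun s hs L => (ha s hs).exists_transitions L⟩

theorem image_iterate_image {X : Type*} (f : X → X) (i j : ℕ) (S : Set X) :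
    f^[i] '' (f^[j] '' S) = f^[i + j] '' S := by
  rw [Function.iterate_add, image_comp]

theorem mem_omegaSet_iff {X : Type*} [TopologicalSpace X] {f : X → X} {x z : X} :
    x ∈ omegaSet f z ↔ ∀ U ∈ 𝓝 x, ∀ N : ℕ, ∃ m ≥ N, f^[m] z ∈ U := by
  simp only [omegaSet, mem_iInter, mem_closure_iff_nhds]
  constructor
  · intro h U hU N
    obtain ⟨p, hp, m, hm, rfl⟩ := h N U hU
    exact ⟨m, hm, hp⟩
  · intro h N U hU
    obtain ⟨m, hm, hp⟩ := h U hU N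
    exact ⟨_, hp, m, hm, rfl⟩

theorem isPreconnected_iInter_of_antitone {X : Type*} [TopologicalSpace X] [T2Space X]
    {K : ℕ → Set X} (hK : Antitone K) (hc : ∀ n, IsCompact (K n))
    (hp : ∀ n, IsPreconnected (K n)) : IsPreconnected (⋂ n, K n) := by
  rw [isPreconnected_closed_iff]
  intro t t' ht ht' hsub ⟨a, ha, hat⟩ ⟨b, hb, hbt⟩
  by_contra hcon
  have hcc : IsCompact (⋂ n, K n) := 
    (hc 0).of_isClosed_subset (isClosed_iInter fun n => (hc n).isClosed) (iInter_subset _ 0)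
  obtain ⟨U, V, hU, hV, hAU, hBV, hUV⟩ :=
    SeparatedNhds.of_isCompact_isCompact (hcc.inter_right ht) (hcc.inter_right ht')
      (Set.disjoint_left.2 fun p hp hp' => hcon ⟨p, hp.1, hp.2, hp'.2⟩)
  obtain ⟨n, hn⟩ := exists_subset_nhds_of_isCompact (U := U ∪ V) hK.directed_ge hc (fun p hp => by
    refine (hU.union hV).mem_nhds ?_
    rcases hsub hp with h | h
    · exact Or.inl (hAU ⟨hp, h⟩)
    · exact Or.inr (hBV ⟨hp, h⟩))
  obtain ⟨p, -, hpU, hpV⟩ := hp n U V hU hV hn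
    ⟨a, iInter_subset _ _ ha, hAU ⟨ha, hat⟩⟩ ⟨b, iInter_subset _ _ hb, hBV ⟨hb, hbt⟩⟩
  exact Set.disjoint_left.1 hUV hpU hpV

theorem image_iInter_of_antitone {X Y : Type*} [TopologicalSpace X] [TopologicalSpace Y]
    [T2Space X] [T1Space Y] {f : X → Y} (hf : Continuous f)
    {K : ℕ → Set X} (hK : Antitone K) (hc : ∀ n, IsCompact (K n)) :
    f '' (⋂ n, K n) = ⋂ n, f '' K n := by
  refine (image_iInter_subset _ _).antisymm fun p hp => ?_
  have hcl : IsClosed (f ⁻¹' {p}) := isClosed_singleton.preimage hf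
  obtain ⟨z, hz⟩ := IsCompact.nonempty_iInter_of_sequence_nonempty_isCompact_isClosed
    (fun n => K n ∩ f ⁻¹' {p}) (fun n => inter_subset_inter_left _ (hK n.le_succ))
    (fun n => by
      obtain ⟨z, hz, h⟩ := mem_iInter.1 hp n
      exact ⟨z, hz, h⟩)
    ((hc 0).inter_right hcl) (fun n => (hc n).isClosed.inter hcl)
  rw [mem_iInter] at hz
  exact ⟨z, mem_iInter.2 fun n => (hz n).1, (hz 0).2⟩

theorem isClosed_connectedComponentIn {X : Type*} [TopologicalSpace X] {F : Set X}
    (hF : IsClosed F) (x : X) : IsClosed (connectedComponentIn F x) := by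
  by_cases hx : x ∈ F
  · refine isClosed_of_closure_subset ?_
    refine isPreconnected_connectedComponentIn.closure.subset_connectedComponentIn
      (subset_closure (mem_connectedComponentIn hx))
      (closure_minimal (connectedComponentIn_subset F x) hF)
  · rw [connectedComponentIn_eq_empty hx]
    exact isClosed_empty

theorem exists_mem_chain {X : Type*} [TopologicalSpace X] [T2Space X] {f : X → X}
    (hf : Continuous f) {K : ℕ → Set X} (hK : ∀ k, IsCompact (K k)) (hne : ∀ k, (K k).Nonempty)
    {i : ℕ → ℕ} (h : ∀ k, K (k + 1) ⊆ f^[i k] '' K k) :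
    ∃ z, ∀ k, f^[∑ j ∈ Finset.range k, i j] z ∈ K k := by
  have hex : ∀ n, ∀ p ∈ K n, ∃ z, f^[∑ j ∈ Finset.range n, i j] z = p ∧
      ∀ k ≤ n, f^[∑ j ∈ Finset.range k, i j] z ∈ K k := by
    intro n
    induction n with
    | zero =>
      intro p hp
      refine ⟨p, by simp, fun k hk => ?_⟩
      obtain rfl : k = 0 := by omega
      simpa using hp
    | succ n ih =>
      intro p hp
      obtain ⟨p', hp', rfl⟩ := h n hp
      obtain ⟨z, hz, hz'⟩ := ih p' hp'
      have h1 : f^[∑ j ∈ Finset.range (n + 1), i j] z = f^[i n] p' := by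
        rw [Finset.sum_range_succ, add_comm, Function.iterate_add_apply, hz]
      refine ⟨z, h1, fun k hk => ?_⟩
      rcases Nat.lt_or_ge n k with hlt | hle
      · obtain rfl : k = n + 1 := by omega
        rw [h1]
        exact hp
      · exact hz' k hle
  have hcl : ∀ k, IsClosed (f^[∑ j ∈ Finset.range k, i j] ⁻¹' K k) := fun k =>
    (hK k).isClosed.preimage (hf.iterate _)
  obtain ⟨z, hz⟩ := IsCompact.nonempty_iInter_of_sequence_nonempty_isCompact_isClosed
    (fun n => K 0 ∩ ⋂ k ≤ n, f^[∑ j ∈ Finset.range k, i j] ⁻¹' K k)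
    (fun n => inter_subset_inter_right _ (biInter_mono (fun k hk => Nat.le_succ_of_le hk)
      fun _ _ => Subset.rfl))
    (fun n => by
      obtain ⟨p, hp⟩ := hne n
      obtain ⟨z, -, hz⟩ := hex n p hp
      exact ⟨z, by simpa using hz 0 (Nat.zero_le _), mem_iInter₂.2 hz⟩)
    ((hK 0).inter_right (isClosed_biInter fun k _ => hcl k))
    (fun n => (hK 0).isClosed.inter (isClosed_biInter fun k _ => hcl k))
  exact ⟨z, fun k => mem_iInter₂.1 (mem_iInter.1 hz k).2 k le_rfl⟩

/-- Every iterate of `C` meeting `C` is contained in `C`. -/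
def AbsorbsReturns {X : Type*} (f : X → X) (C : Set X) : Prop :=
  ∀ i, (f^[i] '' C ∩ C).Nonempty → f^[i] '' C ⊆ C

theorem image_iterate_mul_subset {X : Type*} {f : X → X} {C : Set X} {q : ℕ}
    (h : f^[q] '' C ⊆ C) (k : ℕ) : f^[q * k] '' C ⊆ C := by
  induction k with
  | zero => simp
  | succ k ih =>
    rw [Nat.mul_succ, ← image_iterate_image]
    exact (image_mono h).trans ih

theorem AbsorbsReturns.exists_period {X : Type*} {f : X → X} {C : Set X}
    (hC : AbsorbsReturns f C) (hret : ∃ i ≥ 1, (f^[i] '' C ∩ C).Nonempty) :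
    ∃ q ≥ 1, f^[q] '' C ⊆ C ∧
      (∀ a b, a < q → b < q → a ≠ b → Disjoint (f^[a] '' C) (f^[b] '' C)) ∧
      ∀ i, (f^[i] '' C ∩ C).Nonempty → q ∣ i := by
  classical
  have hne : C.Nonempty := by
    obtain ⟨i, -, p, -, hp⟩ := hret
    exact ⟨p, hp⟩
  set q := Nat.find hret with hq
  obtain ⟨hq1, hq2⟩ : 1 ≤ q ∧ (f^[q] '' C ∩ C).Nonempty := Nat.find_spec hret
  have hmin : ∀ i, 1 ≤ i → i < q → ¬ (f^[i] '' C ∩ C).Nonempty := fun i h1 hi h =>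
    Nat.find_min hret hi ⟨h1, h⟩
  have hqC := hC q hq2
  have key : ∀ a b, a < b → b < q → Disjoint (f^[a] '' C) (f^[b] '' C) := by
    intro a b hab hb
    rw [Set.disjoint_left]
    rintro _ ⟨u, hu, rfl⟩ ⟨v, hv, huv⟩
    refine hmin (a + (q - b)) (by omega) (by omega) ⟨f^[q] v, ⟨u, hu, ?_⟩, hqC ⟨v, hv, rfl⟩⟩
    rw [add_comm, Function.iterate_add_apply, ← huv, ← Function.iterate_add_apply]
    congr 2
    omega
  refine ⟨q, hq1, hqC, fun a b ha hb hab => ?_, fun i hi => ?_⟩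
  · rcases lt_or_gt_of_ne hab with h | h
    · exact key a b h hb
    · exact (key b a h ha).symm
  · have h1 := hC i hi
    by_contra hdvd
    have hr : i % q ≠ 0 := fun h => hdvd (Nat.dvd_of_mod_eq_zero h)
    refine hmin (i % q) (by omega) (Nat.mod_lt _ (by omega)) ?_
    obtain ⟨c, hc⟩ := hne
    refine ⟨f^[i] c, ?_, h1 ⟨c, hc, rfl⟩⟩
    have h2 : f^[i % q] '' (f^[q * (i / q)] '' C) ⊆ f^[i % q] '' C :=
      image_mono (image_iterate_mul_subset hqC _)
    rw [image_iterate_image, Nat.mod_add_div] at h2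
    exact h2 ⟨c, hc, rfl⟩

theorem IsOpenArc.eventually_mem {G : Type*} [TopologicalSpace G] {γ : ℝ → G}
    (hγ : IsOpenArc γ) {U : Set G} (hU : U ∈ 𝓝 (γ 0)) :
    ∃ ε > 0, ∀ t, 0 ≤ t → t ≤ ε → γ t ∈ U := by
  have := hγ.continuous.continuousAt.preimage_mem_nhds hU
  obtain ⟨ε, hε, h⟩ := Metric.mem_nhds_iff.1 this
  refine ⟨ε / 2, by positivity, fun t h0 ht => h ?_⟩
  rw [Metric.mem_ball, Real.dist_eq, sub_zero, abs_of_nonneg h0]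
  linarith

theorem mem_omegaUnion_of_germ {G : Type*} [TopologicalSpace G] [T2Space G] {f : G → G}
    (hf : Continuous f) {γ : ℝ → G} (hγ : IsOpenArc γ) {C : ℕ → Set G}
    (hz : ∀ n, γ 0 ∈ C n)
    (hgerm : ∀ n, ∃ s > 0, γ '' Ioc 0 s ⊆ C n) (habs : ∀ n, AbsorbsReturns f (C n))
    (hesc : ∀ i ≥ 1, ∃ n, Disjoint (f^[i] '' C n) (C n))
    (hret : ∀ s > 0, ∃ i ≥ 1, ∃ u ∈ γ '' Ioc 0 s, f^[i] u ∈ γ '' Ioc 0 s) :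
    γ 0 ∈ omegaUnion f := by
  have hne : ∀ i ≥ 1, f^[i] (γ 0) ≠ γ 0 := by
    intro i hi h
    obtain ⟨n, hn⟩ := hesc i hi
    exact Set.disjoint_left.1 hn ⟨_, hz n, h⟩ (hz n)
  have hleave : ∀ ε > 0, ∃ t n, 0 < t ∧ t < ε ∧ γ t ∉ C n := by
    intro ε hε
    by_contra! hcon
    obtain ⟨i, hi, _, ⟨a, ha, rfl⟩, w, hw, hw'⟩ := hret (ε / 2) (by positivity)
    obtain ⟨n, hn⟩ := hesc i hi
    refine Set.disjoint_left.1 hn ⟨_, hcon a n ha.1 (by linarith [ha.2]), rfl⟩ ?_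
    rw [← hw']
    exact hcon w n hw.1 (by linarith [hw.2])
  simp only [omegaUnion, mem_iUnion]
  by_cases hA : ∀ ε > 0, ∃ i ≥ 1, f^[i] (γ 0) ∈ γ '' Ioo 0 ε
  · refine ⟨γ 0, mem_omegaSet_iff.2 fun U hU N => ?_⟩
    have hfin : ((fun i => f^[i] (γ 0)) '' Ico 1 N).Finite := (finite_Ico 1 N).image _
    have hU' : U ∩ ((fun i => f^[i] (γ 0)) '' Ico 1 N)ᶜ ∈ 𝓝 (γ 0) := by
      refine inter_mem hU (hfin.isClosed.isOpen_compl.mem_nhds ?_)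
      rintro ⟨i, hi, h⟩
      exact hne i hi.1 h
    obtain ⟨ε, hε, h⟩ := hγ.eventually_mem hU'
    obtain ⟨i, hi, t, ht, hti⟩ := hA ε hε
    have h2 := h t ht.1.le ht.2.le
    rw [hti] at h2
    refine ⟨i, ?_, h2.1⟩
    by_contra hlt
    exact h2.2 ⟨i, ⟨hi, by omega⟩, rfl⟩
  push Not at hA
  obtain ⟨ε₀, hε₀, hA⟩ := hA
  have hA' : ∀ i ≥ 1, f^[i] (γ 0) ∉ γ '' Ico 0 ε₀ := by
    rintro i hi ⟨t, ht, h⟩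
    rcases ht.1.eq_or_lt with h0 | h0
    · exact hne i hi (by rw [← h, ← h0])
    · exact hA i hi ⟨t, ⟨h0, ht.2⟩, h⟩
  have hstep : ∀ τ, 0 < τ → τ < min ε₀ 1 → ∃ w σ : ℝ, ∃ i : ℕ, 0 < w ∧ 0 < σ ∧ σ ≤ τ ∧ 1 ≤ i ∧
      γ '' Ioc 0 w ⊆ f^[i] '' (γ '' Icc σ τ) := by
    intro τ hτ hτ'
    have hτε := hτ'.trans_le (min_le_left _ _)
    have hτ1 := hτ'.trans_le (min_le_right _ _)
    obtain ⟨t, n, ht, htτ, htn⟩ := hleave τ hτ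
    obtain ⟨s', hs', hs'n⟩ := hgerm n
    set s := min s' (t / 2) with hs
    have hs0 : 0 < s := lt_min hs' (by positivity)
    have hst : s < t := (min_le_right _ _).trans_lt (by linarith)
    have hsn : γ '' Ioc 0 s ⊆ C n :=
      (image_mono (Ioc_subset_Ioc_right (min_le_left _ _))).trans hs'n
    have hsn' : γ '' Icc 0 s ⊆ C n := by
      rintro _ ⟨a, ha, rfl⟩
      rcases ha.1.eq_or_lt with h0 | h0
      · rw [← h0]
        exact hz n
      · exact hsn ⟨a, ⟨h0, ha.2⟩, rfl⟩
    obtain ⟨i, hi, u, hu, w, hw, hwu⟩ := hret s hs0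
    have hiC : f^[i] '' C n ⊆ C n :=
      habs n i ⟨f^[i] u, ⟨u, hsn hu, rfl⟩, hwu ▸ hsn ⟨w, hw, rfl⟩⟩
    set D := f^[i] '' (γ '' Icc 0 s) with hD
    have hDC : D ⊆ C n := (image_mono hsn').trans hiC
    have hDz : f^[i] (γ 0) ∈ D := ⟨_, ⟨0, ⟨le_rfl, hs0.le⟩, rfl⟩, rfl⟩
    have hDp : IsPreconnected D :=
      (isPreconnected_Icc.image _ hγ.continuous.continuousOn).image _ (hf.iterate i).continuousOn
    have hDw : γ w ∈ D := by
      rw [hwu]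
      exact ⟨u, image_mono Ioc_subset_Icc_self hu, rfl⟩
    have hcov : γ '' Ioc 0 w ⊆ D := by
      rintro _ ⟨w', hw', rfl⟩
      by_contra hcon
      have hlt : w' < w := lt_of_le_of_ne hw'.2 fun h => hcon (h ▸ hDw)
      have := hγ.subset_of_isPreconnected hDp hw'.1.le hlt (hw.2.trans_lt hst)
        (htτ.trans hτ1).le hDw hcon (fun h => htn (hDC h))
      obtain ⟨p, hp, hpz⟩ := this hDz
      exact hA' i hi ⟨p, ⟨hw'.1.le.trans hp.1.le, hp.2.trans (htτ.trans hτε)⟩, hpz⟩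
    have hopen : IsOpen (f^[i] ⁻¹' (γ '' Icc 0 w)ᶜ) :=
      (hγ.isOpen_compl_image_Icc 0 w).preimage (hf.iterate i)
    obtain ⟨ε, hε, hεi⟩ := hγ.eventually_mem (hopen.mem_nhds (by
      rintro ⟨p, hp, hpz⟩
      exact hA' i hi ⟨p, ⟨hp.1, by linarith [hp.2, hw.2]⟩, hpz⟩))
    refine ⟨w, min ε τ, i, hw.1, lt_min hε hτ, min_le_right _ _, hi, ?_⟩
    rintro _ ⟨w', hw', rfl⟩
    obtain ⟨_, ⟨a, ha, rfl⟩, hae⟩ := hcov ⟨w', hw', rfl⟩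
    refine ⟨_, ⟨a, ⟨?_, by linarith [ha.2]⟩, rfl⟩, hae⟩
    by_contra hlt
    push Not at hlt
    have := hεi a ha.1 (hlt.le.trans (min_le_left _ _))
    rw [mem_preimage, hae] at this
    exact this ⟨w', ⟨hw'.1.le, hw'.2⟩, rfl⟩
  choose! w σ i hw hσ hστ hi hcov using hstep
  set ε₁ := min ε₀ 1 with hε₁
  have hε₁0 : 0 < ε₁ := lt_min hε₀ one_pos
  set τ : ℕ → ℝ := fun k => Nat.rec (ε₁ / 2) (fun _ t => min (w t) (t / 2)) k with hτ
  have hτz : τ 0 = ε₁ / 2 := rfl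
  have hτs : ∀ k, τ (k + 1) = min (w (τ k)) (τ k / 2) := fun k => rfl
  have hτ0 : ∀ k, 0 < τ k ∧ τ k < ε₁ := by
    intro k
    induction k with
    | zero => exact ⟨by rw [hτz]; linarith, by rw [hτz]; linarith⟩
    | succ k ih =>
      rw [hτs]
      exact ⟨lt_min (hw _ ih.1 ih.2) (by linarith),
        (min_le_right _ _).trans_lt (by linarith)⟩
  have hτb : ∀ k, τ k ≤ ε₁ * (1 / 2) ^ k := by
    intro k
    induction k with
    | zero => rw [hτz, pow_zero]; linarith
    | succ k ih =>
      rw [hτs, pow_succ]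
      exact (min_le_right _ _).trans (by linarith)
  have hτl : Tendsto τ atTop (𝓝 0) := by
    refine squeeze_zero (fun k => (hτ0 k).1.le) hτb ?_
    have := (tendsto_pow_atTop_nhds_zero_of_lt_one (r := (1 / 2 : ℝ)) (by norm_num)
      (by norm_num)).const_mul ε₁
    rwa [mul_zero] at this
  obtain ⟨z, hz'⟩ := exists_mem_chain hf (K := fun k => γ '' Icc (σ (τ k)) (τ k))
    (i := fun k => i (τ k)) (fun k => isCompact_Icc.image hγ.continuous)
    (fun k => (nonempty_Icc.2 (hστ _ (hτ0 k).1 (hτ0 k).2)).image _) (fun k => by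
      refine Subset.trans (image_mono fun a ha => ?_) (hcov _ (hτ0 k).1 (hτ0 k).2)
      exact ⟨(hσ _ (hτ0 (k + 1)).1 (hτ0 (k + 1)).2).trans_le ha.1,
        ha.2.trans ((hτs k).le.trans (min_le_left _ _))⟩)
  refine ⟨z, mem_omegaSet_iff.2 fun U hU N => ?_⟩
  obtain ⟨ε, hε, hεU⟩ := hγ.eventually_mem hU
  obtain ⟨k, hkN, hkε⟩ := ((eventually_ge_atTop N).and (hτl.eventually_lt_const hε)).exists
  refine ⟨∑ j ∈ Finset.range k, i (τ j), ?_, ?_⟩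
  · have : ∑ j ∈ Finset.range k, 1 ≤ ∑ j ∈ Finset.range k, i (τ j) :=
      Finset.sum_le_sum fun j _ => hi _ (hτ0 j).1 (hτ0 j).2
    simp at this
    omega
  · obtain ⟨a, ha, hae⟩ := hz' k
    rw [← hae]
    exact hεU a ((hσ _ (hτ0 k).1 (hτ0 k).2).le.trans ha.1) (ha.2.trans hkε.le)

/-- The closure of the union of all forward images of the germ `α '' Ioc 0 s`. -/
def germHull {G : Type*} [TopologicalSpace G] (f : G → G) (α : ℝ → G) (s : ℝ) : Set G :=
  closure (⋃ i, f^[i] '' (α '' Ioc 0 s))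

/-- The connected component of `α 0` in the hull of the germ `α '' Ioc 0 s`. -/
def germComponent {G : Type*} [TopologicalSpace G] (f : G → G) (α : ℝ → G) (s : ℝ) : Set G :=
  connectedComponentIn (germHull f α s) (α 0)

section Germ

variable {G : Type*} [TopologicalSpace G] {f : G → G} {α β : ℝ → G} {s : ℝ}

theorem IsOpenArc.mem_of_isClosed (hα : IsOpenArc α) {F : Set G} (hF : IsClosed F)
    (h : ∀ s > 0, (α '' Ioc 0 s ∩ F).Nonempty) : α 0 ∈ F := by
  by_contra hcon
  obtain ⟨ε, hε, hεF⟩ := hα.eventually_mem (hF.isOpen_compl.mem_nhds hcon)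
  obtain ⟨_, ⟨t, ht, rfl⟩, hp⟩ := h ε hε
  exact hεF t ht.1.le ht.2 hp

theorem image_iterate_germHull_subset (hf : Continuous f) (i : ℕ) :
    f^[i] '' germHull f α s ⊆ germHull f α s := by
  refine (image_closure_subset_closure_image (hf.iterate i)).trans (closure_mono ?_)
  rw [image_iUnion]
  refine iUnion_subset fun j => ?_
  rw [image_iterate_image]
  exact subset_iUnion (fun k => f^[k] '' (α '' Ioc 0 s)) (i + j)

theorem image_subset_germHull : α '' Ioc 0 s ⊆ germHull f α s := by
  refine Subset.trans ?_ subset_closure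
  exact Subset.trans (by simp) (subset_iUnion (fun k => f^[k] '' (α '' Ioc 0 s)) 0)

theorem germHull_mono {s' : ℝ} (h : s ≤ s') : germHull f α s ⊆ germHull f α s' :=
  closure_mono (iUnion_mono fun _ => image_mono (image_mono (Ioc_subset_Ioc_right h)))

theorem germComponent_mono {s' : ℝ} (h : s ≤ s') :
    germComponent f α s ⊆ germComponent f α s' :=
  connectedComponentIn_mono _ (germHull_mono h)

theorem isClosed_germComponent : IsClosed (germComponent f α s) :=
  isClosed_connectedComponentIn isClosed_closure _

theorem isPreconnected_germComponent : IsPreconnected (germComponent f α s) :=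
  isPreconnected_connectedComponentIn

theorem IsOpenArc.image_subset_germComponent (hα : IsOpenArc α) (hs : 0 < s) :
    α '' Icc 0 s ⊆ germComponent f α s := by
  have h0 : α '' Icc 0 s ⊆ germHull f α s := by
    rw [← closure_Ioc hs.ne]
    refine (image_closure_subset_closure_image hα.continuous).trans ?_
    exact closure_minimal image_subset_germHull isClosed_closure
  exact (isPreconnected_Icc.image _ hα.continuous.continuousOn).subset_connectedComponentIn
    ⟨0, ⟨le_rfl, hs.le⟩, rfl⟩ h0

theorem absorbsReturns_germComponent (hf : Continuous f) :
    AbsorbsReturns f (germComponent f α s) := by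
  rintro i ⟨p, hp, hpC⟩
  have h1 : f^[i] '' germComponent f α s ⊆ connectedComponentIn (germHull f α s) p :=
    (isPreconnected_germComponent.image _
      (hf.iterate i).continuousOn).subset_connectedComponentIn hp
      ((image_mono (connectedComponentIn_subset _ _)).trans (image_iterate_germHull_subset hf i))
  rwa [← connectedComponentIn_eq hpC] at h1

theorem HasJointReturns.exists_germComponent_period (hα : IsOpenArc α) (hf : Continuous f)
    (hR : HasJointReturns f α β) (hs : 0 < s) :
    ∃ q ≥ 1, f^[q] '' germComponent f α s ⊆ germComponent f α s ∧
      (∀ a b, a < q → b < q → a ≠ b →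
        Disjoint (f^[a] '' germComponent f α s) (f^[b] '' germComponent f α s)) ∧
      ∀ i, (f^[i] '' germComponent f α s ∩ germComponent f α s).Nonempty → q ∣ i := by
  refine (absorbsReturns_germComponent hf).exists_period ?_
  obtain ⟨i, hi, ⟨u, hu, hu'⟩, -⟩ := hR s hs 1
  have hsub := (image_mono Ioc_subset_Icc_self).trans (hα.image_subset_germComponent (f := f) hs)
  exact ⟨i, hi, _, ⟨u, hsub hu, rfl⟩, hsub hu'⟩

end Germ

theorem isNSPair_of_germComponent {G : Type*} [TopologicalSpace G] [T2Space G] [CompactSpace G]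
    {n : ℕ} {ψ : Fin n → ℝ → G} (hψ : IsEdgeSystem ψ) {f : G → G} (hf : Continuous f)
    {α β : ℝ → G} (hα : IsOpenArc α) (hβ : IsOpenArc β) (hne : α 0 ≠ β 0)
    (hR : HasJointReturns f α β)
    (hun : ∀ q : ℕ, 1 ≤ q → ∃ s > 0, Disjoint (f^[q] '' germComponent f α s)
      (germComponent f α s)) : IsNSPair f (α 0) (β 0) := by
  choose! t ht0 ht using hun
  set s : ℕ → ℝ := fun k => Nat.rec 1 (fun k r => min r (t (k + 1))) k with hs
  have hsz : s 0 = 1 := rfl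
  have hss : ∀ k, s (k + 1) = min (s k) (t (k + 1)) := fun k => rfl
  have hs0 : ∀ k, 0 < s k := by
    intro k
    induction k with
    | zero => rw [hsz]; exact one_pos
    | succ k ih => rw [hss]; exact lt_min ih (ht0 _ (by omega))
  have hsanti : Antitone s := antitone_nat_of_succ_le fun k => (hss k).le.trans (min_le_left _ _)
  have hst : ∀ k q, 1 ≤ q → q ≤ k → s k ≤ t q := by
    intro k q hq hqk
    refine (hsanti hqk).trans ?_
    obtain ⟨q, rfl⟩ : ∃ r, q = r + 1 := ⟨q - 1, by omega⟩
    exact (hss q).le.trans (min_le_right _ _)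
  set C : ℕ → Set G := fun k => germComponent f α (s k) with hC
  have hCanti : Antitone C := fun a b hab => germComponent_mono (hsanti hab)
  have hCesc : ∀ k q, 1 ≤ q → q ≤ k → Disjoint (f^[q] '' C k) (C k) := fun k q hq hqk =>
    (ht q hq).mono (image_mono (germComponent_mono (hst k q hq hqk)))
      (germComponent_mono (hst k q hq hqk))
  have hCcl : ∀ k, IsClosed (C k) := fun k => isClosed_germComponent
  have hCα : ∀ k, α '' Icc 0 (s k) ⊆ C k := fun k => hα.image_subset_germComponent (hs0 k)
  have hCabs : ∀ k, AbsorbsReturns f (C k) := fun k => absorbsReturns_germComponent hf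
  choose q hq1 hqC hqd hqdvd using fun k => hR.exists_germComponent_period hα hf (hs0 k)
  have hCne : ∀ k, (C k).Nonempty := fun k => ⟨_, hCα k ⟨0, ⟨le_rfl, (hs0 k).le⟩, rfl⟩⟩
  have hqret : ∀ k, (f^[q k] '' C k ∩ C k).Nonempty := fun k => by
    rw [inter_eq_left.2 (hqC k)]
    exact (hCne k).image _
  have hqk : ∀ k, k < q k := by
    intro k
    by_contra hle
    push Not at hle
    obtain ⟨p, hp, hp'⟩ := hqret k
    exact Set.disjoint_left.1 (hCesc k (q k) (hq1 k) hle) hp hp'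
  have hqq : ∀ k, q k ∣ q (k + 1) := by
    intro k
    obtain ⟨p, hp, hp'⟩ := hqret (k + 1)
    exact hqdvd k _ ⟨p, image_mono (hCanti k.le_succ) hp, hCanti k.le_succ hp'⟩
  set J : ℕ → Set G := fun k => ⋂ m, f^[q k * m] '' C k with hJ
  have hJanti : ∀ k, Antitone fun m => f^[q k * m] '' C k := fun k =>
    antitone_nat_of_succ_le fun m => by
      simp only [Nat.mul_succ, ← image_iterate_image]
      exact image_mono (hqC k)
  have hcpt : ∀ k m, IsCompact (f^[m] '' C k) := fun k m =>
    (hCcl k).isCompact.image (hf.iterate m)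
  have hJC : ∀ k, J k ⊆ C k := fun k => (iInter_subset _ 0).trans (by simp)
  have hJcl : ∀ k, IsClosed (J k) := fun k => isClosed_iInter fun m => (hcpt k _).isClosed
  have hJp : ∀ k, IsPreconnected (J k) := fun k =>
    isPreconnected_iInter_of_antitone (hJanti k) (fun m => hcpt k _) fun m =>
      isPreconnected_germComponent.image _ (hf.iterate _).continuousOn
  have hJinv : ∀ k, f^[q k] '' J k = J k := by
    intro k
    rw [hJ, image_iInter_of_antitone (hf.iterate _) (hJanti k) (fun m => hcpt k _)]
    refine Subset.antisymm (subset_iInter fun m => ?_) (subset_iInter fun m => ?_)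
    · refine (iInter_subset _ m).trans ?_
      rw [image_iterate_image, add_comm, ← image_iterate_image]
      exact image_mono (hqC k)
    · refine (iInter_subset _ (m + 1)).trans ?_
      rw [image_iterate_image, Nat.mul_succ, add_comm]
  have hJnest : ∀ k, J (k + 1) ⊆ J k := by
    intro k
    refine subset_iInter fun m => (iInter_subset _ m).trans ?_
    obtain ⟨d, hd⟩ := hqq k
    have hd1 : 1 ≤ d := Nat.one_le_iff_ne_zero.2 fun h => by
      have := hq1 (k + 1)
      rw [hd, h] at this
      omega
    rw [hd, mul_assoc]
    exact (image_mono (hCanti k.le_succ)).trans (hJanti k (Nat.le_mul_of_pos_left m hd1))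
  have hret : ∀ k m, ∀ r > 0, (α '' Ioc 0 r ∩ f^[q k * m] '' C k).Nonempty ∧
      (β '' Ioc 0 r ∩ f^[q k * m] '' C k).Nonempty := by
    intro k m r hr
    obtain ⟨i, hi, ⟨u, hu, hu'⟩, ⟨v, hv, hv'⟩, -⟩ := hR (min r (s k)) (lt_min hr (hs0 k)) (q k * m)
    have hle : ∀ γ : ℝ → G, γ '' Ioc 0 (min r (s k)) ⊆ γ '' Ioc 0 r := fun γ =>
      image_mono (Ioc_subset_Ioc_right (min_le_left _ _))
    have hle' : α '' Ioc 0 (min r (s k)) ⊆ C k :=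
      (image_mono (Ioc_subset_Icc_self.trans (Icc_subset_Icc_right (min_le_right _ _)))).trans
        (hCα k)
    obtain ⟨d, rfl⟩ := hqdvd k i ⟨_, ⟨u, hle' hu, rfl⟩, hle' hu'⟩
    have hmd : m ≤ d := Nat.le_of_mul_le_mul_left hi (hq1 k)
    exact ⟨⟨_, hle α hu', hJanti k hmd ⟨u, hle' hu, rfl⟩⟩,
      ⟨_, hle β hv', hJanti k hmd ⟨v, hle' hv, rfl⟩⟩⟩
  have hxJ : ∀ k, α 0 ∈ J k := fun k => mem_iInter.2 fun m =>
    hα.mem_of_isClosed (hcpt k _).isClosed fun r hr => (hret k m r hr).1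
  have hyJ : ∀ k, β 0 ∈ J k := fun k => mem_iInter.2 fun m =>
    hβ.mem_of_isClosed (hcpt k _).isClosed fun r hr => (hret k m r hr).2
  have hesc : ∀ i ≥ 1, ∃ k, Disjoint (f^[i] '' C k) (C k) := fun i hi =>
    ⟨i, hCesc i i hi le_rfl⟩
  refine ⟨hne, ?_, ?_, J, q, fun k => ⟨⟨hJcl k, ⟨⟨_, hxJ k⟩, hJp k⟩, ?_⟩, hq1 k, hJinv k, ?_⟩,
    hJnest, ?_, fun k => ⟨hxJ k, hyJ k⟩⟩
  · refine mem_omegaUnion_of_germ hf hα (fun k => hJC k (hxJ k)) (fun k => ⟨s k, hs0 k, ?_⟩) hCabs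
      hesc fun r hr => ?_
    · exact (image_mono Ioc_subset_Icc_self).trans (hCα k)
    · obtain ⟨i, hi, h, -⟩ := hR r hr 1
      exact ⟨i, hi, h⟩
  · refine mem_omegaUnion_of_germ hf hβ (fun k => hJC k (hyJ k)) (fun k => ?_) hCabs
      hesc fun r hr => ?_
    · obtain ⟨r, hr0, -, hr | hr⟩ := hβ.dichotomy (C := C k) isPreconnected_germComponent
      · exact ⟨r, hr0, hr⟩
      · obtain ⟨p, hp, hp'⟩ := (hret k 0 r hr0).2
        rw [mul_zero, Function.iterate_zero, image_id] at hp'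
        exact (Set.disjoint_left.1 hr hp hp').elim
    · obtain ⟨i, hi, -, -, -, h⟩ := hR r hr 1
      exact ⟨i, hi, h⟩
  · exact hψ.isTopGraph_coe ⟨⟨_, hxJ k⟩, hJp k⟩ (hJcl k) ⟨_, hxJ k, _, hyJ k, hne⟩
  · exact fun a b ha hb hab => (hqd k a b ha hb hab).mono (image_mono (hJC k)) (image_mono (hJC k))
  · exact tendsto_atTop_mono (fun k => (hqk k).le) tendsto_id

theorem Set.Finite.exists_pos_le_dist {X : Type*} [MetricSpace X] {B : Set X} (hB : B.Finite) :
    ∃ δ > 0, ∀ a ∈ B, ∀ b ∈ B, a ≠ b → δ ≤ dist a b := by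
  by_cases hnt : B.Nontrivial
  · exact ⟨B.infsep, hB.infsep_pos_iff_nontrivial.2 hnt, fun a ha b hb hab =>
      infsep_le_dist_of_mem ha hb hab⟩
  · exact ⟨1, one_pos, fun a ha b hb hab =>
      (hab ((Set.not_nontrivial_iff.1 hnt) ha hb)).elim⟩

theorem HasJointReturns.eq_of_finite_iInter {G : Type*} [MetricSpace G] [CompactSpace G]
    {f : G → G} (hf : Continuous f) {α β : ℝ → G} (hα : IsOpenArc α) (hβ : IsOpenArc β)
    (hR : HasJointReturns f α β) {V : ℕ → Set G} (hV : Antitone V)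
    (hfin : (⋂ n, closure (V n)).Finite)
    (h : ∀ n, ∃ s > 0, ∀ u ∈ α '' Ioc 0 s, ∀ i,
      (f^[i] u ∈ α '' Ioc 0 s ∨ f^[i] u ∈ β '' Ioc 0 s) → ∀ l ≤ i, f^[l] u ∈ V n) :
    α 0 = β 0 := by
  by_contra hne
  have hd : 0 < dist (α 0) (β 0) := dist_pos.2 hne
  obtain ⟨δ, hδ, hsep⟩ := hfin.exists_pos_le_dist
  obtain ⟨η', hη', huc⟩ := Metric.uniformContinuous_iff.1
    (CompactSpace.uniformContinuous_of_continuous hf) (δ / 4) (by positivity)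
  set η := min (min η' (δ / 4)) (dist (α 0) (β 0) / 4) with hη
  have hη0 : 0 < η := lt_min (lt_min hη' (by positivity)) (by positivity)
  have hη1 : η ≤ η' := (min_le_left _ _).trans (min_le_left _ _)
  have hη2 : η ≤ δ / 4 := (min_le_left _ _).trans (min_le_right _ _)
  have hη3 : η ≤ dist (α 0) (β 0) / 4 := min_le_right _ _
  obtain ⟨n, hn⟩ := exists_subset_nhds_of_isCompact
    (U := Metric.thickening η (⋂ n, closure (V n)))
    (V := fun n => closure (V n)) (Antitone.directed_ge fun a b hab => closure_mono (hV hab))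
    (fun n => isClosed_closure.isCompact) (fun p hp =>
      Metric.isOpen_thickening.mem_nhds (Metric.self_subset_thickening hη0 _ hp))
  obtain ⟨s₁, hs₁, hs₁V⟩ := h n
  obtain ⟨s₂, hs₂, hs₂x⟩ := hα.eventually_mem (Metric.ball_mem_nhds (α 0) (half_pos hη0))
  obtain ⟨s₃, hs₃, hs₃y⟩ := hβ.eventually_mem (Metric.ball_mem_nhds (β 0) (half_pos hη0))
  set s := min s₁ (min s₂ s₃) with hs
  have h1 : s ≤ s₁ := min_le_left _ _
  have h2 : s ≤ s₂ := (min_le_right _ _).trans (min_le_left _ _)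
  have h3 : s ≤ s₃ := (min_le_right _ _).trans (min_le_right _ _)
  have hA : ∀ p ∈ α '' Ioc 0 s, dist p (α 0) < η / 2 := by
    rintro _ ⟨t, ht, rfl⟩
    exact hs₂x t ht.1.le (ht.2.trans h2)
  have hB : ∀ p ∈ β '' Ioc 0 s, dist p (β 0) < η / 2 := by
    rintro _ ⟨t, ht, rfl⟩
    exact hs₃y t ht.1.le (ht.2.trans h3)
  obtain ⟨i, -, ⟨u, hu, hui⟩, ⟨v, hv, hvi⟩, -⟩ := hR s (lt_min hs₁ (lt_min hs₂ hs₃)) 0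
  have hmono : ∀ γ : ℝ → G, γ '' Ioc 0 s ⊆ γ '' Ioc 0 s₁ := fun γ =>
    image_mono (Ioc_subset_Ioc_right h1)
  have hnear : ∀ p ∈ V n, ∃ b ∈ ⋂ n, closure (V n), dist p b < η := fun p hp =>
    Metric.mem_thickening_iff.1 (hn (subset_closure hp))
  have huV := hs₁V u (hmono α hu) i (Or.inl (hmono α hui))
  have hvV := hs₁V v (hmono α hv) i (Or.inr (hmono β hvi))
  have key : ∀ l ≤ i, ∃ b ∈ ⋂ n, closure (V n), dist (f^[l] u) b < η ∧ dist (f^[l] v) b < η := by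
    intro l
    induction l with
    | zero =>
      intro hl
      obtain ⟨b, hb, hub⟩ := hnear _ (huV 0 hl)
      obtain ⟨b', hb', hvb⟩ := hnear _ (hvV 0 hl)
      have heq : b = b' := by
        by_contra hbb
        have := hsep b hb b' hb' hbb
        simp only [Function.iterate_zero, id] at hub hvb
        have h4 := dist_triangle4 b u v b'
        have h5 := dist_triangle_right u v (α 0)
        rw [dist_comm b u] at h4
        linarith [hA u hu, hA v hv]
      exact ⟨b, hb, hub, heq ▸ hvb⟩
    | succ l ih =>
      intro hl
      obtain ⟨a, ha, hua, hva⟩ := ih (by omega)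
      obtain ⟨b, hb, hub⟩ := hnear _ (huV (l + 1) hl)
      obtain ⟨b', hb', hvb⟩ := hnear _ (hvV (l + 1) hl)
      have heq : b = b' := by
        by_contra hbb
        have := hsep b hb b' hb' hbb
        have hu1 := huc (hua.trans_le hη1)
        have hv1 := huc (hva.trans_le hη1)
        rw [← Function.iterate_succ_apply' f] at hu1 hv1
        have h4 := dist_triangle4 b (f^[l + 1] u) (f^[l + 1] v) b'
        have h5 := dist_triangle_right (f^[l + 1] u) (f^[l + 1] v) (f a)
        rw [dist_comm b (f^[l + 1] u)] at h4
        simp only [Nat.succ_eq_add_one] at hu1 hv1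
        linarith
      exact ⟨b, hb, hub, heq ▸ hvb⟩
  obtain ⟨b, -, hub, hvb⟩ := key i le_rfl
  have h4 := dist_triangle4 (α 0) (f^[i] u) (f^[i] v) (β 0)
  have h5 := dist_triangle_right (f^[i] u) (f^[i] v) b
  rw [dist_comm (α 0) (f^[i] u)] at h4
  linarith [hA _ hui, hB _ hvi]

theorem exists_iInter_germHull_eq_iUnion {G : Type*} [TopologicalSpace G] [T2Space G]
    [CompactSpace G] {f : G → G} (hf : Continuous f) {α : ℝ → G} (hα : IsOpenArc α)
    {q : ℕ} (hq : 1 ≤ q)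
    (h : ∀ s > 0, (f^[q] '' germComponent f α s ∩ germComponent f α s).Nonempty) :
    ∃ P : Fin q → Set G, (∀ r, IsPreconnected (P r)) ∧
      ⋂ n : ℕ, germHull f α (1 / (n + 1 : ℝ)) = ⋃ r, P r := by
  have hpos : ∀ n : ℕ, (0:ℝ) < 1 / (n + 1 : ℝ) := fun n => by positivity
  have hanti : Antitone fun n : ℕ => (1 / (n + 1 : ℝ)) := fun a b hab =>
    one_div_le_one_div_of_le (by positivity) (by exact_mod_cast Nat.succ_le_succ hab)
  set C : ℕ → Set G := fun n => germComponent f α (1 / (n + 1 : ℝ)) with hC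
  have hCanti : Antitone C := fun a b hab => germComponent_mono (hanti hab)
  have hCc : ∀ n, IsCompact (C n) := fun n => isClosed_germComponent.isCompact
  have hqC : ∀ n, f^[q] '' C n ⊆ C n := fun n => absorbsReturns_germComponent hf q (h _ (hpos n))
  have hhull : ∀ n : ℕ, germHull f α (1 / (n + 1 : ℝ)) = ⋃ r : Fin q, f^[r] '' C n := by
    intro n
    refine Subset.antisymm (closure_minimal (iUnion_subset fun i => ?_) ?_)
      (iUnion_subset fun r => ?_)
    · refine Subset.trans ?_ (subset_iUnion _ (⟨i % q, Nat.mod_lt _ hq⟩ : Fin q))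
      refine (image_mono ((image_mono Ioc_subset_Icc_self).trans
        (hα.image_subset_germComponent (f := f) (hpos n)))).trans ?_
      change f^[i] '' C n ⊆ _
      conv_lhs => rw [← Nat.mod_add_div i q]
      rw [← image_iterate_image]
      exact image_mono (image_iterate_mul_subset (hqC n) _)
    · exact isClosed_iUnion_of_finite fun r => ((hCc n).image (hf.iterate r)).isClosed
    · exact (image_mono (connectedComponentIn_subset _ _)).trans
        (image_iterate_germHull_subset hf r)
  refine ⟨fun r => f^[r] '' ⋂ n, C n, fun r => (isPreconnected_iInter_of_antitone hCanti hCc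
    fun n => isPreconnected_germComponent).image _ (hf.iterate _).continuousOn, ?_⟩
  refine Subset.antisymm (fun p hp => ?_) (iUnion_subset fun r => subset_iInter fun n => ?_)
  · by_contra hcon
    rw [mem_iUnion] at hcon
    push Not at hcon
    have : ∀ r : Fin q, ∃ n, p ∉ f^[r] '' C n := by
      intro r
      have h1 := hcon r
      rw [image_iInter_of_antitone (hf.iterate _) hCanti hCc, mem_iInter] at h1
      push Not at h1
      exact h1
    choose n hn using this
    have h2 := mem_iInter.1 hp (Finset.univ.sup n)
    rw [hhull, mem_iUnion] at h2
    obtain ⟨r, hr⟩ := h2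
    exact hn r (image_mono (hCanti (Finset.le_sup (Finset.mem_univ r))) hr)
  · rw [hhull]
    exact (image_mono (iInter_subset _ n)).trans (subset_iUnion (fun r : Fin q => f^[r] '' C n) r)

/-- Two disjoint germs with joint returns inside the common hull of all the germs
`α '' Ioc 0 s`. -/
structure IsRecurrentPair {G : Type*} [TopologicalSpace G] (f : G → G) (α β : ℝ → G) : Prop where
  arc_left : IsOpenArc α
  arc_right : IsOpenArc β
  disjoint : Disjoint (α '' Icc 0 1) (β '' Icc 0 1)
  returns : HasJointReturns f α β
  hull_eq : ∀ s, 0 < s → s ≤ 1 → germHull f α s = germHull f α 1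
  right_subset : β '' Ioc 0 1 ⊆ germHull f α 1
  orbit_notMem : ∀ k ≥ 1, f^[k] (α 0) = α 0 → ∀ i, f^[i] (α 0) ∉ α '' Ioc 0 1

theorem image_rescale_Ioc {G : Type*} (γ : ℝ → G) {c : ℝ} (hc : 0 < c) (s : ℝ) :
    (fun t => γ (0 + (c - 0) * t)) '' Ioc 0 s = γ '' Ioc 0 (c * s) := by
  have : (fun t => γ (0 + (c - 0) * t)) = γ ∘ fun t => c * t := by ext t; simp
  rw [this, image_comp]
  congr 1
  rw [image_mul_left_Ioc hc, mul_zero]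

section Bounded

variable {G : Type*} [MetricSpace G] [CompactSpace G] {n : ℕ} {ψ : Fin n → ℝ → G} {f : G → G}
  {α β : ℝ → G}

theorem HasJointReturns.exists_subset_iInter_germHull (hψ : IsEdgeSystem ψ) (hf : Continuous f)
    (hα : IsOpenArc α) (hβ : IsOpenArc β) (hne : α 0 ≠ β 0) (hR : HasJointReturns f α β)
    {q : ℕ} (hq : 1 ≤ q)
    (h : ∀ s > 0, (f^[q] '' germComponent f α s ∩ germComponent f α s).Nonempty) :
    ∃ s, 0 < s ∧ α '' Ioc 0 s ⊆ ⋂ n : ℕ, germHull f α (1 / (n + 1 : ℝ)) ∧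
      β '' Ioc 0 s ⊆ ⋂ n : ℕ, germHull f α (1 / (n + 1 : ℝ)) := by
  obtain ⟨N, hN⟩ := hψ.exists_hasFrontierBound
  obtain ⟨P, hP, hX⟩ := exists_iInter_germHull_eq_iUnion hf hα hq h
  set X := ⋂ n : ℕ, germHull f α (1 / (n + 1 : ℝ)) with hXdef
  have hXinv : ∀ i, ∀ p ∈ X, f^[i] p ∈ X := fun i p hp => mem_iInter.2 fun n =>
    image_iterate_germHull_subset hf i ⟨p, mem_iInter.1 hp n, rfl⟩
  have hXcl : IsClosed X := isClosed_iInter fun n => isClosed_closure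
  have hfr : (frontier X).Finite := by
    rw [hX]
    exact finite_of_encard_le_coe (hN.iUnion hP)
  obtain ⟨a, ha0, -, ha⟩ := hα.dichotomy_iUnion hP
  obtain ⟨b, hb0, -, hb⟩ := hβ.dichotomy_iUnion hP
  rw [← hX] at ha hb
  set s := min a b with hs
  have hs0 : 0 < s := lt_min ha0 hb0
  have hsa : ∀ γ : ℝ → G, γ '' Ioc 0 s ⊆ γ '' Ioc 0 a := fun γ =>
    image_mono (Ioc_subset_Ioc_right (min_le_left _ _))
  have hsb : ∀ γ : ℝ → G, γ '' Ioc 0 s ⊆ γ '' Ioc 0 b := fun γ =>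
    image_mono (Ioc_subset_Ioc_right (min_le_right _ _))
  obtain ⟨i, -, -, ⟨u, hu, hui⟩, ⟨v, hv, hvi⟩, -⟩ := hR s hs0 0
  rcases ha with ha | ha
  · refine ⟨s, hs0, (hsa α).trans ha, ?_⟩
    rcases hb with hb | hb
    · exact (hsb β).trans hb
    · exact (Set.disjoint_left.1 hb (hsb β hui) (hXinv i u (ha (hsa α hu)))).elim
  rcases hb with hb | hb
  · exact (Set.disjoint_left.1 ha (hsa α hvi) (hXinv i v (hb (hsb β hv)))).elim
  refine (hne (hR.eq_of_finite_iInter hf hα hβ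
    (V := fun n => germHull f α (1 / (n + 1 : ℝ)) \ X) (fun k l hkl => ?_) ?_ fun k => ?_)).elim
  · refine sdiff_subset_sdiff_left (germHull_mono ?_)
    exact one_div_le_one_div_of_le (by positivity) (by exact_mod_cast Nat.succ_le_succ hkl)
  · refine hfr.subset fun p hp => ?_
    rw [mem_iInter] at hp
    rw [hXcl.frontier_eq]
    refine ⟨mem_iInter.2 fun k => closure_minimal sdiff_subset isClosed_closure (hp k), ?_⟩
    rw [← mem_compl_iff, ← closure_compl]
    exact closure_mono (fun p hp => hp.2) (hp 0)
  · refine ⟨min s (1 / (k + 1 : ℝ)), lt_min hs0 (by positivity), fun u hu i hi l hl => ⟨?_, ?_⟩⟩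
    · exact image_iterate_germHull_subset hf l
        ⟨u, image_subset_germHull (image_mono (Ioc_subset_Ioc_right (min_le_right _ _)) hu), rfl⟩
    · intro hX'
      have h1 := hXinv (i - l) _ hX'
      rw [← Function.iterate_add_apply, Nat.sub_add_cancel hl] at h1
      rcases hi with hi | hi
      · exact Set.disjoint_left.1 ha (hsa α (image_mono (Ioc_subset_Ioc_right
          (min_le_left _ _)) hi)) h1
      · exact Set.disjoint_left.1 hb (hsb β (image_mono (Ioc_subset_Ioc_right
          (min_le_left _ _)) hi)) h1

theorem HasJointReturns.exists_isRecurrentPair (hψ : IsEdgeSystem ψ) (hf : Continuous f)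
    (hα : IsOpenArc α) (hβ : IsOpenArc β) (hne : α 0 ≠ β 0) (hR : HasJointReturns f α β)
    {q : ℕ} (hq : 1 ≤ q)
    (h : ∀ s > 0, (f^[q] '' germComponent f α s ∩ germComponent f α s).Nonempty) :
    ∃ α' β' : ℝ → G, α' 0 = α 0 ∧ β' 0 = β 0 ∧ IsRecurrentPair f α' β' := by
  obtain ⟨s₁, hs₁, hαX, hβX⟩ := hR.exists_subset_iInter_germHull hψ hf hα hβ hne hq h
  obtain ⟨U, V, hU, hV, hxU, hyV, hUV⟩ := t2_separation hne
  obtain ⟨s₂, hs₂, hαU⟩ := hα.eventually_mem (hU.mem_nhds hxU)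
  obtain ⟨s₃, hs₃, hβV⟩ := hβ.eventually_mem (hV.mem_nhds hyV)
  obtain ⟨s₄, hs₄, horb⟩ : ∃ s₄ > 0, ∀ k ≥ 1, f^[k] (α 0) = α 0 → ∀ i, ∀ t, 0 < t → t ≤ s₄ →
      t ≤ 1 → f^[i] (α 0) ≠ α t := by
    by_cases hper : ∃ k ≥ 1, f^[k] (α 0) = α 0
    · obtain ⟨k, hk, hkx⟩ := hper
      have hkx' : Function.IsPeriodicPt f k (α 0) := hkx
      have hfin : ((fun i => f^[i] (α 0)) '' Iio k \ {α 0}).Finite :=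
        ((finite_Iio k).image _).sdiff
      obtain ⟨ε, hε, hεo⟩ := hα.eventually_mem (hfin.isClosed.isOpen_compl.mem_nhds (x := α 0)
        (fun hmem => hmem.2 rfl))
      refine ⟨ε, hε, fun _ _ _ i t ht htε ht1 heq => hεo t ht.le htε ?_⟩
      rw [← heq]
      refine ⟨⟨i % k, Nat.mod_lt _ hk, hkx'.iterate_mod_apply i⟩, fun h0 => ?_⟩
      rw [mem_singleton_iff, heq] at h0
      exact ht.ne' (hα.injOn ⟨ht.le, ht1⟩ ⟨le_rfl, zero_le_one⟩ h0)
    · exact ⟨1, one_pos, fun k hk hkx => (hper ⟨k, hk, hkx⟩).elim⟩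
  set c := min 1 (min (min s₁ s₂) (min s₃ s₄)) with hc
  have hc0 : 0 < c := lt_min one_pos (lt_min (lt_min hs₁ hs₂) (lt_min hs₃ hs₄))
  have hc1 : c ≤ 1 := min_le_left _ _
  have hcs : c ≤ min (min s₁ s₂) (min s₃ s₄) := min_le_right _ _
  have hcs₁ : c ≤ s₁ := hcs.trans ((min_le_left _ _).trans (min_le_left _ _))
  have hcs₂ : c ≤ s₂ := hcs.trans ((min_le_left _ _).trans (min_le_right _ _))
  have hcs₃ : c ≤ s₃ := hcs.trans ((min_le_right _ _).trans (min_le_left _ _))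
  have hcs₄ : c ≤ s₄ := hcs.trans ((min_le_right _ _).trans (min_le_right _ _))
  have hhull : ∀ s, germHull f (fun t => α (0 + (c - 0) * t)) s = germHull f α (c * s) :=
    fun s => by simp only [germHull, image_rescale_Ioc α hc0]
  have hXsub : ∀ s > 0, ⋂ n : ℕ, germHull f α (1 / (n + 1 : ℝ)) ⊆ germHull f α s := by
    intro s hs
    obtain ⟨m, hm⟩ := exists_nat_one_div_lt hs
    exact (iInter_subset _ m).trans (germHull_mono hm.le)
  have hXcl : IsClosed (⋂ n : ℕ, germHull f α (1 / (n + 1 : ℝ))) :=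
    isClosed_iInter fun n => isClosed_closure
  have hXsup : germHull f α c ⊆ ⋂ n : ℕ, germHull f α (1 / (n + 1 : ℝ)) := by
    refine closure_minimal (iUnion_subset fun i => subset_iInter fun m => ?_) hXcl
    refine Subset.trans (image_mono ?_) (image_iterate_germHull_subset hf i)
    exact ((image_mono (Ioc_subset_Ioc_right hcs₁)).trans hαX).trans (iInter_subset _ m)
  have hmem0 : (0:ℝ) ∈ Icc (0:ℝ) 1 := ⟨le_rfl, zero_le_one⟩
  have hct : ∀ t ∈ Icc (0:ℝ) 1, 0 ≤ c * t ∧ c * t ≤ c := fun t ht =>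
    ⟨mul_nonneg hc0.le ht.1, mul_le_of_le_one_right hc0.le ht.2⟩
  refine ⟨fun t => α (0 + (c - 0) * t), fun t => β (0 + (c - 0) * t), by simp, by simp,
    hα.affine hmem0 ⟨hc0.le, hc1⟩ hc0.ne, hβ.affine hmem0 ⟨hc0.le, hc1⟩ hc0.ne, ?_, ?_, ?_, ?_, ?_⟩
  · rw [Set.disjoint_left]
    rintro _ ⟨t, ht, rfl⟩ ⟨t', ht', he⟩
    simp only [zero_add, sub_zero] at he
    obtain ⟨h0, h1⟩ := hct t ht
    obtain ⟨h0', h1'⟩ := hct t' ht'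
    refine Set.disjoint_left.1 hUV (hαU _ h0 (h1.trans hcs₂)) ?_
    rw [← he]
    exact hβV _ h0' (h1'.trans hcs₃)
  · intro s hs L
    simp only [image_rescale_Ioc _ hc0]
    exact hR (c * s) (mul_pos hc0 hs) L
  · intro s hs hs1
    rw [hhull, hhull, mul_one]
    exact (germHull_mono (mul_le_of_le_one_right hc0.le hs1)).antisymm
      (hXsup.trans (hXsub _ (mul_pos hc0 hs)))
  · rw [image_rescale_Ioc _ hc0, hhull, mul_one]
    exact ((image_mono (Ioc_subset_Ioc_right hcs₁)).trans hβX).trans (hXsub c hc0)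
  · intro k hk hkx i
    rw [image_rescale_Ioc _ hc0, mul_one]
    simp only [mul_zero, add_zero] at hkx ⊢
    rintro ⟨t, ht, he⟩
    exact horb k hk hkx i t ht.1 (ht.2.trans hcs₄) (ht.2.trans hc1) he.symm

end Bounded

/-- The forward images of the arcs `α '' Icc s' s` with `0 < s'`. -/
def IsSweep {G : Type*} (f : G → G) (α : ℝ → G) (s : ℝ) (C : Set G) : Prop :=
  ∃ l : ℕ, ∃ s' > 0, C = f^[l] '' (α '' Icc s' s)

/-- No sweep covers `α '' Icc t r`. -/
def IsBlocked {G : Type*} (f : G → G) (α : ℝ → G) (s t r : ℝ) : Prop :=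
  ∀ C, IsSweep f α s C → ¬ α '' Icc t r ⊆ C

/-- Arbitrarily short initial pieces of `α` have sweeps covering every arc
`α '' Icc t r`. -/
def HasSweepCovers {G : Type*} (f : G → G) (α : ℝ → G) (r : ℝ) : Prop :=
  ∀ t, 0 < t → t < r → ∀ s, 0 < s → s ≤ 1 → ¬ IsBlocked f α s t r

theorem IsBlocked.mono {G : Type*} {f : G → G} {α : ℝ → G} {s s₂ t r : ℝ}
    (h : IsBlocked f α s t r) (hs : s₂ ≤ s) : IsBlocked f α s₂ t r := by
  rintro _ ⟨l, s', hs', rfl⟩ hsub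
  exact h _ ⟨l, s', hs', rfl⟩ (hsub.trans (image_mono (image_mono (Icc_subset_Icc_right hs))))

theorem exists_blocked_seq {G : Type*} {f : G → G} {α : ℝ → G}
    (h : ∀ r, 0 < r → r < 1 → ¬ HasSweepCovers f α r)
    {b₀ : ℝ} (hb₀ : 0 < b₀) (hb₁ : b₀ < 1) (N : ℕ) :
    ∃ b : ℕ → ℝ, b 0 = b₀ ∧ (∀ k, 0 < b k) ∧ (∀ k, b (k + 1) < b k) ∧
      ∃ S, 0 < S ∧ S ≤ 1 ∧ ∀ k < N, IsBlocked f α S (b (k + 1)) (b k) := by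
  have h1 : ∀ r, 0 < r → r < 1 → ∃ t s : ℝ, 0 < t ∧ t < r ∧ 0 < s ∧ s ≤ 1 ∧
      IsBlocked f α s t r := by
    intro r hr hr1
    have := h r hr hr1
    unfold HasSweepCovers at this
    push Not at this
    obtain ⟨t, ht, htr, s, hs, hs1, hb⟩ := this
    exact ⟨t, s, ht, htr, hs, hs1, hb⟩
  choose! t s ht htr hs hs1 hbl using h1
  set b : ℕ → ℝ := fun k => t^[k] b₀ with hb
  have hbs : ∀ k, b (k + 1) = t (b k) := fun k => Function.iterate_succ_apply' _ _ _
  have hb01 : ∀ k, 0 < b k ∧ b k < 1 := by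
    intro k
    induction k with
    | zero => exact ⟨hb₀, hb₁⟩
    | succ k ih =>
      rw [hbs]
      exact ⟨ht _ ih.1 ih.2, (htr _ ih.1 ih.2).trans ih.2⟩
  refine ⟨b, rfl, fun k => (hb01 k).1, fun k => ?_, ?_⟩
  · rw [hbs]
    exact htr _ (hb01 k).1 (hb01 k).2
  · induction N with
    | zero => exact ⟨1, one_pos, le_rfl, fun k hk => by omega⟩
    | succ N ih =>
      obtain ⟨S, hS, hS1, hSb⟩ := ih
      refine ⟨min S (s (b N)), lt_min hS (hs _ (hb01 N).1 (hb01 N).2),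
        (min_le_left _ _).trans hS1, fun k hk => ?_⟩
      rcases Nat.lt_succ_iff_lt_or_eq.1 hk with hk | rfl
      · exact (hSb k hk).mono (min_le_left _ _)
      · rw [hbs]
        exact (hbl _ (hb01 k).1 (hb01 k).2).mono (min_le_right _ _)

section Sweep

variable {G : Type*} [TopologicalSpace G] {f : G → G} {α β : ℝ → G} {s t r t' r' : ℝ} {C : Set G}

theorem IsSweep.isPreconnected (hf : Continuous f) (hα : IsOpenArc α) (hC : IsSweep f α s C) :
    IsPreconnected C := by
  obtain ⟨l, s', -, rfl⟩ := hC
  exact (isPreconnected_Icc.image _ hα.continuous.continuousOn).image _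
    (hf.iterate l).continuousOn

theorem IsSweep.subset_of_isBlocked [T2Space G] (hf : Continuous f) (hα : IsOpenArc α)
    (hC : IsSweep f α s C) (h : IsBlocked f α s t r) (h' : IsBlocked f α s t' r')
    (ht : 0 ≤ t) (hr' : r' ≤ 1) (hmeet : (C ∩ α '' Icc r t').Nonempty) : C ⊆ α '' Ioo t r' := by
  obtain ⟨_, hp, p, hpI, rfl⟩ := hmeet
  obtain ⟨_, ⟨q, hq, rfl⟩, hqC⟩ := Set.not_subset.1 (h C hC)
  obtain ⟨_, ⟨q', hq', rfl⟩, hqC'⟩ := Set.not_subset.1 (h' C hC)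
  have h1 : q < p := lt_of_le_of_ne (hq.2.trans hpI.1) fun h => hqC (h ▸ hp)
  have h2 : p < q' := lt_of_le_of_ne (hpI.2.trans hq'.1) fun h => hqC' (h ▸ hp)
  exact (hα.subset_of_isPreconnected (hC.isPreconnected hf hα) (ht.trans hq.1) h1 h2
    (hq'.2.trans hr') hp hqC hqC').trans (image_mono (Ioo_subset_Ioo hq.1 hq'.2))

theorem exists_isSweep_of_mem_germHull (hf : Continuous f) {j : ℕ} {u p : G}
    (hu : u ∈ α '' Ioc 0 s) (hju : f^[j] u ∈ α '' Ioc 0 s) (hp : p ∈ germHull f α s)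
    {U V : Set G} (hU : IsOpen U) (hV : IsOpen V) (hpU : p ∈ U) (hpV : f^[j] p ∈ V) :
    ∃ C C', IsSweep f α s C ∧ IsSweep f α s C' ∧ (C ∩ U).Nonempty ∧ (C' ∩ V).Nonempty ∧
      (C ∩ C').Nonempty := by
  obtain ⟨_, ⟨hwU, hwV⟩, hw⟩ := mem_closure_iff.1 hp (U ∩ f^[j] ⁻¹' V)
    (hU.inter (hV.preimage (hf.iterate j))) ⟨hpU, hpV⟩
  rw [mem_iUnion] at hw
  obtain ⟨l, _, ⟨w, hw, rfl⟩, rfl⟩ := hw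
  obtain ⟨a, ha, rfl⟩ := hu
  obtain ⟨b, hb, hba⟩ := hju
  set s' := min w (min a b) with hs'
  have hw' : α w ∈ α '' Icc s' s := ⟨w, ⟨min_le_left _ _, hw.2⟩, rfl⟩
  have ha' : α a ∈ α '' Icc s' s :=
    ⟨a, ⟨(min_le_right _ _).trans (min_le_left _ _), ha.2⟩, rfl⟩
  have hb' : α b ∈ α '' Icc s' s :=
    ⟨b, ⟨(min_le_right _ _).trans (min_le_right _ _), hb.2⟩, rfl⟩
  have hs0 : 0 < s' := lt_min hw.1 (lt_min ha.1 hb.1)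
  refine ⟨_, _, ⟨l, s', hs0, rfl⟩, ⟨l + j, s', hs0, rfl⟩, ⟨_, ⟨_, hw', rfl⟩, hwU⟩,
    ⟨_, ⟨_, hw', rfl⟩, ?_⟩, ⟨f^[l] (α b), ⟨_, hb', rfl⟩, _, ha', ?_⟩⟩
  · rw [add_comm, Function.iterate_add_apply]
    exact hwV
  · rw [Function.iterate_add_apply, hba]

end Sweep

theorem IsRecurrentPair.exists_hasSweepCovers {G : Type*} [TopologicalSpace G] [T2Space G]
    {f : G → G} (hf : Continuous f) {α β : ℝ → G} (h : IsRecurrentPair f α β) :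
    ∃ r, 0 < r ∧ r < 1 ∧ HasSweepCovers f α r := by
  by_contra! hcon
  have hα := h.arc_left
  obtain ⟨b, hbz, hb0, hbs, S, hS, hS1, hSb⟩ :=
    exists_blocked_seq hcon (b₀ := 1 / 2) (by norm_num) (by norm_num) 10
  have hb : StrictAnti b := strictAnti_nat_of_succ_lt hbs
  have hb1 : ∀ k, b k < 1 := fun k => (hb.antitone (Nat.zero_le k)).trans_lt (by
    rw [hbz]; norm_num)
  have hX : ∀ s, 0 < s → s ≤ 1 → α '' Ioc 0 1 ⊆ germHull f α s ∧ β '' Ioc 0 1 ⊆ germHull f α s := by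
    intro s hs hs1
    rw [h.hull_eq s hs hs1]
    exact ⟨image_subset_germHull, h.right_subset⟩
  have hβα : ∀ p ∈ β '' Ioc 0 1, p ∉ α '' Icc 0 1 := fun p hp hp' =>
    Set.disjoint_left.1 h.disjoint hp' (image_mono Ioc_subset_Icc_self hp)
  set s := min S (b 11) with hs
  have hs0 : 0 < s := lt_min hS (hb0 11)
  have hs1 : s ≤ 1 := (min_le_left _ _).trans hS1
  have hsb : ∀ k ≤ 11, s ≤ b k := fun k hk => (min_le_right _ _).trans (hb.antitone hk)
  have hblk : ∀ k < 10, IsBlocked f α s (b (k + 1)) (b k) := fun k hk =>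
    (hSb k hk).mono (min_le_left _ _)
  have hbar : ∀ l k, k + 1 ≤ l → l < 10 → ∀ C, IsSweep f α s C →
      (C ∩ α '' Icc (b l) (b (k + 1))).Nonempty → C ⊆ α '' Ioo (b (l + 1)) (b k) :=
    fun l k hkl hl C hC hne => hC.subset_of_isBlocked hf hα (hblk l hl) (hblk k (by omega))
      (hb0 _).le (hb1 _).le hne
  obtain ⟨i, -, ⟨u, hu, hui⟩, ⟨_, ⟨τ, hτ, rfl⟩, hwi⟩, ⟨v, hv, rv, hrv, hvi⟩, -⟩ := h.returns s hs0 0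
  have hmono : ∀ γ : ℝ → G, γ '' Ioc 0 s ⊆ γ '' Ioc 0 1 := fun γ =>
    image_mono (Ioc_subset_Ioc_right hs1)
  have hmem : ∀ t, 0 < t → t < 1 → α t ∈ germHull f α s := fun t h0 h1 =>
    (hX s hs0 hs1).1 ⟨t, ⟨h0, h1.le⟩, rfl⟩
  have hclosed : ∀ a b, IsOpen (α '' Icc a b)ᶜ := hα.isOpen_compl_image_Icc
  have himg_mem : f^[i] (α (b 7)) ∈ α '' Icc (b 10) (b 4) := by
    by_contra hno
    obtain ⟨C, C', hC, hC', hCU, hCV, hCC⟩ := exists_isSweep_of_mem_germHull hf hu hui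
      (hmem (b 7) (hb0 7) (hb1 7)) (hα.isOpen (b 8) (b 6) (hb0 8).le (hb1 6).le)
      (hclosed (b 10) (b 4)) ⟨b 7, ⟨hbs 7, hbs 6⟩, rfl⟩ hno
    have h1 := hbar 8 5 (by norm_num) (by norm_num) C hC
      (hCU.mono (inter_subset_inter_right _ (image_mono Ioo_subset_Icc_self)))
    have h2 := hbar 9 4 (by norm_num) (by norm_num) C' hC' (by
      rw [inter_comm] at hCC
      exact hCC.mono (inter_subset_inter_right _ (h1.trans (image_mono Ioo_subset_Icc_self))))
    obtain ⟨p, hp, hpV⟩ := hCV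
    exact hpV (image_mono Ioo_subset_Icc_self (h2 hp))
  have himg_ne : ∀ t, 0 < t → t ≤ b 7 → f^[i] (α t) ≠ α (b 3) := by
    intro t ht ht7 heq
    have ht1 : t < 1 := ht7.trans_lt (hb1 7)
    obtain ⟨C, C', hC, hC', hCU, hCV, hCC⟩ := exists_isSweep_of_mem_germHull hf hu hui
      (hmem t ht ht1) (hclosed (b 6) 1) (hα.isOpen (b 4) (b 2) (hb0 4).le (hb1 2).le)
      (fun hno => by
        rw [hα.mem_image_iff ⟨ht.le, ht1.le⟩ (Icc_subset_Icc_left (hb0 6).le)] at hno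
        exact absurd (hno.1.trans ht7) (not_le.2 (hbs 6)))
      (by rw [heq]; exact ⟨b 3, ⟨hbs 3, hbs 2⟩, rfl⟩)
    have h1 := hbar 4 1 (by norm_num) (by norm_num) C' hC'
      (hCV.mono (inter_subset_inter_right _ (image_mono Ioo_subset_Icc_self)))
    have h2 := hbar 5 0 (by norm_num) (by norm_num) C hC
      (hCC.mono (inter_subset_inter_right _ (h1.trans (image_mono Ioo_subset_Icc_self))))
    obtain ⟨p, hp, hpU⟩ := hCU
    exact hpU (image_mono (Ioo_subset_Icc_self.trans (Icc_subset_Icc_right (hb1 0).le)) (h2 hp))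
  have hτ7 : τ ≤ b 7 := hτ.2.trans (hsb 7 (by norm_num))
  obtain ⟨p, ⟨hτp, hp7⟩, hpv⟩ : ∃ p ∈ Icc τ (b 7), f^[i] (α p) = α rv := by
    obtain ⟨ρ, hρ, hρe⟩ := himg_mem
    set D := f^[i] '' (α '' Icc τ (b 7)) with hD
    have hDp : IsPreconnected D := (isPreconnected_Icc.image _ hα.continuous.continuousOn).image _
      (hf.iterate i).continuousOn
    have hDρ : α ρ ∈ D := by
      rw [hρe]
      exact ⟨_, ⟨b 7, ⟨hτ7, le_rfl⟩, rfl⟩, rfl⟩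
    have hDb : α (b 3) ∉ D := by
      rintro ⟨_, ⟨t, ht, rfl⟩, he⟩
      exact himg_ne t (hτ.1.trans_le ht.1) ht.2 he
    have hrvD : α rv ∈ D := by
      by_contra hno
      have hlt' : rv < ρ := lt_of_le_of_ne ((hrv.2.trans (hsb 10 (by norm_num))).trans hρ.1)
        fun he => hno (he ▸ hDρ)
      have h1 := hα.subset_of_isPreconnected hDp hrv.1.le hlt' (hρ.2.trans_lt (hbs 3)) (hb1 3).le
        hDρ hno hDb
      have h2 : f^[i] (α τ) ∈ D := ⟨_, ⟨τ, ⟨le_rfl, hτ7⟩, rfl⟩, rfl⟩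
      exact hβα _ (hmono β hwi) (image_mono
        (Ioo_subset_Icc_self.trans (Icc_subset_Icc hrv.1.le (hb1 3).le)) (h1 h2))
    obtain ⟨_, ⟨p, hp, rfl⟩, hpe⟩ := hrvD
    exact ⟨p, hp, hpe⟩
  have hp0 : 0 < p := hτ.1.trans_le hτp
  have hp1 : p < 1 := hp7.trans_lt (hb1 7)
  obtain ⟨c, hcz, hc0, hcs, S', hS', hS'1, hS'c⟩ :=
    exists_blocked_seq hcon (b₀ := p / 2) (by linarith) (by linarith) 6
  have hc : StrictAnti c := strictAnti_nat_of_succ_lt hcs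
  have hcp : ∀ k, c k < p := fun k => (hc.antitone (Nat.zero_le k)).trans_lt (by
    rw [hcz]; linarith)
  set s' := min S' s with hs'
  have hs'0 : 0 < s' := lt_min hS' hs0
  have hs'1 : s' ≤ 1 := (min_le_left _ _).trans hS'1
  have hbar' : ∀ l k, l < 6 → k < 10 → ∀ C, IsSweep f α s' C →
      (C ∩ α '' Icc (c l) (b (k + 1))).Nonempty → C ⊆ α '' Ioo (c (l + 1)) (b k) :=
    fun l k hl hk C hC hne => hC.subset_of_isBlocked hf hα ((hS'c l hl).mono (min_le_left _ _))
      ((hblk k hk).mono (min_le_right _ _)) (hc0 _).le (hb1 _).le hne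
  obtain ⟨j, hij, ⟨u', hu', huj⟩, -⟩ := h.returns s' hs'0 i
  have hpX : α p ∈ germHull f α s' := (hX s' hs'0 hs'1).1 ⟨p, ⟨hp0, hp1.le⟩, rfl⟩
  have hvX : v ∈ germHull f α s' := (hX s' hs'0 hs'1).2 (hmono β hv)
  have hp_img_mem : f^[j] (α p) ∈ α '' Icc (c 3) (b 4) := by
    by_contra hno
    obtain ⟨C, C', hC, hC', hCU, hCV, hCC⟩ := exists_isSweep_of_mem_germHull hf hu' huj hpX
      (hα.isOpen (c 1) (b 6) (hc0 1).le (hb1 6).le) (hclosed (c 3) (b 4))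
      ⟨p, ⟨hcp 1, hp7.trans_lt (hbs 6)⟩, rfl⟩ hno
    have h1 := hbar' 1 5 (by norm_num) (by norm_num) C hC
      (hCU.mono (inter_subset_inter_right _ (image_mono Ioo_subset_Icc_self)))
    have h2 := hbar' 2 4 (by norm_num) (by norm_num) C' hC' (by
      rw [inter_comm] at hCC
      exact hCC.mono (inter_subset_inter_right _ (h1.trans (image_mono Ioo_subset_Icc_self))))
    obtain ⟨q, hq, hqV⟩ := hCV
    exact hqV (image_mono Ioo_subset_Icc_self (h2 hq))
  have hjv : f^[j] (α p) = f^[j] v := by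
    obtain ⟨d, rfl⟩ := Nat.exists_eq_add_of_le' hij
    rw [Function.iterate_add_apply, Function.iterate_add_apply, hpv, hvi]
  obtain ⟨C, C', hC, hC', hCU, hCV, hCC⟩ := exists_isSweep_of_mem_germHull hf hu' huj hvX
    (hclosed 0 1) (hα.isOpen (c 4) (b 3) (hc0 4).le (hb1 3).le) (hβα v (hmono β hv)) (by
      rw [← hjv]
      exact image_mono (Icc_subset_Ioo (hcs 3) (hbs 3)) hp_img_mem)
  have h1 := hbar' 4 2 (by norm_num) (by norm_num) C' hC'
    (hCV.mono (inter_subset_inter_right _ (image_mono Ioo_subset_Icc_self)))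
  have h2 := hbar' 5 1 (by norm_num) (by norm_num) C hC
    (hCC.mono (inter_subset_inter_right _ (h1.trans (image_mono Ioo_subset_Icc_self))))
  obtain ⟨q, hq, hqU⟩ := hCU
  exact hqU (image_mono (Ioo_subset_Icc_self.trans (Icc_subset_Icc (hc0 6).le (hb1 1).le)) (h2 hq))

theorem exists_iUnion_iterate_eq {X : Type*} [TopologicalSpace X] {f : X → X} (hf : Continuous f)
    {S : Set X} (hS : IsPreconnected S) {p : ℕ} (hp : 1 ≤ p) (h : (f^[p] '' S ∩ S).Nonempty) :
    ∃ C : Fin p → Set X, (∀ i, IsPreconnected (C i)) ∧ ⋃ j, f^[j] '' S = ⋃ i, C i := by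
  refine ⟨fun ρ => ⋃ k, f^[ρ + p * k] '' S, fun ρ => ?_, ?_⟩
  · refine IsPreconnected.iUnion_of_chain (fun k => hS.image _ (hf.iterate _).continuousOn)
      fun k => ?_
    obtain ⟨_, ⟨u, hu, rfl⟩, hpu⟩ := h
    refine ⟨f^[ρ + p * k] (f^[p] u), ⟨_, hpu, rfl⟩, u, hu, ?_⟩
    rw [← Function.iterate_add_apply, Order.succ_eq_add_one, mul_add_one, add_assoc]
  · ext q
    simp only [mem_iUnion]
    constructor
    · rintro ⟨j, hj⟩
      refine ⟨⟨j % p, Nat.mod_lt _ hp⟩, j / p, ?_⟩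
      rwa [Nat.mod_add_div]
    · rintro ⟨i, k, hq⟩
      exact ⟨_, hq⟩

theorem Set.finite_setOf_eventually_mem {X : Type*} {F : ℕ → Set X} {M : ℕ}
    (hF : ∀ n, (F n).encard ≤ M) : {p | ∀ᶠ n in atTop, p ∈ F n}.Finite := by
  by_contra hinf
  obtain ⟨T, hT, hcard⟩ := Set.Infinite.exists_subset_card_eq hinf (M + 1)
  have hev : ∀ᶠ n in atTop, ∀ p ∈ T, p ∈ F n := (Filter.eventually_all_finset T).2 fun p hp => hT hp
  obtain ⟨n, hn⟩ := hev.exists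
  have := (encard_le_encard (s := (T : Set X)) hn).trans (hF n)
  rw [encard_coe_eq_coe_finsetCard, hcard] at this
  norm_cast at this
  omega

theorem disjoint_closure_iUnion_image {G : Type*} [TopologicalSpace G] {γ : ℝ → G}
    (hγ : IsOpenArc γ) {Z : Set G} {σ : ℝ} (hσ : σ ≤ 1) (h : Disjoint (γ '' Ioc 0 σ) Z) :
    Disjoint (γ '' Ioo 0 σ) (closure Z) :=
  (h.mono_left (image_mono Ioo_subset_Ioc_self)).closure_right (hγ.isOpen 0 σ le_rfl hσ)

section Covers

variable {G : Type*} [MetricSpace G] {f : G → G} {α β : ℝ → G} {r t s : ℝ}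

theorem HasSweepCovers.exists_not_subset (hE : HasSweepCovers f α r) (hf : Continuous f)
    (hα : IsOpenArc α) (hent : Dynamics.coverEntropy f univ = 0) (ht : 0 < t) (htr : t < r)
    (hs : 0 < s) (hs1 : s ≤ 1) :
    ∃ τ, 0 < τ ∧ τ < s ∧ ∀ j ≥ 1, ¬ α '' Icc τ s ⊆ f^[j] '' (α '' Icc t r) := by
  have key : ∀ s, 0 < s → s ≤ 1 → ∃ l, ∃ s' > 0, s' ≤ s ∧
      α '' Icc t r ⊆ f^[l] '' (α '' Icc s' s) := by
    intro s hs hs1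
    have := hE t ht htr s hs hs1
    unfold IsBlocked IsSweep at this
    push Not at this
    obtain ⟨_, ⟨l, s', hs', rfl⟩, hsub⟩ := this
    refine ⟨l, s', hs', ?_, hsub⟩
    obtain ⟨_, ⟨w, hw, -⟩, -⟩ := hsub ⟨t, left_mem_Icc.2 htr.le, rfl⟩
    exact hw.1.trans hw.2
  obtain ⟨l₁, s₁, hs₁, hs₁s, h₁⟩ := key s hs hs1
  obtain ⟨l₂, s₂, hs₂, hs₂s, h₂⟩ := key (s₁ / 2) (by positivity) (by linarith)
  refine ⟨s₂, hs₂, by linarith, fun j hj hsub => ?_⟩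
  have hcl : ∀ a b, IsClosed (α '' Icc a b) := fun a b =>
    (isCompact_Icc.image hα.continuous).isClosed
  have hKc : IsCompact (α '' Icc t r) := isCompact_Icc.image hα.continuous
  have hcov : ∀ l a b, s₂ ≤ a → b ≤ s → α '' Icc t r ⊆ f^[l] '' (α '' Icc a b) →
      α '' Icc t r ⊆ f^[l + j] '' (α '' Icc t r ∩ f^[j] ⁻¹' (α '' Icc a b)) := by
    intro l a b ha hb h
    rw [← image_iterate_image, image_inter_preimage, inter_eq_right.2
      ((image_mono (Icc_subset_Icc ha hb)).trans hsub)]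
    exact h
  refine (coverEntropy_pos_of_cover (f := f) (K := α '' Icc t r)
    (D := α '' Icc t r ∩ f^[j] ⁻¹' (α '' Icc s₁ s))
    (E := α '' Icc t r ∩ f^[j] ⁻¹' (α '' Icc s₂ (s₁ / 2)))
    ⟨_, t, left_mem_Icc.2 htr.le, rfl⟩ inter_subset_left inter_subset_left
    (hKc.inter_right ((hcl _ _).preimage (hf.iterate j)))
    (hKc.inter_right ((hcl _ _).preimage (hf.iterate j))) ?_ (a := l₁ + j) (b := l₂ + j)
    (by omega) (by omega) (hcov _ _ _ (by linarith) le_rfl h₁)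
    (hcov _ _ _ le_rfl (by linarith) h₂)).ne' hent
  rw [Set.disjoint_left]
  rintro p ⟨-, a, ha, hpa⟩ ⟨-, b, hb, hpb⟩
  have := hα.injOn ⟨hs₁.le.trans ha.1, ha.2.trans hs1⟩
    ⟨hs₂.le.trans hb.1, hb.2.trans (by linarith)⟩ (hpa.trans hpb.symm)
  linarith [ha.1, hb.2]

theorem HasSweepCovers.exists_disjoint (hE : HasSweepCovers f α r) (hf : Continuous f)
    (hα : IsOpenArc α) (hent : Dynamics.coverEntropy f univ = 0) (ht : 0 < t) (htr : t < r)
    {j : ℕ} (hj : 1 ≤ j) :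
    ∃ s, 0 < s ∧ s ≤ 1 ∧ Disjoint (α '' Ioc 0 s) (f^[j] '' (α '' Icc t r)) := by
  obtain ⟨s, hs, hs1, h | h⟩ := hα.dichotomy
    ((isPreconnected_Icc.image _ hα.continuous.continuousOn).image _
      (hf.iterate j).continuousOn : IsPreconnected (f^[j] '' (α '' Icc t r)))
  · obtain ⟨τ, hτ, -, hτj⟩ := hE.exists_not_subset hf hα hent ht htr hs hs1
    exact absurd ((image_mono fun w hw => show w ∈ Ioc 0 s from ⟨hτ.trans_le hw.1, hw.2⟩).trans h)
      (hτj j hj)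
  · exact ⟨s, hs, hs1, h⟩

theorem HasSweepCovers.exists_trapped (hE : HasSweepCovers f α r) (hf : Continuous f)
    (hα : IsOpenArc α) (hent : Dynamics.coverEntropy f univ = 0) (ht : 0 < t) (htr : t < r)
    (hs : 0 < s) (hs1 : s ≤ 1) :
    ∃ σ > 0, ∀ j ≥ 1, (α '' Ioc 0 σ ∩ f^[j] '' (α '' Icc t r)).Nonempty →
      f^[j] '' (α '' Icc t r) ⊆ α '' Ioo 0 s := by
  obtain ⟨τ, hτ, hτs, hτj⟩ := hE.exists_not_subset hf hα hent ht htr hs hs1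
  refine ⟨τ / 2, by positivity, ?_⟩
  rintro j hj ⟨_, ⟨p, hp, rfl⟩, hpC⟩
  obtain ⟨_, ⟨q', hq', rfl⟩, hq'C⟩ := Set.not_subset.1 (hτj j hj)
  obtain ⟨σ, hσ, -, hσd⟩ := hE.exists_disjoint hf hα hent ht htr hj
  have hq : α (min σ (p / 2)) ∉ f^[j] '' (α '' Icc t r) := Set.disjoint_left.1 hσd
    ⟨_, ⟨lt_min hσ (half_pos hp.1), min_le_left _ _⟩, rfl⟩
  have hq0 : 0 < min σ (p / 2) := lt_min hσ (half_pos hp.1)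
  refine (hα.subset_of_isPreconnected ((isPreconnected_Icc.image _
    hα.continuous.continuousOn).image _ (hf.iterate j).continuousOn) hq0.le
    ((min_le_right _ _).trans_lt (half_lt_self hp.1)) ?_ (hq'.2.trans hs1) hpC hq hq'C).trans ?_
  · linarith [hp.2, hq'.1]
  · exact image_mono (Ioo_subset_Ioo hq0.le hq'.2)

end Covers

theorem IsRecurrentPair.exists_weak_return {G : Type*} [MetricSpace G] [CompactSpace G] {n : ℕ}
    {ψ : Fin n → ℝ → G} {f : G → G} {α β : ℝ → G} {r : ℝ} (hψ : IsEdgeSystem ψ)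
    (hf : Continuous f) (h : IsRecurrentPair f α β) (hr : 0 < r) (hr1 : r < 1) :
    ∃ t, 0 < t ∧ t < r ∧ ∀ σ > 0, ∃ j, (α '' Ioc 0 σ ∩ f^[j] '' (α '' Icc t r)).Nonempty := by
  by_contra! hcon
  have hα := h.arc_left
  have hβ := h.arc_right
  obtain ⟨N, hN⟩ := hψ.exists_hasFrontierBound
  obtain ⟨p, hp, ⟨_, ⟨a, ha, rfl⟩, b, hb, hab⟩, -⟩ := h.returns r hr 1
  set t₀ := min a b with ht₀
  have ht₀0 : 0 < t₀ := lt_min ha.1 hb.1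
  have ht₀r : t₀ ≤ r := (min_le_left _ _).trans ha.2
  have hchain : ∀ S : Set G, IsPreconnected S → α '' Icc t₀ r ⊆ S →
      ∃ C : Fin p → Set G, (∀ i, IsPreconnected (C i)) ∧ ⋃ j, f^[j] '' S = ⋃ i, C i :=
    fun S hS hsub => exists_iUnion_iterate_eq hf hS hp
      ⟨α b, ⟨α a, hsub ⟨a, ⟨min_le_left _ _, ha.2⟩, rfl⟩, hab.symm⟩,
        hsub ⟨b, ⟨min_le_right _ _, hb.2⟩, rfl⟩⟩
  set t : ℕ → ℝ := fun k => t₀ / (k + 2) with ht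
  have ht0 : ∀ k, 0 < t k := fun k => by positivity
  have htt₀ : ∀ k, t k < t₀ := fun k => by
    rw [ht, div_lt_iff₀ (by positivity)]
    nlinarith [(Nat.cast_nonneg k : (0:ℝ) ≤ k)]
  have htanti : Antitone t := fun i j hij =>
    div_le_div_of_nonneg_left ht₀0.le (by positivity) (by gcongr)
  have htlim : Tendsto t atTop (𝓝 0) :=
    tendsto_const_nhds.div_atTop (tendsto_atTop_add_const_right _ _ tendsto_natCast_atTop_atTop)
  set O : ℕ → Set G := fun k => ⋃ j, f^[j] '' (α '' Icc (t k) r) with hO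
  have hOmono : Monotone O := fun i j hij =>
    iUnion_mono fun l => image_mono (image_mono (Icc_subset_Icc_left (htanti hij)))
  have hOchain : ∀ k, ∃ C : Fin p → Set G, (∀ i, IsPreconnected (C i)) ∧ O k = ⋃ i, C i :=
    fun k => hchain _ (isPreconnected_Icc.image _ hα.continuous.continuousOn)
      (image_mono (Icc_subset_Icc_left (htt₀ k).le))
  have hinv : ∀ i S, f^[i] '' (⋃ j, f^[j] '' S) ⊆ ⋃ j, f^[j] '' S := by
    intro i S
    rw [image_iUnion]
    refine iUnion_subset fun j => ?_
    rw [image_iterate_image]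
    exact subset_iUnion (fun k => f^[k] '' S) (i + j)
  have hclinv : ∀ i S, f^[i] '' closure (⋃ j, f^[j] '' S) ⊆ closure (⋃ j, f^[j] '' S) :=
    fun i S => (image_closure_subset_closure_image (hf.iterate i)).trans (closure_mono (hinv i S))
  have hOα : ∀ k, ∃ σ > 0, Disjoint (α '' Ioc 0 σ) (O k) := by
    intro k
    obtain ⟨σ, hσ, hσd⟩ := hcon (t k) (ht0 k) ((htt₀ k).trans_le ht₀r)
    refine ⟨σ, hσ, disjoint_iUnion_right.2 fun j => ?_⟩
    exact Set.disjoint_iff_inter_eq_empty.2 (hσd j)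
  have hOβ : ∀ k, ∃ σ, 0 < σ ∧ σ ≤ 1 ∧ Disjoint (β '' Ioc 0 σ) (O k) := by
    intro k
    obtain ⟨C, hC, hOC⟩ := hOchain k
    obtain ⟨σ, hσ, hσ1, hsub | hdis⟩ := hβ.dichotomy_iUnion hC
    · exfalso
      obtain ⟨σ', hσ', hd⟩ := hOα k
      obtain ⟨i, -, -, -, ⟨u, hu, hui⟩, -⟩ := h.returns (min σ σ') (lt_min hσ hσ') 0
      refine Set.disjoint_left.1 hd (image_mono (Ioc_subset_Ioc_right (min_le_right _ _)) hui)
        (hinv i _ ⟨u, ?_, rfl⟩)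
      change u ∈ O k
      rw [hOC]
      exact hsub (image_mono (Ioc_subset_Ioc_right (min_le_left _ _)) hu)
    · exact ⟨σ, hσ, hσ1, hOC ▸ hdis⟩
  have hdense : closure (⋃ j, f^[j] '' (α '' Ioc 0 r)) = germHull f α 1 := h.hull_eq r hr hr1.le
  refine Set.disjoint_left.1 h.disjoint ⟨0, left_mem_Icc.2 zero_le_one, rfl⟩
    ⟨0, left_mem_Icc.2 zero_le_one, (h.returns.eq_of_finite_iInter hf hα hβ
      (V := fun k => germHull f α 1 \ closure (O k)) ?_ ?_ ?_).symm⟩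
  · exact fun i j hij => sdiff_le_sdiff_left (closure_mono (hOmono hij))
  · have hfin₁ : (frontier (⋃ j, f^[j] '' (α '' Ioc 0 r))).Finite := by
      obtain ⟨C, hC, hOC⟩ := hchain (α '' Ioc 0 r)
        (isPreconnected_Ioc.image _ hα.continuous.continuousOn)
        (image_mono fun w hw => ⟨ht₀0.trans_le hw.1, hw.2⟩)
      rw [hOC]
      exact finite_of_encard_le_coe (hN.iUnion hC)
    have hfin₂ := Set.finite_setOf_eventually_mem (F := fun k => frontier (O k)) (M := p * N)
      fun k => by
        obtain ⟨C, hC, hOC⟩ := hOchain k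
        simpa only [hOC] using hN.iUnion hC
    refine (hfin₁.union hfin₂).subset fun q hq => ?_
    rw [mem_iInter] at hq
    have hqX : q ∈ germHull f α 1 :=
      closure_minimal sdiff_subset isClosed_closure (hq 0)
    by_cases hqO : q ∈ ⋃ j, f^[j] '' (α '' Ioc 0 r)
    · right
      obtain ⟨j, _, ⟨w, hw, rfl⟩, rfl⟩ := mem_iUnion.1 hqO
      filter_upwards [htlim.eventually (gt_mem_nhds hw.1)] with k hk
      refine ⟨subset_closure (mem_iUnion.2 ⟨j, _, ⟨w, ⟨hk.le, hw.2⟩, rfl⟩, rfl⟩), fun hq_int => ?_⟩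
      have : Disjoint (interior (O k)) (closure (germHull f α 1 \ closure (O k))) :=
        (disjoint_sdiff_right.mono_left (interior_subset.trans subset_closure)).closure_right
          isOpen_interior
      exact Set.disjoint_left.1 this hq_int (hq k)
    · left
      rw [← hdense] at hqX
      exact ⟨hqX, fun hq_int => hqO (interior_subset hq_int)⟩
  · intro k
    obtain ⟨σ, hσ, hσd⟩ := hOα k
    obtain ⟨σ', hσ', hσ'1, hσ'd⟩ := hOβ k
    have hd₁ := disjoint_closure_iUnion_image hα (min_le_right σ 1)
      (hσd.mono_left (image_mono (Ioc_subset_Ioc_right (min_le_left _ _))))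
    have hd₂ := disjoint_closure_iUnion_image hβ hσ'1 hσ'd
    refine ⟨min (min σ 1) σ' / 2, by positivity, fun u hu i hui l hl => ⟨?_, fun hlO => ?_⟩⟩
    · refine image_iterate_germHull_subset hf l ⟨u, image_subset_germHull
        (image_mono (Ioc_subset_Ioc_right ?_) hu), rfl⟩
      linarith [min_le_left (min σ 1) σ', min_le_right σ 1]
    · have hpos : 0 < min (min σ 1) σ' := by positivity
      have hiO : f^[i] u ∈ closure (O k) := hclinv (i - l) _
        ⟨_, hlO, by rw [← Function.iterate_add_apply, Nat.sub_add_cancel hl]⟩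
      rcases hui with hui | hui
      · refine Set.disjoint_left.1 hd₁ (image_mono (Ioc_subset_Ioo_right ?_) hui) hiO
        linarith [min_le_left (min σ 1) σ']
      · refine Set.disjoint_left.1 hd₂ (image_mono (Ioc_subset_Ioo_right ?_) hui) hiO
        linarith [min_le_right (min σ 1) σ']

theorem IsRecurrentPair.iterate_ne_self {G : Type*} [TopologicalSpace G] [T2Space G]
    {f : G → G} {α β : ℝ → G} {r t : ℝ} (h : IsRecurrentPair f α β) (hr1 : r ≤ 1)
    (ht : 0 < t) (htrap : ∀ t', 0 < t' → t' ≤ t → ∀ σ, 0 < σ → σ ≤ 1 → ∃ j ≥ 1,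
      f^[j] '' (α '' Icc t' r) ⊆ α '' Ioo 0 σ)
    {θ : ℝ} (hθ : 0 < θ) (hθr : θ ≤ r) {k : ℕ} (hk : 1 ≤ k) : f^[k] (α θ) ≠ α θ := by
  intro hper
  have horb : ∀ j, f^[j] (α θ) = f^[j % k] (α θ) := fun j =>
    (Function.IsPeriodicPt.iterate_mod_apply (f := f) hper j).symm
  have hfin : ((fun j => f^[j] (α θ)) '' Iio k).Finite := (finite_Iio k).image _
  obtain ⟨j, hj, hjx⟩ := h.arc_left.mem_of_isClosed hfin.isClosed fun s hs => by
    obtain ⟨j, -, hj⟩ := htrap (min θ t) (lt_min hθ ht) (min_le_right _ _) (min s 1)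
      (lt_min hs one_pos) (min_le_right _ _)
    have hmem := hj ⟨_, ⟨θ, ⟨min_le_left _ _, hθr⟩, rfl⟩, rfl⟩
    refine ⟨_, image_mono ?_ hmem, j % k, Nat.mod_lt _ hk, (horb j).symm⟩
    exact fun w hw => ⟨hw.1, hw.2.le.trans (min_le_left _ _)⟩
  simp only at hjx
  refine h.orbit_notMem k hk ?_ (k - j) ?_
  · rw [← hjx, ← Function.iterate_add_apply, add_comm, Function.iterate_add_apply, hper]
  · rw [← hjx, ← Function.iterate_add_apply, Nat.sub_add_cancel (le_of_lt hj), hper]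
    exact ⟨θ, ⟨hθ, hθr.trans hr1⟩, rfl⟩

theorem IsOpenArc.apply_mem_of_forall_ne {G : Type*} [TopologicalSpace G] [T2Space G]
    {F : G → G} {α : ℝ → G} {r t : ℝ} (hF : Continuous F) (hα : IsOpenArc α) (htr : t ≤ r)
    (hr1 : r ≤ 1) (hK : F '' (α '' Icc t r) ⊆ α '' Ioo 0 t)
    (hper : ∀ θ, 0 < θ → θ ≤ r → F (α θ) ≠ α θ)
    (hdis : ∀ t', 0 < t' → t' < r → ∃ s, 0 < s ∧ s ≤ 1 ∧
      Disjoint (α '' Ioc 0 s) (F '' (α '' Icc t' r)))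
    {θ : ℝ} (hθ : 0 < θ) (hθr : θ ≤ r) : F (α θ) ∈ α '' Ioo 0 θ := by
  have htop : ∀ θ, t ≤ θ → θ ≤ r → F (α θ) ∈ α '' Ioo 0 θ := fun θ h1 h2 =>
    image_mono (Ioo_subset_Ioo_right h1) (hK ⟨_, ⟨θ, ⟨h1, h2⟩, rfl⟩, rfl⟩)
  have hcont : Continuous fun θ => F (α θ) := hF.comp hα.continuous
  by_contra hbad
  set B : Set ℝ := {θ | 0 < θ ∧ θ ≤ r ∧ F (α θ) ∉ α '' Ioo 0 θ} with hB
  have hBne : B.Nonempty := ⟨θ, hθ, hθr, hbad⟩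
  have hBt : ∀ w ∈ B, w < t := fun w hw => not_le.1 fun h => hw.2.2 (htop w h hw.2.1)
  have hBdd : BddAbove B := ⟨t, fun w hw => (hBt w hw).le⟩
  set m := sSup B with hm
  have hm0 : 0 < m := hθ.trans_le (le_csSup hBdd ⟨hθ, hθr, hbad⟩)
  have hmt : m ≤ t := csSup_le hBne fun w hw => (hBt w hw).le
  have hgood : ∀ w, m < w → w ≤ r → F (α w) ∈ α '' Ioo 0 w := fun w hw hwr => by
    by_contra hcon
    exact absurd (le_csSup hBdd ⟨hm0.trans hw, hwr, hcon⟩) (not_le.2 hw)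
  have hmB : F (α m) ∉ α '' Ioo 0 m := by
    rintro ⟨c, hc, hcm⟩
    obtain ⟨d, hd⟩ := exists_between hc.2
    have hev : ∀ᶠ w in 𝓝 m, F (α w) ∈ α '' Ioo 0 d ∧ d < w := by
      refine (hcont.continuousAt.eventually ((hα.isOpen 0 d le_rfl ?_).mem_nhds ?_)).and
        (lt_mem_nhds hd.2)
      · linarith [hd.2]
      · simp only
        rw [← hcm]
        exact ⟨c, ⟨hc.1, hd.1⟩, rfl⟩
    obtain ⟨ε, hε, hεm⟩ := Metric.eventually_nhds_iff.1 hev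
    obtain ⟨w, hw, hwm⟩ := exists_lt_of_lt_csSup hBne (by linarith : m - ε < m)
    obtain ⟨h1, h2⟩ := hεm (by
      rw [Real.dist_eq, abs_lt]
      constructor <;> linarith [le_csSup hBdd hw] : dist w m < ε)
    exact hw.2.2 (image_mono (Ioo_subset_Ioo_right h2.le) h1)
  have hmr : m < t := lt_of_le_of_ne hmt fun h => hmB (h ▸ htop t le_rfl htr)
  have hlim : ∀ S : Set G, IsClosed S → (∀ᶠ w in 𝓝[>] m, F (α w) ∈ S) → F (α m) ∈ S :=
    fun S hS hev => hS.mem_of_tendsto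
      (hcont.continuousAt.tendsto.mono_left nhdsWithin_le_nhds) hev
  have hIoo : ∀ w, m < w → w ≤ r → ∀ᶠ v in 𝓝[>] m, F (α v) ∈ α '' Ioo 0 v ∧ m < v ∧ v < w :=
    fun w hw hwr => by
      filter_upwards [Ioo_mem_nhdsGT hw] with v hv
      exact ⟨hgood v hv.1 (hv.2.le.trans hwr), hv.1, hv.2⟩
  have hcl : ∀ a b, IsClosed (α '' Icc a b) := fun a b =>
    (isCompact_Icc.image hα.continuous).isClosed
  obtain ⟨c, hc, hcm⟩ : F (α m) ∈ α '' Icc 0 1 := hlim _ (hcl _ _) <| by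
    filter_upwards [hIoo t hmr htr] with v hv
    exact image_mono (Ioo_subset_Icc_self.trans
      (Icc_subset_Icc_right (by linarith [hv.2.2]))) hv.1
  have hcle : c ≤ m := by
    by_contra! hlt
    obtain ⟨w, hmw, hwc⟩ := exists_between (lt_min hlt hmr)
    have hw1 : w ≤ 1 := by linarith [hwc.trans_le (min_le_right _ _)]
    have := hlim (α '' Icc 0 w) (hcl _ _) <| by
      filter_upwards [hIoo w hmw (by linarith [hwc.trans_le (min_le_right _ _)])] with v hv
      exact image_mono (Ioo_subset_Icc_self.trans (Icc_subset_Icc_right hv.2.2.le)) hv.1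
    rw [← hcm, hα.mem_image_iff hc (Icc_subset_Icc_right hw1)] at this
    linarith [this.2, hwc.trans_le (min_le_left _ _)]
  rcases hcle.lt_or_eq with hlt | rfl
  · rcases hc.1.lt_or_eq with hc0 | rfl
    · exact hmB ⟨c, ⟨hc0, hlt⟩, hcm⟩
    · obtain ⟨s, hs, hs1, hsd⟩ := hdis m hm0 (hmr.trans_le htr)
      have hx : F (α m) ∈ (α '' Icc s 1)ᶜ := by
        rw [← hcm]
        rintro ⟨w, hw, hwe⟩
        have := hα.injOn ⟨hs.le.trans hw.1, hw.2⟩ hc hwe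
        linarith [hw.1]
      have hev := (hcont.continuousAt.eventually ((hα.isOpen_compl_image_Icc s 1).mem_nhds hx)
        ).filter_mono (nhdsWithin_le_nhds (s := Ioi m))
      obtain ⟨v, hv, ⟨w, hw, hwe⟩, hmv, hvt⟩ := (hev.and (hIoo t hmr htr)).exists
      have hws : w < s := not_le.1 fun hle => hv ⟨w, ⟨hle, by linarith [hw.2]⟩, hwe⟩
      exact Set.disjoint_left.1 hsd ⟨w, ⟨hw.1, hws.le⟩, rfl⟩
        ⟨_, ⟨v, ⟨hmv.le, hvt.le.trans htr⟩, rfl⟩, hwe.symm⟩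
  · exact hper _ hm0 (hmt.trans htr) hcm.symm

theorem HasJointReturns.eq_of_invariant {G : Type*} [MetricSpace G] {f : G → G} {α β : ℝ → G}
    {r : ℝ} (hf : Continuous f) (hα : IsOpenArc α) (hβ : IsOpenArc β)
    (hR : HasJointReturns f α β) (hr : 0 < r) {j : ℕ} (hj : 1 ≤ j)
    (h : ∀ s, 0 < s → s ≤ r → f^[j] '' (α '' Ioc 0 s) ⊆ α '' Ioc 0 s) : α 0 = β 0 := by
  by_contra hne
  have hd : 0 < dist (α 0) (β 0) := dist_pos.2 hne
  have hball : ∀ p : G, Metric.ball p (dist (α 0) (β 0) / 4) ∈ 𝓝 p := fun p =>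
    Metric.ball_mem_nhds p (by positivity)
  obtain ⟨s₁, hs₁, h₁⟩ := hα.eventually_mem (U := ⋂ ρ ∈ Finset.range (j + 1),
    f^[ρ] ⁻¹' Metric.ball (f^[ρ] (α 0)) (dist (α 0) (β 0) / 4))
    ((Filter.biInter_finset_mem _).2 fun ρ _ =>
      (hf.iterate ρ).continuousAt.preimage_mem_nhds (hball _))
  obtain ⟨s₂, hs₂, h₂⟩ := hβ.eventually_mem (hball (β 0))
  set s := min r (min s₁ s₂) with hs
  have hs0 : 0 < s := lt_min hr (lt_min hs₁ hs₂)
  obtain ⟨i, -, ⟨u, hu, hui⟩, ⟨v, hv, hvi⟩, -⟩ := hR s hs0 0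
  have hA : ∀ p ∈ α '' Ioc 0 s, ∀ ρ ≤ j,
      dist (f^[ρ] p) (f^[ρ] (α 0)) < dist (α 0) (β 0) / 4 := by
    rintro _ ⟨w, hw, rfl⟩ ρ hρ
    exact mem_iInter₂.1 (h₁ w hw.1.le (hw.2.trans ((min_le_right _ _).trans (min_le_left _ _))))
      ρ (Finset.mem_range_succ_iff.2 hρ)
  have hB : dist (f^[i] v) (β 0) < dist (α 0) (β 0) / 4 := by
    obtain ⟨w, hw, hwe⟩ := hvi
    rw [← hwe]
    exact h₂ w hw.1.le (hw.2.trans ((min_le_right _ _).trans (min_le_right _ _)))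
  have hi : ∀ p ∈ α '' Ioc 0 s, dist (f^[i] p) (f^[i % j] (α 0)) < dist (α 0) (β 0) / 4 := by
    intro p hp
    rw [← Nat.mod_add_div i j, Function.iterate_add_apply, Nat.mod_add_div]
    exact hA _ (image_iterate_mul_subset (h s hs0 (min_le_left _ _)) (i / j) ⟨p, hp, rfl⟩) _
      (Nat.mod_lt _ hj).le
  have h1 := hA _ hui 0 (Nat.zero_le _)
  simp only [Function.iterate_zero, id] at h1
  have h2 := dist_triangle_left (α 0) (f^[i % j] (α 0)) (f^[i] u)
  have h3 := dist_triangle_left (β 0) (f^[i % j] (α 0)) (f^[i] v)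
  have h4 := dist_triangle_right (α 0) (β 0) (f^[i % j] (α 0))
  linarith [hi u hu, hi v hv]

theorem IsRecurrentPair.coverEntropy_ne_zero {G : Type*} [MetricSpace G] [CompactSpace G] {n : ℕ}
    {ψ : Fin n → ℝ → G} {f : G → G} {α β : ℝ → G} (hψ : IsEdgeSystem ψ)
    (hf : Continuous f) (h : IsRecurrentPair f α β) : Dynamics.coverEntropy f univ ≠ 0 := by
  intro hent
  have hα := h.arc_left
  obtain ⟨r, hr, hr1, hE⟩ := h.exists_hasSweepCovers hf
  obtain ⟨t, ht, htr, hret⟩ := h.exists_weak_return hψ hf hr hr1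
  have htrap : ∀ t', 0 < t' → t' ≤ t → ∀ σ, 0 < σ → σ ≤ 1 → ∃ j ≥ 1,
      f^[j] '' (α '' Icc t' r) ⊆ α '' Ioo 0 σ := by
    intro t' ht' htt' σ hσ hσ1
    obtain ⟨σ', hσ', htr'⟩ := hE.exists_trapped hf hα hent ht' (htt'.trans_lt htr) hσ hσ1
    obtain ⟨j, p, ⟨w, hw, rfl⟩, hj⟩ := hret (min σ' (t / 2)) (by positivity)
    have hj1 : 1 ≤ j := by
      by_contra! hj0
      obtain rfl : j = 0 := by omega
      rw [Function.iterate_zero, image_id, hα.mem_image_iff ⟨hw.1.le, ?_⟩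
        fun u hu => ⟨ht.le.trans hu.1, hu.2.trans hr1.le⟩] at hj
      · linarith [hj.1, hw.2.trans (min_le_right _ _)]
      · linarith [hw.2.trans (min_le_right _ _)]
    refine ⟨j, hj1, htr' j hj1 ⟨α w, ⟨w, ⟨hw.1, hw.2.trans (min_le_left _ _)⟩, rfl⟩, ?_⟩⟩
    exact image_mono (image_mono (Icc_subset_Icc_left htt')) hj
  obtain ⟨j, hj, hjt⟩ := htrap t ht le_rfl t ht (htr.le.trans hr1.le)
  refine Set.disjoint_left.1 h.disjoint ⟨0, left_mem_Icc.2 zero_le_one, rfl⟩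
    ⟨0, left_mem_Icc.2 zero_le_one,
      (h.returns.eq_of_invariant hf hα h.arc_right hr hj fun s _ hsr => ?_).symm⟩
  rintro _ ⟨_, ⟨w, hw, rfl⟩, rfl⟩
  refine image_mono ?_ (hα.apply_mem_of_forall_ne (hf.iterate j) htr.le hr1.le hjt
    (fun θ hθ hθr => h.iterate_ne_self hr1.le ht htrap hθ hθr hj)
    (fun t' ht' ht'r => hE.exists_disjoint hf hα hent ht' ht'r hj) hw.1 (hw.2.trans hsr))
  exact fun u hu => ⟨hu.1, hu.2.le.trans hw.2⟩

theorem IsINPair.isNSPair {G : Type*} [MetricSpace G] [CompactSpace G] {n : ℕ}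
    {ψ : Fin n → ℝ → G} (hψ : IsEdgeSystem ψ) {f : G → G} (hf : Continuous f)
    (hent : Dynamics.coverEntropy f univ = 0) {x y : G} (hxy : x ≠ y) (h : IsINPair f x y) :
    IsNSPair f x y := by
  obtain ⟨α, β, hα, hβ, rfl, rfl, hR⟩ := hψ.exists_hasJointReturns hxy h
  by_cases hun : ∀ q : ℕ, 1 ≤ q → ∃ s > 0, Disjoint (f^[q] '' germComponent f α s)
      (germComponent f α s)
  · exact isNSPair_of_germComponent hψ hf hα hβ hxy hR hun
  · push Not at hun
    obtain ⟨q, hq, hmeet⟩ := hun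
    obtain ⟨α', β', -, -, hrec⟩ := hR.exists_isRecurrentPair hψ hf hα hβ hxy hq
      fun s hs => Set.not_disjoint_iff_nonempty_inter.1 (hmeet s hs)
    exact absurd hent (hrec.coverEntropy_ne_zero hψ hf)

theorem IsITPair.isINPair {G : Type*} [TopologicalSpace G] {f : G → G} {x y : G}
    (h : IsITPair f x y) : IsINPair f x y := by
  intro U V hU hV n
  obtain ⟨I, hI, hind⟩ := h U V hU hV
  obtain ⟨T, hT, hcard⟩ := hI.exists_subset_card_eq n
  exact ⟨T, hcard.ge, fun J hJ => hind J (hJ.trans hT)⟩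

namespace IsPeriodicSubgraph

variable {G : Type*} [TopologicalSpace G] {f : G → G} {K : Set G} {k : ℕ}

theorem pos (h : IsPeriodicSubgraph f K k) : 0 < k := h.2.1

theorem image_period (h : IsPeriodicSubgraph f K k) : f^[k] '' K = K := h.2.2.1

theorem isClosed (h : IsPeriodicSubgraph f K k) : IsClosed K := h.1.1

theorem isConnected (h : IsPeriodicSubgraph f K k) : IsConnected K := h.1.2.1

theorem isConnected_image (h : IsPeriodicSubgraph f K k) (hf : Continuous f) (i : ℕ) :
    IsConnected (f^[i] '' K) :=
  h.isConnected.image _ (hf.iterate i).continuousOn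

theorem isClosed_image [T2Space G] [CompactSpace G] (h : IsPeriodicSubgraph f K k)
    (hf : Continuous f) (i : ℕ) : IsClosed (f^[i] '' K) :=
  (h.isClosed.isCompact.image (hf.iterate i)).isClosed

theorem image_add_mul (h : IsPeriodicSubgraph f K k) (i j : ℕ) :
    f^[i + k * j] '' K = f^[i] '' K := by
  induction j with
  | zero => rfl
  | succ j ih => rw [Nat.mul_succ, ← add_assoc, ← image_iterate_image, h.image_period, ih]

theorem image_mod (h : IsPeriodicSubgraph f K k) (i : ℕ) : f^[i % k] '' K = f^[i] '' K := by
  rw [← h.image_add_mul (i % k) (i / k), Nat.mod_add_div]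

theorem mod_eq (h : IsPeriodicSubgraph f K k) {i j : ℕ}
    (hij : (f^[i] '' K ∩ f^[j] '' K).Nonempty) : i % k = j % k := by
  by_contra hne
  rw [← h.image_mod i, ← h.image_mod j] at hij
  exact Set.not_disjoint_iff_nonempty_inter.2 hij
    (h.2.2.2 _ _ (Nat.mod_lt _ h.pos) (Nat.mod_lt _ h.pos) hne)

theorem image_eq (h : IsPeriodicSubgraph f K k) {i j : ℕ}
    (hij : (f^[i] '' K ∩ f^[j] '' K).Nonempty) : f^[i] '' K = f^[j] '' K := by
  rw [← h.image_mod i, ← h.image_mod j, h.mod_eq hij]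

end IsPeriodicSubgraph

/-- A decreasing sequence of periodic subgraphs with unbounded periods. -/
structure IsSolenoidalSeq {G : Type*} [TopologicalSpace G] (f : G → G) (J : ℕ → Set G)
    (m : ℕ → ℕ) : Prop where
  periodic : ∀ n, IsPeriodicSubgraph f (J n) (m n)
  succ_subset : ∀ n, J (n + 1) ⊆ J n
  tendsto : Tendsto m atTop atTop

namespace IsSolenoidalSeq

variable {G : Type*} [TopologicalSpace G] {f : G → G} {J : ℕ → Set G} {m : ℕ → ℕ} {x z : G}

theorem antitone (h : IsSolenoidalSeq f J m) : Antitone J := antitone_nat_of_succ_le h.succ_subset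

theorem exists_period_gt (h : IsSolenoidalSeq f J m) (N M : ℕ) : ∃ n ≥ N, M < m n :=
  ((eventually_ge_atTop N).and (h.tendsto.eventually_gt_atTop M)).exists

theorem injective_orbit (h : IsSolenoidalSeq f J m) (hx : ∀ n, x ∈ J n) :
    Function.Injective fun k => f^[k] x := by
  intro i j hij
  obtain ⟨n, -, hn⟩ := h.exists_period_gt 0 (i + j)
  have := (h.periodic n).mod_eq (i := i) (j := j) ⟨_, ⟨x, hx n, rfl⟩, ⟨x, hx n, hij.symm⟩⟩
  rwa [Nat.mod_eq_of_lt (by omega), Nat.mod_eq_of_lt (by omega)] at this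

/-- An orbit accumulating at a point of all the `J n` is eventually synchronised with
the cycle of each `J n`. -/
theorem exists_phase [T2Space G] [CompactSpace G] {N : ℕ} (hN : HasFrontierBound G N)
    (hf : Continuous f) (h : IsSolenoidalSeq f J m) (hx : ∀ n, x ∈ J n) (hz : x ∈ omegaSet f z)
    (n : ℕ) : ∃ φ e, ∀ k ≥ e, f^[k] z ∈ f^[k + φ] '' J n := by
  set O : Set G := ⋃ i : Fin (m n), f^[(i : ℕ)] '' J n with hO
  have hmemO : ∀ k, f^[k] '' J n ⊆ O := fun k => by
    rw [← (h.periodic n).image_mod k]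
    exact subset_iUnion (fun i : Fin (m n) => f^[(i : ℕ)] '' J n)
      ⟨_, Nat.mod_lt _ (h.periodic n).pos⟩
  have hfin : (frontier O).Finite :=
    finite_of_encard_le_coe (hN.iUnion fun i : Fin (m n) =>
      ((h.periodic n).isConnected_image hf i).isPreconnected)
  obtain ⟨e, he⟩ : ∃ e, f^[e] z ∈ O := by
    by_contra! hno
    refine (infinite_range_of_injective (h.injective_orbit hx)) (hfin.subset ?_)
    rintro _ ⟨k, rfl⟩
    refine ⟨subset_closure (hmemO k ⟨x, hx n, rfl⟩), fun hq_int => ?_⟩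
    obtain ⟨l, -, hl⟩ := mem_omegaSet_iff.1 hz _
      ((hf.iterate k).continuousAt.preimage_mem_nhds (isOpen_interior.mem_nhds hq_int)) 0
    refine hno (k + l) ?_
    rw [Function.iterate_add_apply]
    exact interior_subset hl
  obtain ⟨i, w, hw, hwe⟩ := mem_iUnion.1 he
  refine ⟨i + (m n - 1) * e, e, fun k hk => ?_⟩
  have : k + (i + (m n - 1) * e) = (k - e + i) + m n * e := by
    obtain ⟨c, hc⟩ : ∃ c, m n = c + 1 := ⟨m n - 1, (Nat.sub_add_cancel (h.periodic n).pos).symm⟩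
    obtain ⟨d, rfl⟩ := Nat.exists_eq_add_of_le hk
    simp only [hc, Nat.add_sub_cancel, Nat.add_sub_cancel_left]
    ring
  rw [this, (h.periodic n).image_add_mul]
  refine ⟨w, hw, ?_⟩
  rw [Function.iterate_add_apply, hwe, ← Function.iterate_add_apply, Nat.sub_add_cancel hk]

theorem exists_connected_visits [T2Space G] [CompactSpace G] {ν : ℕ} {ψ : Fin ν → ℝ → G}
    (hψ : IsEdgeSystem ψ) (hf : Continuous f) (h : IsSolenoidalSeq f J m) (hx : ∀ n, x ∈ J n)
    (hz : x ∈ omegaSet f z) {U : Set G} (hU : U ∈ 𝓝 x) (n : ℕ) :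
    ∃ W, IsCompact W ∧ IsPreconnected W ∧ x ∈ W ∧ W ⊆ U ∧ W ⊆ J n ∧ {t | f^[t] z ∈ W}.Infinite := by
  obtain ⟨N, hN⟩ := hψ.exists_hasFrontierBound
  obtain ⟨φ, e, hφ⟩ := h.exists_phase hN hf hx hz n
  obtain ⟨Γ, hΓ, hΓarc, hΓn⟩ := hψ.exists_germs_nhds x
  obtain ⟨β, hβΓ, hβ⟩ : ∃ β ∈ Γ, ∀ s > 0, {t | f^[t] z ∈ β '' Ioc 0 s}.Infinite := by
    by_contra! hcon
    choose! s hs0 hs using hcon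
    obtain ⟨s₀, hs₀, hs₀Γ⟩ : ∃ s₀ : ℝ, 0 < s₀ ∧ ∀ β ∈ Γ, s₀ ≤ s β := by
      rcases Γ.eq_empty_or_nonempty with rfl | hne
      · exact ⟨1, one_pos, by simp⟩
      · obtain ⟨β, hβ, hmin⟩ := Set.exists_min_image Γ s hΓ hne
        exact ⟨s β, hs0 β hβ, hmin⟩
    have hfin : {t | f^[t] z ∈ {x} ∪ ⋃ β ∈ Γ, β '' Ioc 0 s₀}.Finite := by
      refine (Set.Finite.union (?_ : {t | f^[t] z = x}.Finite) (hΓ.biUnion hs)).subset ?_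
      · refine Set.Subsingleton.finite fun a ha b hb => ?_
        change f^[a] z = x at ha
        change f^[b] z = x at hb
        wlog hab : a ≤ b generalizing a b
        · exact (this b a hb ha (by omega)).symm
        · obtain ⟨d, rfl⟩ := Nat.exists_eq_add_of_le hab
          rw [add_comm, Function.iterate_add_apply, ha] at hb
          have : d = 0 := h.injective_orbit hx (a₁ := d) (a₂ := 0) hb
          omega
      · rintro t (ht | ht)
        · exact Or.inl ht
        · obtain ⟨β, hβ, ht⟩ := mem_iUnion₂.1 ht
          exact Or.inr (mem_iUnion₂.2 ⟨β, hβ,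
            image_mono (Ioc_subset_Ioc_right (hs₀Γ β hβ)) ht⟩)
    obtain ⟨b, hb⟩ := hfin.bddAbove
    obtain ⟨t, ht, htz⟩ := mem_omegaSet_iff.1 hz _ (hΓn s₀ hs₀) (b + 1)
    have := hb htz
    omega
  obtain ⟨hβarc, rfl⟩ := hΓarc β hβΓ
  obtain ⟨ε, hε, hεU⟩ := hβarc.eventually_mem hU
  obtain ⟨ε', hε', hεJ⟩ := hβarc.eventually_mem
    (U := (⋃ i : {i : Fin (m n) // (i : ℕ) ≠ 0}, f^[(i : ℕ)] '' J n)ᶜ) (by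
      refine (isClosed_iUnion_of_finite fun i => ?_).isOpen_compl.mem_nhds fun hmem => ?_
      · exact (h.periodic n).isClosed_image hf i
      · obtain ⟨i, hi⟩ := mem_iUnion.1 hmem
        have := (h.periodic n).mod_eq (i := i) (j := 0) ⟨_, hi, _, hx n, rfl⟩
        rw [Nat.mod_eq_of_lt i.1.2, Nat.zero_mod] at this
        exact i.2 this)
  obtain ⟨s, hs, -, hsub⟩ := hβarc.dichotomy (h.periodic n).isConnected.isPreconnected
  have hsub : β '' Ioc 0 s ⊆ J n := by
    refine hsub.resolve_right fun hdis => ?_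
    obtain ⟨t, htβ, hte⟩ := (hβ (min s ε') (lt_min hs hε')).exists_gt e
    obtain ⟨w, hw, hwt⟩ := htβ
    have hout := hεJ w hw.1.le (hw.2.trans (min_le_right _ _))
    have hmem := hφ t hte.le
    rw [← (h.periodic n).image_mod, ← hwt] at hmem
    by_cases h0 : (t + φ) % m n = 0
    · rw [h0, Function.iterate_zero, image_id] at hmem
      exact Set.disjoint_left.1 hdis ⟨w, ⟨hw.1, hw.2.trans (min_le_left _ _)⟩, rfl⟩ hmem
    · exact hout (mem_iUnion.2 ⟨⟨⟨_, Nat.mod_lt _ (h.periodic n).pos⟩, h0⟩, hmem⟩)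
  have hm : 0 < min s ε := lt_min hs hε
  refine ⟨β '' Icc 0 (min s ε), isCompact_Icc.image hβarc.continuous,
    isPreconnected_Icc.image _ hβarc.continuous.continuousOn, ⟨0, left_mem_Icc.2 hm.le, rfl⟩,
    ?_, ?_, (hβ _ hm).mono fun t ht => image_mono Ioc_subset_Icc_self ht⟩
  · rintro _ ⟨w, hw, rfl⟩
    exact hεU w hw.1 (hw.2.trans (min_le_right _ _))
  · rintro _ ⟨w, hw, rfl⟩
    rcases hw.1.lt_or_eq with h0 | rfl
    · exact hsub ⟨w, ⟨h0, hw.2.trans (min_le_left _ _)⟩, rfl⟩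
    · exact hx n

theorem exists_meets [T2Space G] [CompactSpace G] {N : ℕ} (hN : HasFrontierBound G N)
    (hf : Continuous f) (h : IsSolenoidalSeq f J m) (hx : ∀ n, x ∈ J n)
    (hz : x ∈ omegaSet f z) {W : Set G} (hW : {t | f^[t] z ∈ W}.Infinite) :
    ∃ M, ∀ n, M < m n → ∃ e, ∀ s ≥ e, ∀ i₁ i₂, ∃ j < m n, j ≠ i₁ ∧ j ≠ i₂ ∧
      (f^[s] '' W ∩ f^[j] '' J n).Nonempty := by
  obtain ⟨T, hT, hcard⟩ := hW.exists_subset_card_eq 3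
  refine ⟨T.sup id, fun n hn => ?_⟩
  obtain ⟨φ, e, hφ⟩ := h.exists_phase hN hf hx hz n
  refine ⟨e, fun s hs i₁ i₂ => ?_⟩
  have hinj : InjOn (fun t => (s + t + φ) % m n) T := by
    intro a ha b hb hab
    have h1 : a ≤ T.sup id := Finset.le_sup (f := id) ha
    have h2 : b ≤ T.sup id := Finset.le_sup (f := id) hb
    have h3 : a ≡ b [MOD m n] := by
      have : s + a + φ ≡ s + b + φ [MOD m n] := hab
      exact Nat.ModEq.add_left_cancel' s (Nat.ModEq.add_right_cancel' φ this)
    rw [Nat.ModEq, Nat.mod_eq_of_lt (by omega), Nat.mod_eq_of_lt (by omega)] at h3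
    exact h3
  have hlt : ({i₁, i₂} : Finset ℕ).card < (T.image fun t => (s + t + φ) % m n).card := by
    rw [Finset.card_image_of_injOn hinj, hcard]
    exact Nat.lt_succ_of_le Finset.card_le_two
  obtain ⟨j, hj, hjn⟩ := Finset.exists_mem_notMem_of_card_lt_card hlt
  obtain ⟨t, ht, rfl⟩ := Finset.mem_image.1 hj
  simp only [Finset.mem_insert, Finset.mem_singleton, not_or] at hjn
  refine ⟨_, Nat.mod_lt _ (h.periodic n).pos, hjn.1, hjn.2, f^[s + t] z, ?_, ?_⟩
  · rw [Function.iterate_add_apply]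
    exact ⟨_, hT ht, rfl⟩
  · rw [(h.periodic n).image_mod]
    exact hφ _ (by omega)

end IsSolenoidalSeq

theorem exists_pair_separating {A : Finset ℕ} (hA : A.Nontrivial) {P : ℕ → Set ℝ}
    (hne : ∀ i ∈ A, (P i).Nonempty) (hord : ∀ i ∈ A, (P i).OrdConnected)
    (hdis : ∀ i ∈ A, ∀ j ∈ A, i ≠ j → Disjoint (P i) (P j)) :
    ∃ i₁ ∈ A, ∃ i₂ ∈ A, ∀ Q : Set ℝ, Q.OrdConnected → (Q ∩ P i₁).Nonempty →
      (∃ j ∈ A, j ≠ i₁ ∧ j ≠ i₂ ∧ (Q ∩ P j).Nonempty) → P i₂ ⊆ Q := by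
  choose! c hc using hne
  have hlt : ∀ i ∈ A, ∀ j ∈ A, i ≠ j → c i ≤ c j → ∀ a ∈ P i, ∀ b ∈ P j, a < b := by
    intro i hi j hj hij hcij a ha b hb
    by_contra! hba
    rcases le_total b (c i) with h | h
    · exact Set.disjoint_left.1 (hdis i hi j hj hij) (hc i hi)
        ((hord j hj).out hb (hc j hj) ⟨h, hcij⟩)
    · exact Set.disjoint_left.1 (hdis i hi j hj hij)
        ((hord i hi).out (hc i hi) ha ⟨h, hba⟩) hb
  obtain ⟨i₁, hi₁, hmin₁⟩ := A.exists_min_image c hA.nonempty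
  obtain ⟨k, hk, hki⟩ := hA.exists_ne i₁
  obtain ⟨i₂, hi₂, hmin₂⟩ := (A.erase i₁).exists_min_image c ⟨k, Finset.mem_erase.2 ⟨hki, hk⟩⟩
  rw [Finset.mem_erase] at hi₂
  refine ⟨i₁, hi₁, i₂, hi₂.2, ?_⟩
  rintro Q hQ ⟨a, haQ, ha⟩ ⟨j, hj, hj₁, hj₂, b, hbQ, hb⟩ w hw
  exact hQ.out haQ hbQ ⟨(hlt i₁ hi₁ i₂ hi₂.2 hi₂.1.symm (hmin₁ _ hi₂.2) a ha w hw).le,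
    (hlt i₂ hi₂.2 j hj hj₂.symm (hmin₂ j (Finset.mem_erase.2 ⟨hj₁, hj⟩)) w hw b hb).le⟩

theorem IsOpenArc.ordConnected_preimage {G : Type*} [TopologicalSpace G] [T2Space G]
    {γ : ℝ → G} (hγ : IsOpenArc γ) {C : Set G} (hC : IsPreconnected C) (h0 : γ 0 ∉ C) :
    (Icc 0 1 ∩ γ ⁻¹' C).OrdConnected := by
  refine ⟨?_⟩
  rintro p ⟨hp, hpC⟩ w ⟨hw, hwC⟩ q hq
  have hqI : q ∈ Icc (0:ℝ) 1 := ⟨hp.1.trans hq.1, hq.2.trans hw.2⟩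
  refine ⟨hqI, ?_⟩
  by_contra hqC
  have hpq : p < q := hq.1.lt_of_ne fun h => hqC (h ▸ hpC)
  have hp0 : 0 < p := hp.1.lt_of_ne fun h => h0 (h ▸ hpC)
  have := hγ.subset_of_isPreconnected hC le_rfl hp0 hpq hqI.2 hpC h0 hqC hwC
  rw [hγ.mem_image_iff hw fun u hu => ⟨hu.1.le, hu.2.le.trans hqI.2⟩] at this
  exact absurd hq.2 (not_le.2 this.2)

namespace IsSolenoidalSeq

variable {G : Type*} [TopologicalSpace G] [T2Space G] {f : G → G} {J : ℕ → Set G}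
  {m : ℕ → ℕ} {x y z z' : G} {ν : ℕ} {ψ : Fin ν → ℝ → G}

theorem exists_image_subset_edge (hψ : IsEdgeSystem ψ) (hf : Continuous f)
    (h : IsSolenoidalSeq f J m) {n : ℕ} (hn : ν * 2 < m n) :
    ∃ s i, f^[s] '' J n ⊆ ψ i '' Ioo 0 1 := by
  obtain ⟨s, hs⟩ : ∃ s : Fin (m n), ∀ i, ∀ b : Bool,
      ψ i (if b then 0 else 1) ∉ f^[(s : ℕ)] '' J n := by
    by_contra! hcon
    choose i b hib using hcon
    have hinj : Function.Injective fun s => (i s, b s) := by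
      intro s s' hss
      simp only [Prod.mk.injEq] at hss
      have h2 := hib s'
      rw [← hss.1, ← hss.2] at h2
      have := (h.periodic n).mod_eq (i := s) (j := s') ⟨_, hib s, h2⟩
      rwa [Nat.mod_eq_of_lt s.2, Nat.mod_eq_of_lt s'.2, Fin.val_inj] at this
    have := Fintype.card_le_of_injective _ hinj
    simp only [Fintype.card_fin, Fintype.card_prod, Fintype.card_bool] at this
    omega
  have hcon := (h.periodic n).isConnected_image hf s
  exact ⟨s, hψ.subset_edge hcon.isPreconnected hcon.nonempty (fun i => hs i true)
    fun i => hs i false⟩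

theorem exists_common_cover [CompactSpace G] (hψ : IsEdgeSystem ψ) (hf : Continuous f)
    (h : IsSolenoidalSeq f J m) (hx : ∀ n, x ∈ J n) (hy : ∀ n, y ∈ J n)
    (hz : x ∈ omegaSet f z) (hz' : y ∈ omegaSet f z') {n₀ : ℕ} (hn₀ : ν * 2 < m n₀)
    {W W' : Set G} (hW : IsPreconnected W) (hW' : IsPreconnected W') (hxW : x ∈ W) (hyW : y ∈ W')
    (hWJ : W ⊆ J n₀) (hWJ' : W' ⊆ J n₀) (hWz : {t | f^[t] z ∈ W}.Infinite)
    (hWz' : {t | f^[t] z' ∈ W'}.Infinite) :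
    ∃ n ≥ n₀, ∃ T ≥ 1, J n ⊆ f^[T] '' W ∧ J n ⊆ f^[T] '' W' := by
  obtain ⟨N, hN⟩ := hψ.exists_hasFrontierBound
  classical
  obtain ⟨s₀, i, hI⟩ := h.exists_image_subset_edge hψ hf hn₀
  obtain ⟨M, hM⟩ := h.exists_meets hN hf hx hz hWz
  obtain ⟨M', hM'⟩ := h.exists_meets hN hf hy hz' hWz'
  obtain ⟨n, hn, hmn⟩ := h.exists_period_gt n₀ (max M M')
  obtain ⟨e, he⟩ := hM n ((le_max_left _ _).trans_lt hmn)
  obtain ⟨e', he'⟩ := hM' n ((le_max_right _ _).trans_lt hmn)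
  have hJ := h.periodic n
  have hJ₀ := h.periodic n₀
  have hsub : J n ⊆ J n₀ := h.antitone hn
  set I := f^[s₀] '' J n₀ with hIdef
  have h0I : ψ i 0 ∉ I := fun hmem => by
    have := hI hmem
    rw [(hψ.arc i).mem_image_iff ⟨le_rfl, zero_le_one⟩ Ioo_subset_Icc_self] at this
    exact lt_irrefl _ this.1
  have hJI : ∀ j, (f^[j] '' J n ∩ I).Nonempty → f^[j] '' J n₀ = I := fun j hj =>
    hJ₀.image_eq (hj.mono (inter_subset_inter_left _ (image_mono hsub)))
  set A : Finset ℕ := {j ∈ Finset.range (m n) | f^[j] '' J n ⊆ I} with hA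
  have hmemA : ∀ j < m n, (f^[j] '' J n ∩ I).Nonempty → j ∈ A := fun j hj hne => by
    rw [hA, Finset.mem_filter, Finset.mem_range]
    exact ⟨hj, (image_mono hsub).trans (hJI j hne).subset⟩
  have hpos : 0 < m n := hJ.pos
  have hAnt : A.Nontrivial := by
    have hs₁ : e ≤ s₀ + m n₀ * e :=
      (Nat.le_mul_of_pos_left e hJ₀.pos).trans (Nat.le_add_left _ _)
    have key : ∀ j, (f^[s₀ + m n₀ * e] '' W ∩ f^[j] '' J n).Nonempty →
        (f^[j] '' J n ∩ I).Nonempty := fun j hj => by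
      rw [inter_comm] at hj
      refine hj.mono (inter_subset_inter_right _ ?_)
      rw [hIdef, ← hJ₀.image_add_mul s₀ e]
      exact image_mono hWJ
    obtain ⟨j₁, hj₁, -, -, hm₁⟩ := he _ hs₁ 0 0
    obtain ⟨j₂, hj₂, hne, -, hm₂⟩ := he _ hs₁ j₁ j₁
    exact ⟨j₂, hmemA _ hj₂ (key _ hm₂), j₁, hmemA _ hj₁ (key _ hm₁), hne⟩
  have hAI : ∀ j ∈ A, f^[j] '' J n ⊆ I := fun j hj => (Finset.mem_filter.1 hj).2
  have hAlt : ∀ j ∈ A, j < m n := fun j hj => Finset.mem_range.1 (Finset.mem_filter.1 hj).1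
  have hparam : ∀ p ∈ I, ∃ w ∈ Icc (0:ℝ) 1, ψ i w = p := fun p hp => by
    obtain ⟨w, hw, rfl⟩ := hI hp
    exact ⟨w, Ioo_subset_Icc_self hw, rfl⟩
  have hlift : ∀ S S' : Set G, S' ⊆ I → (S ∩ S').Nonempty →
      ((Icc 0 1 ∩ ψ i ⁻¹' S) ∩ (Icc 0 1 ∩ ψ i ⁻¹' S')).Nonempty := by
    rintro S S' hS' ⟨p, hp, hp'⟩
    obtain ⟨w, hw, rfl⟩ := hparam p (hS' hp')
    exact ⟨w, ⟨hw, hp⟩, hw, hp'⟩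
  obtain ⟨i₁, hi₁, i₂, hi₂, hsep⟩ := exists_pair_separating hAnt
    (P := fun j => Icc 0 1 ∩ ψ i ⁻¹' (f^[j] '' J n))
    (fun j hj => (hlift _ _ (hAI j hj) (by
      rw [inter_self]; exact (hJ.isConnected_image hf j).nonempty)).mono inter_subset_left)
    (fun j hj => (hψ.arc i).ordConnected_preimage (hJ.isConnected_image hf j).isPreconnected
      fun hmem => h0I (hAI j hj hmem))
    (fun j hj k hk hjk => by
      rw [Set.disjoint_left]
      rintro w ⟨-, hw⟩ ⟨-, hw'⟩
      have := hJ.mod_eq ⟨_, hw, hw'⟩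
      rw [Nat.mod_eq_of_lt (hAlt j hj), Nat.mod_eq_of_lt (hAlt k hk)] at this
      exact hjk this)
  set s := i₁ + m n * (e + e') with hs
  have hse : e + e' ≤ s := (Nat.le_mul_of_pos_left _ hpos).trans (Nat.le_add_left _ _)
  have hsJ : f^[s] '' J n = f^[i₁] '' J n := hJ.image_add_mul _ _
  have hsI : f^[s] '' J n₀ = I := hJI s <| by
    rw [hsJ, inter_eq_left.2 (hAI i₁ hi₁)]
    exact (hJ.isConnected_image hf i₁).nonempty
  have hcover : ∀ S, IsPreconnected S → S ⊆ J n₀ → (∃ p ∈ S, p ∈ J n) →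
      (∃ j < m n, j ≠ i₁ ∧ j ≠ i₂ ∧ (f^[s] '' S ∩ f^[j] '' J n).Nonempty) →
      J n ⊆ f^[m n - i₂ + s] '' S := by
    rintro S hS hSJ ⟨p, hpS, hpJ⟩ ⟨j, hj, hj₁, hj₂, hmeet⟩
    have hSI : f^[s] '' S ⊆ I := hsI ▸ image_mono hSJ
    have hjA : j ∈ A := hmemA j hj (by
      rw [inter_comm] at hmeet
      exact hmeet.mono (inter_subset_inter_right _ hSI))
    have hsub₂ := hsep (Icc 0 1 ∩ ψ i ⁻¹' (f^[s] '' S))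
      ((hψ.arc i).ordConnected_preimage (hS.image _ (hf.iterate s).continuousOn)
        fun hmem => h0I (hSI hmem))
      (hlift _ _ (hAI i₁ hi₁) ⟨_, ⟨p, hpS, rfl⟩, hsJ ▸ ⟨p, hpJ, rfl⟩⟩)
      ⟨j, hjA, hj₁, hj₂, hlift _ _ (hAI j hjA) hmeet⟩
    have himg : f^[i₂] '' J n ⊆ f^[s] '' S := fun q hq => by
      obtain ⟨w, hw, rfl⟩ := hparam q (hAI i₂ hi₂ hq)
      exact (hsub₂ ⟨hw, hq⟩).2
    have := image_mono (f := f^[m n - i₂]) himg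
    rwa [image_iterate_image, image_iterate_image, Nat.sub_add_cancel (hAlt i₂ hi₂).le,
      hJ.image_period] at this
  have hi₂lt := hAlt i₂ hi₂
  exact ⟨n, hn, m n - i₂ + s, by omega,
    hcover W hW hWJ ⟨x, hxW, hx n⟩ (he s (by omega) i₁ i₂),
    hcover W' hW' hWJ' ⟨y, hyW, hy n⟩ (he' s (by omega) i₁ i₂)⟩

end IsSolenoidalSeq

theorem exists_infinite_isIndepSet {G : Type*} [TopologicalSpace G] [T2Space G] {f : G → G}
    (hf : Continuous f) {U V : Set G} {W W' J : ℕ → Set G} {g T : ℕ → ℕ} {n₀ : ℕ}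
    (hg : ∀ n ≥ n₀, n₀ ≤ g n) (hT : ∀ n ≥ n₀, 1 ≤ T n) (hW : ∀ n, IsCompact (W n))
    (hW' : ∀ n, IsCompact (W' n)) (hne : ∀ n, (W n).Nonempty) (hne' : ∀ n, (W' n).Nonempty)
    (hWU : ∀ n, W n ⊆ U) (hWV : ∀ n, W' n ⊆ V) (hWJ : ∀ n, W n ⊆ J n) (hWJ' : ∀ n, W' n ⊆ J n)
    (hcov : ∀ n ≥ n₀, J (g n) ⊆ f^[T n] '' W n) (hcov' : ∀ n ≥ n₀, J (g n) ⊆ f^[T n] '' W' n) :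
    ∃ I : Set ℕ, I.Infinite ∧ IsIndepSet f U V I := by
  set ν : ℕ → ℕ := fun k => g^[k] n₀ with hν
  have hν0 : ∀ k, n₀ ≤ ν k := by
    intro k
    induction k with
    | zero => exact le_rfl
    | succ k ih =>
      simp only [hν, Function.iterate_succ_apply']
      exact hg _ ih
  set σ : ℕ → ℕ := fun k => ∑ j ∈ Finset.range k, T (ν j) with hσ
  have hσmono : StrictMono σ := strictMono_nat_of_lt_succ fun k => by
    simp only [hσ, Finset.sum_range_succ]
    have := hT _ (hν0 k)
    omega
  refine ⟨range σ, infinite_range_of_injective hσmono.injective,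
    isIndepSet_of_forall_exists fun S => ?_⟩
  obtain ⟨p, hp⟩ := exists_mem_chain hf (K := fun k => if S (σ k) then W (ν k) else W' (ν k))
    (i := fun k => T (ν k)) (fun k => by split_ifs; exacts [hW _, hW' _])
    (fun k => by split_ifs; exacts [hne _, hne' _]) (fun k => by
      have h1 : (if S (σ (k + 1)) then W (ν (k + 1)) else W' (ν (k + 1))) ⊆ J (g (ν k)) := by
        rw [← Function.iterate_succ_apply' g k n₀]
        split_ifs
        exacts [hWJ _, hWJ' _]
      refine h1.trans ?_
      split_ifs
      exacts [hcov _ (hν0 k), hcov' _ (hν0 k)])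
  refine ⟨p, ?_⟩
  rintro _ ⟨k, rfl⟩
  have := hp k
  split_ifs at this ⊢ with hS
  exacts [hWU _ this, hWV _ this]

theorem IsNSPair.isITPair {G : Type*} [TopologicalSpace G] [T2Space G] [CompactSpace G] {ν : ℕ}
    {ψ : Fin ν → ℝ → G} (hψ : IsEdgeSystem ψ) {f : G → G} (hf : Continuous f) {x y : G}
    (h : IsNSPair f x y) : IsITPair f x y := by
  obtain ⟨-, hx, hy, J, m, hper, hsucc, htend, hJ⟩ := h
  obtain ⟨z, hz⟩ := mem_iUnion.1 hx
  obtain ⟨z', hz'⟩ := mem_iUnion.1 hy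
  have hs : IsSolenoidalSeq f J m := ⟨hper, hsucc, htend⟩
  intro U V hU hV
  obtain ⟨n₀, hn₀⟩ := eventually_atTop.1 (htend.eventually_gt_atTop (ν * 2))
  choose W hWc hWp hxW hWU hWJ hWz using
    hs.exists_connected_visits hψ hf (fun n => (hJ n).1) hz hU
  choose W' hWc' hWp' hyW hWV hWJ' hWz' using
    hs.exists_connected_visits hψ hf (fun n => (hJ n).2) hz' hV
  choose! g hg T hT hcov hcov' using fun n (hn : n ≥ n₀) =>
    hs.exists_common_cover hψ hf (fun n => (hJ n).1) (fun n => (hJ n).2) hz hz' (hn₀ n hn)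
      (hWp n) (hWp' n) (hxW n) (hyW n) (hWJ n) (hWJ' n) (hWz n) (hWz' n)
  exact exists_infinite_isIndepSet hf (fun n hn => hn.trans (hg n hn)) hT hWc hWc'
    (fun n => ⟨x, hxW n⟩) (fun n => ⟨y, hyW n⟩) hWU hWV hWJ hWJ' hcov hcov'

/-- For a graph map with zero topological entropy and a non-diagonal pair `⟨x,y⟩`,
being an NS-pair, an IN-pair and an IT-pair are all equivalent. -/
theorem nsPair_iff_inPair_iff_itPair {G : Type*} [MetricSpace G]
    (hG : IsTopGraph G) (f : G → G) (hf : Continuous f)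
    (hent : Dynamics.coverEntropy f Set.univ = 0) (x y : G) (hxy : x ≠ y) :
    (IsNSPair f x y ↔ IsINPair f x y) ∧ (IsINPair f x y ↔ IsITPair f x y) := by
  have : CompactSpace G := hG.1
  obtain ⟨n, ψ, hψ⟩ := hG.exists_edgeSystem
  have hINNS : IsINPair f x y → IsNSPair f x y := fun h => h.isNSPair hψ hf hent hxy
  have hNSIT : IsNSPair f x y → IsITPair f x y := fun h => h.isITPair hψ hf
  have hITIN : IsITPair f x y → IsINPair f x y := fun h => h.isINPair
  exact ⟨⟨fun h => hITIN (hNSIT h), hINNS⟩, ⟨fun h => hNSIT (hINNS h), hITIN⟩⟩
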